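/- Let M be a reductive algebraic monoid with unit group G, and let H ⊆ G be a normal subgroup, closed in M. Then the categorical quotient M//H = Spec(k[M]^H) is an affine algebraic monoid with unit group isomorphic to G/H, and the quotient map π: M → M//H is a morphism of algebraic monoids. -/

import Mathlib

open MvPolynomial

namespace AlgebraicMonoid

variable (k : Type) [Field k] [IsAlgClosed k] (n : ℕ)

/-- `n × n` matrices over `k`: the ambient affine space for linear algebraic monoids. -/
abbrev Mat := Matrix (Fin n) (Fin n) k

/-- Polynomial functions on the space of `n × n` matrices. -/
abbrev MPoly := MvPolynomial (Fin n × Fin n) k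

variable {k n}

/-- Evaluation of a polynomial at a matrix. -/
noncomputable def mEval (x : Mat k n) (p : MPoly k n) : k :=
  eval (fun ij => x ij.1 ij.2) p

/-- The (regular function induced by) `p` vanishes identically on `X`. -/
def VanishesOn (X : Set (Mat k n)) (p : MPoly k n) : Prop :=
  ∀ x ∈ X, mEval x p = 0

/-- Zariski closed subsets of matrix space. -/
def ZClosed (X : Set (Mat k n)) : Prop :=
  ∃ S : Set (MPoly k n), X = {x | ∀ p ∈ S, mEval x p = 0}

/-- An affine (linear) algebraic monoid, realized as a Zariski closed submonoid of
matrix space (every affine algebraic monoid admits such a closed embedding). -/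
structure IsAlgMonoid (M : Set (Mat k n)) : Prop where
  zclosed : ZClosed M
  one_mem : (1 : Mat k n) ∈ M
  mul_mem : ∀ a ∈ M, ∀ b ∈ M, a * b ∈ M

/-- The unit group `G(M)` of the monoid `M`. -/
def unitGroup (M : Set (Mat k n)) : Set (Mat k n) :=
  {g | g ∈ M ∧ ∃ h ∈ M, g * h = 1 ∧ h * g = 1}

/-- `H` is an (abstract) subgroup of `G`. -/
def IsSubgroupOf (H G : Set (Mat k n)) : Prop :=
  H ⊆ G ∧ (1 : Mat k n) ∈ H ∧ (∀ a ∈ H, ∀ b ∈ H, a * b ∈ H) ∧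
    ∀ a ∈ H, ∃ b ∈ H, a * b = 1 ∧ b * a = 1

/-- `Y` is closed in `X` (for the Zariski topology). -/
def IsClosedIn (Y X : Set (Mat k n)) : Prop :=
  Y ⊆ X ∧ ∃ C : Set (Mat k n), ZClosed C ∧ Y = C ∩ X

/-- `X` is irreducible: nonempty, and its vanishing ideal is prime. -/
def IrreducibleSet (X : Set (Mat k n)) : Prop :=
  X.Nonempty ∧ ∀ p q : MPoly k n, VanishesOn X (p * q) → VanishesOn X p ∨ VanishesOn X q

/-- The action of `H` on `M` by left multiplication is observable: every nonzero
`H`-stable ideal of `k[M]` (presented as an ideal of the polynomial ring containing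
the vanishing ideal of `M`) contains a nonzero `H`-invariant function.
Here `H` acts on `k[M]` by `(f · h)(m) = f (h * m)`. -/
def LeftObservable (H M : Set (Mat k n)) : Prop :=
  ∀ J : Ideal (MPoly k n),
    (∀ p : MPoly k n, VanishesOn M p → p ∈ J) →
    (∀ p ∈ J, ∀ h ∈ H, ∃ p' ∈ J, ∀ m ∈ M, mEval m p' = mEval (h * m) p) →
    (∃ p ∈ J, ¬ VanishesOn M p) →
    ∃ p ∈ J, (¬ VanishesOn M p) ∧ ∀ h ∈ H, ∀ m ∈ M, mEval (h * m) p = mEval m p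

/-- `χ` defines a character of (the monoid) `X`, i.e. a regular multiplicative map to `k`. -/
structure IsCharacterOn (X : Set (Mat k n)) (χ : MPoly k n) : Prop where
  map_one : mEval 1 χ = 1
  map_mul : ∀ a ∈ X, ∀ b ∈ X, mEval (a * b) χ = mEval a χ * mEval b χ

/-- The character `χ` of `H` is extendible to `M`: there is a nonzero
`H`-semiinvariant `f ∈ k[M]` of weight `χ`, i.e. `f(h m) = χ(h) f(m)`. -/
def Extendible (M H : Set (Mat k n)) (χ : MPoly k n) : Prop :=
  ∃ f : MPoly k n, (¬ VanishesOn M f) ∧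
    ∀ h ∈ H, ∀ m ∈ M, mEval (h * m) f = mEval h χ * mEval m f

/-- The matrix of regular functions `P` evaluated at `x`: a rational representation. -/
noncomputable def repApply {d : ℕ} (P : Matrix (Fin d) (Fin d) (MPoly k n)) (x : Mat k n) :
    Matrix (Fin d) (Fin d) k :=
  Matrix.of fun i j => mEval x (P i j)

/-- `P` defines a (finite dimensional rational) right `M`-module structure on `k^d`,
the action being `v · x = v ᵥ* (P x)`. -/
def IsRightRep {d : ℕ} (M : Set (Mat k n)) (P : Matrix (Fin d) (Fin d) (MPoly k n)) : Prop :=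
  repApply P 1 = 1 ∧ ∀ a ∈ M, ∀ b ∈ M, repApply P (a * b) = repApply P a * repApply P b


/-- Polynomials on the affine space `k^r` in which the affinized quotient lives. -/
abbrev QPoly (r : ℕ) (k : Type) [CommSemiring k] := MvPolynomial (Fin r) k

/-- Evaluation of polynomials on `k^r`. -/
noncomputable def qEval {k : Type} [CommSemiring k] {r : ℕ} (y : Fin r → k) (p : QPoly r k) : k :=
  eval y p

/-- Zariski closed subsets of `k^r`. -/
def ZClosedQ {k : Type} [CommSemiring k] {r : ℕ} (C : Set (Fin r → k)) : Prop :=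
  ∃ S : Set (QPoly r k), C = {y | ∀ p ∈ S, qEval y p = 0}

/-- Given a tuple `f` of regular functions generating `k[M]^H`, the corresponding
quotient (affinization) map `π : M → k^r`, `π(m) = (f₁(m), …, f_r(m))`. -/
noncomputable def quotMap {k : Type} [Field k] {n r : ℕ}
    (f : Fin r → MPoly k n) (m : Mat k n) : Fin r → k :=
  fun i => mEval m (f i)

/-- The affinized quotient `X//H`, realized as the Zariski closure of the image of the
quotient map in `k^r`. -/
def quotVariety {k : Type} [Field k] {n r : ℕ}
    (f : Fin r → MPoly k n) (X : Set (Mat k n)) : Set (Fin r → k) :=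
  {y | ∀ p : QPoly r k, (∀ m ∈ X, qEval (quotMap f m) p = 0) → qEval y p = 0}

/-- `p` is `H`-invariant as a regular function on `X` (action `(f·h)(x) = f(hx)`). -/
def InvariantOn {k : Type} [Field k] {n : ℕ} (H X : Set (Mat k n)) (p : MPoly k n) : Prop :=
  ∀ h ∈ H, ∀ x ∈ X, mEval (h * x) p = mEval x p

/-- The rational function `p/q` is `H`-invariant on `X`. -/
def RatInvariantOn {k : Type} [Field k] {n : ℕ} (H X : Set (Mat k n)) (p q : MPoly k n) : Prop :=
  ∀ h ∈ H, ∀ x ∈ X, mEval (h * x) p * mEval x q = mEval x p * mEval (h * x) q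

/-- A polynomially-defined multiplication on `k^r`, given by polynomials `μ i` in the
coordinates of the two arguments. -/
noncomputable def mulMap {k : Type} [CommSemiring k] {r : ℕ}
    (μ : Fin r → MvPolynomial (Fin r ⊕ Fin r) k) (y y' : Fin r → k) : Fin r → k :=
  fun i => eval (Sum.elim y y') (μ i)

/-- `H` is a normal subgroup of the group `G`. -/
def IsNormalIn {k : Type} [Field k] {n : ℕ} (H G : Set (Mat k n)) : Prop :=
  ∀ a ∈ G, ∀ b ∈ G, a * b = 1 → b * a = 1 → ∀ h ∈ H, a * h * b ∈ H

/-- `R` is the unipotent radical of the algebraic group `G`: the largest closed,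
connected (irreducible), normal subgroup of `G` all of whose elements are unipotent. -/
def IsUnipotentRadical {k : Type} [Field k] {n : ℕ} (G R : Set (Mat k n)) : Prop :=
  IsSubgroupOf R G ∧ IsClosedIn R G ∧ IrreducibleSet R ∧ IsNormalIn R G ∧
    (∀ x ∈ R, (x - 1) ^ n = 0) ∧
    ∀ R' : Set (Mat k n), IsSubgroupOf R' G → IsClosedIn R' G → IrreducibleSet R' →
      IsNormalIn R' G → (∀ x ∈ R', (x - 1) ^ n = 0) → R' ⊆ R

/-- `G` is a reductive algebraic group: its unipotent radical is trivial, i.e. every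
closed connected normal unipotent subgroup of `G` is trivial. -/
def IsReductiveGroup {k : Type} [Field k] {n : ℕ} (G : Set (Mat k n)) : Prop :=
  ∀ R : Set (Mat k n), IsSubgroupOf R G → IsClosedIn R G → IrreducibleSet R →
    IsNormalIn R G → (∀ x ∈ R, (x - 1) ^ n = 0) → R ⊆ {1}

end AlgebraicMonoid

namespace AlgebraicMonoid

section RightSubstitution

variable {A B : Type*} [CommSemiring A] [CommSemiring B] {R R' J : Type*} [Fintype J]

/-- Right substitution `p ↦ p(Z g)` on polynomials in the entries of a matrix `Z`. -/
noncomputable def rsub (g : Matrix J J A) : MvPolynomial (R × J) A →ₐ[A] MvPolynomial (R × J) A :=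
  aeval fun z => ∑ j, C (g j z.2) * X (z.1, j)

theorem rsub_X (g : Matrix J J A) (z : R × J) :
    rsub g (X z) = ∑ j, C (g j z.2) * X (z.1, j) := by
  simp [rsub]

theorem rsub_C (g : Matrix J J A) (a : A) : rsub g (C a : MvPolynomial (R × J) A) = C a := by
  simp [rsub]

theorem eval_rsub (z : Matrix R J A) (g : Matrix J J A) (p : MvPolynomial (R × J) A) :
    eval (fun x => z x.1 x.2) (rsub g p) = eval (fun x => (z * g) x.1 x.2) p := by
  induction p using MvPolynomial.induction_on with
  | C a => simp
  | add p q hp hq => simp [hp, hq]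
  | mul_X p i hp => simp [hp, rsub_X, Matrix.mul_apply, mul_comm]

theorem rsub_rsub (g h : Matrix J J A) (p : MvPolynomial (R × J) A) :
    rsub g (rsub h p) = rsub (g * h) p := by
  induction p using MvPolynomial.induction_on with
  | C a => simp
  | add p q hp hq => simp [hp, hq]
  | mul_X p i hp =>
    simp only [map_mul, hp, rsub_X, map_sum, rsub_C, Matrix.mul_apply, Finset.mul_sum,
      Finset.sum_mul]
    rw [Finset.sum_comm]
    simp only [mul_assoc, mul_left_comm]

theorem rsub_one [DecidableEq J] (p : MvPolynomial (R × J) A) : rsub 1 p = p := by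
  induction p using MvPolynomial.induction_on with
  | C a => simp
  | add p q hp hq => simp [hp, hq]
  | mul_X p i hp => simp [hp, rsub_X, Matrix.one_apply]

theorem rsub_rename (w : R → R') (g : Matrix J J A) (p : MvPolynomial (R × J) A) :
    rsub g (rename (Prod.map w id) p) = rename (Prod.map w id) (rsub g p) := by
  induction p using MvPolynomial.induction_on with
  | C a => simp
  | add p q hp hq => simp [hp, hq]
  | mul_X p i hp => simp [hp, rsub_X]

theorem map_rsub (φ : A →+* B) (g : Matrix J J A) (p : MvPolynomial (R × J) A) :
    map φ (rsub g p) = rsub (g.map φ) (map φ p) := by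
  induction p using MvPolynomial.induction_on with
  | C a => simp
  | add p q hp hq => simp [hp, hq]
  | mul_X p i hp => simp [hp, rsub_X]

theorem isHomogeneous_rsub {p : MvPolynomial (R × J) A} {d : ℕ} (hp : p.IsHomogeneous d)
    (g : Matrix J J A) : (rsub g p).IsHomogeneous d := by
  have := hp.aeval (fun z : R × J => ∑ j, C (g j z.2) * X (z.1, j)) (n := 1) fun z =>
    IsHomogeneous.sum _ _ _ fun j _ => by
      simpa using (isHomogeneous_C (R × J) (g j z.2)).mul (isHomogeneous_X A (z.1, j))
  simpa [rsub] using this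

end RightSubstitution

section UniversalForm

variable {A : Type*} [CommSemiring A] {σ : Type*} [Fintype σ]

/-- The family of coefficients of a polynomial. -/
def coeffs (p : MvPolynomial σ A) : (σ →₀ ℕ) → A := fun e => coeff e p

open Classical in
/-- The universal form of degree `d`. -/
noncomputable def univForm (σ A : Type*) [Fintype σ] [CommSemiring A] (d : ℕ) :
    MvPolynomial σ (MvPolynomial (σ →₀ ℕ) A) :=
  ∑ e ∈ (Finset.univ : Finset σ).finsuppAntidiag d, monomial e (X e)

theorem map_univForm {d : ℕ} {p : MvPolynomial σ A} (hp : p.IsHomogeneous d) :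
    map (eval (coeffs p)) (univForm σ A d) = p := by
  classical
  ext e
  simp only [univForm, map_sum, map_monomial, coeff_sum, coeff_monomial, eval_X, coeffs]
  rw [Finset.sum_ite_eq' _ e]
  split_ifs with h
  · rfl
  · by_contra hne
    refine h ?_
    rw [Finset.mem_finsuppAntidiag]
    refine ⟨?_, Finset.subset_univ _⟩
    have := hp (Ne.symm hne)
    rw [Finsupp.weight_apply, Finsupp.sum_fintype _ _ (by simp)] at this
    simpa using this

theorem map_constantCoeff_univForm (d : ℕ) :
    map (constantCoeff) (univForm σ A d) = 0 := by
  simp [univForm]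

end UniversalForm

section Apolar

variable {F : Type*} [Field F] {σ : Type*}

/-- The apolar pairing `∑ a! f_a h_a`. -/
noncomputable def apolar (f h : MvPolynomial σ F) : F :=
  ∑ a ∈ f.support, coeff a f * ((a.prod fun _ i => i.factorial : ℕ) : F) * coeff a h

theorem apolar_eq_sum {s : Finset (σ →₀ ℕ)} {f : MvPolynomial σ F} (hs : f.support ⊆ s)
    (h : MvPolynomial σ F) :
    apolar f h = ∑ a ∈ s, coeff a f * ((a.prod fun _ i => i.factorial : ℕ) : F) * coeff a h :=
  Finset.sum_subset hs fun a _ ha => by rw [notMem_support_iff.1 ha]; simp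

theorem apolar_add (f f' h : MvPolynomial σ F) : apolar (f + f') h = apolar f h + apolar f' h := by
  classical
  rw [apolar_eq_sum (s := f.support ∪ f'.support) support_add,
    apolar_eq_sum (s := f.support ∪ f'.support) Finset.subset_union_left,
    apolar_eq_sum (s := f.support ∪ f'.support) Finset.subset_union_right]
  simp [add_mul, Finset.sum_add_distrib]

theorem apolar_monomial (a : σ →₀ ℕ) (c : F) (h : MvPolynomial σ F) :
    apolar (monomial a c) h = c * ((a.prod fun _ i => i.factorial : ℕ) : F) * coeff a h := by
  classical
  rw [apolar_eq_sum (s := {a}) support_monomial_subset]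
  simp

theorem apolar_add_right (f h h' : MvPolynomial σ F) :
    apolar f (h + h') = apolar f h + apolar f h' := by
  simp [apolar, mul_add, Finset.sum_add_distrib]

theorem apolar_C_mul (c : F) (f h : MvPolynomial σ F) : apolar (C c * f) h = c * apolar f h := by
  induction f using MvPolynomial.induction_on' with
  | monomial a b => rw [C_mul_monomial, apolar_monomial, apolar_monomial]; ring
  | add p q hp hq => rw [mul_add, apolar_add, apolar_add, hp, hq, mul_add]

theorem apolar_C_mul_right (c : F) (f h : MvPolynomial σ F) :
    apolar f (C c * h) = c * apolar f h := by
  induction f using MvPolynomial.induction_on' with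
  | monomial a b => rw [apolar_monomial, apolar_monomial, coeff_C_mul]; ring
  | add p q hp hq => rw [apolar_add, apolar_add, hp, hq, mul_add]

theorem apolar_sum {ι : Type*} (s : Finset ι) (f : ι → MvPolynomial σ F) (h : MvPolynomial σ F) :
    apolar (∑ i ∈ s, f i) h = ∑ i ∈ s, apolar (f i) h :=
  map_sum (AddMonoidHom.mk' (fun f => apolar f h) fun f f' => apolar_add f f' h) f s

theorem apolar_sum_right {ι : Type*} (s : Finset ι) (f : MvPolynomial σ F)
    (h : ι → MvPolynomial σ F) : apolar f (∑ i ∈ s, h i) = ∑ i ∈ s, apolar f (h i) :=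
  map_sum (AddMonoidHom.mk' (fun h => apolar f h) fun h h' => apolar_add_right f h h') h s

theorem apolar_mul_X (f h : MvPolynomial σ F) (i : σ) :
    apolar (f * X i) h = apolar f (pderiv i h) := by
  classical
  induction f using MvPolynomial.induction_on' with
  | monomial a b =>
    rw [X, monomial_mul, apolar_monomial, apolar_monomial, coeff_pderiv]
    have : ((a + Finsupp.single i 1).prod fun _ i => i.factorial) =
        (a i + 1) * (a.prod fun _ i => i.factorial) := by
      rw [Finsupp.prod_of_support_subset (s := insert i a.support), Finsupp.prod_of_support_subset a
        (s := insert i a.support), ← Finset.mul_prod_erase _ _ (Finset.mem_insert_self i _),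
        ← Finset.mul_prod_erase (insert i a.support) (fun x => (a x).factorial)
          (Finset.mem_insert_self i _)]
      · rw [← mul_assoc]
        congr 1
        · simp [Nat.factorial_succ]
        · refine Finset.prod_congr rfl fun j hj => ?_
          simp [Finsupp.single_eq_of_ne (Finset.ne_of_mem_erase hj)]
      · exact Finset.subset_insert _ _
      · simp
      · intro j
        simp only [Finsupp.mem_support_iff, Finset.mem_insert, Finsupp.add_apply]
        intro h
        by_contra hc
        push Not at hc
        simp [hc.2, Finsupp.single_eq_of_ne hc.1] at h
      · simp
    rw [this]
    push_cast
    ring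
  | add p q hp hq => rw [add_mul, apolar_add, apolar_add, hp, hq]

variable {R J : Type*} [Fintype J]

theorem pderiv_rsub (g : Matrix J J F) (h : MvPolynomial (R × J) F) (r : R) (j : J) :
    pderiv (r, j) (rsub g h) = ∑ l, C (g j l) * rsub g (pderiv (r, l) h) := by
  classical
  induction h using MvPolynomial.induction_on with
  | C a => simp
  | add p q hp hq => simp [hp, hq, mul_add, Finset.sum_add_distrib]
  | mul_X p z hp =>
    obtain ⟨r', j'⟩ := z
    simp only [map_mul, pderiv_mul, hp, rsub_X, map_add, mul_add, Finset.sum_add_distrib]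
    congr 1
    · rw [Finset.sum_mul]
      exact Finset.sum_congr rfl fun l _ => by ring
    · simp only [map_sum, pderiv_C_mul, pderiv_X, Pi.single_apply, Prod.mk.injEq]
      by_cases hr : r' = r
      · subst hr
        simp [apply_ite (rsub g), mul_comm, eq_comm]
      · simp [hr]

theorem apolar_rsub (g : Matrix J J F) (f h : MvPolynomial (R × J) F) :
    apolar (rsub g f) h = apolar f (rsub g.transpose h) := by
  induction f using MvPolynomial.induction_on generalizing h with
  | C a =>
    rw [rsub_C, C_apply, apolar_monomial, apolar_monomial]
    congr 1
    induction h using MvPolynomial.induction_on with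
    | C a => simp
    | add p q hp hq => simp [hp, hq]
    | mul_X p z hp =>
      change constantCoeff _ = constantCoeff _
      rw [map_mul, map_mul, map_mul, rsub_X]
      simp
  | add p q hp hq => simp only [map_add, apolar_add, hp, hq]
  | mul_X p z hp =>
    obtain ⟨r, j⟩ := z
    rw [apolar_mul_X, map_mul, rsub_X, Finset.mul_sum, apolar_sum, pderiv_rsub, apolar_sum_right]
    refine Finset.sum_congr rfl fun l _ => ?_
    rw [mul_left_comm, apolar_C_mul, apolar_mul_X, hp, apolar_C_mul_right, Matrix.transpose_apply]

theorem apolar_self_intCast_ne_zero [CharZero F] (f : MvPolynomial σ ℤ) (hf : f ≠ 0) :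
    apolar (map (Int.castRingHom F) f) (map (Int.castRingHom F) f) ≠ 0 := by
  have h1 : apolar (map (Int.castRingHom F) f) (map (Int.castRingHom F) f) =
      ((∑ a ∈ f.support, (((a.prod fun _ i => i.factorial : ℕ) : ℤ) * (coeff a f) ^ 2) : ℤ) : F) := by
    unfold apolar
    rw [support_map_of_injective _ (Int.cast_injective)]
    push_cast
    refine Finset.sum_congr rfl fun a _ => ?_
    simp only [coeff_map, eq_intCast]
    ring
  rw [h1, Int.cast_ne_zero]
  refine (Finset.sum_pos (fun a ha => ?_) (support_nonempty.2 hf)).ne'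
  have : 0 < (a.prod fun _ i => i.factorial) := Finset.prod_pos fun i _ => Nat.factorial_pos _
  have h3 : coeff a f ≠ 0 := mem_support_iff.1 ha
  positivity

end Apolar

/-- The generic determinant. -/
noncomputable def genDet (n : ℕ) (A : Type*) [CommRing A] : MvPolynomial (Fin n × Fin n) A :=
  (Matrix.of fun i j => X (i, j)).det

theorem genDet_isHomogeneous (n : ℕ) (A : Type*) [CommRing A] : (genDet n A).IsHomogeneous n := by
  rw [genDet, Matrix.det_apply]
  refine IsHomogeneous.sum _ _ _ fun σ _ => ?_
  rw [Units.smul_def, zsmul_eq_mul, ← map_intCast (C : A →+* MvPolynomial (Fin n × Fin n) A)]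
  have h := IsHomogeneous.prod Finset.univ (fun i => (X (σ i, i) : MvPolynomial (Fin n × Fin n) A))
    (fun _ => 1) fun i _ => isHomogeneous_X A (σ i, i)
  simpa using (isHomogeneous_C (Fin n × Fin n) ((Equiv.Perm.sign σ : ℤ) : A)).mul h

theorem map_genDet {n : ℕ} {A B : Type*} [CommRing A] [CommRing B] (φ : A →+* B) :
    map φ (genDet n A) = genDet n B := by
  rw [genDet, RingHom.map_det, genDet]
  congr 1
  ext1 i j
  simp

theorem eval_genDet {n : ℕ} {A : Type*} [CommRing A] (z : Matrix (Fin n) (Fin n) A) :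
    eval (fun x => z x.1 x.2) (genDet n A) = z.det := by
  rw [genDet, RingHom.map_det]
  congr 1
  ext i j
  simp

theorem rsub_genDet {n : ℕ} {A : Type*} [CommRing A] (g : Matrix (Fin n) (Fin n) A) :
    rsub g (genDet n A) = C g.det * genDet n A := by
  rw [genDet, AlgHom.map_det, RingHom.map_det, mul_comm, ← Matrix.det_mul]
  congr 1
  ext1 i j
  simp [Matrix.mul_apply, rsub_X, mul_comm]

theorem genDet_ne_zero (n : ℕ) (A : Type*) [CommRing A] [Nontrivial A] : genDet n A ≠ 0 := by
  intro h
  have := eval_genDet (1 : Matrix (Fin n) (Fin n) A)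
  rw [h] at this
  simp at this

/-- Evaluate an invariant at the coefficients. -/
def IsSLFunctional {F : Type*} [Field F] (n J : ℕ)
    (Φ : MvPolynomial ((Fin n × Fin n) →₀ ℕ) F) : Prop :=
  constantCoeff Φ = 0 ∧
    (∀ (p : MvPolynomial (Fin n × Fin n) F) (g : Matrix (Fin n) (Fin n) F),
      p.IsHomogeneous (n * J) → g.det = 1 → eval (coeffs (rsub g p)) Φ = eval (coeffs p) Φ) ∧
    eval (coeffs (genDet n F ^ J)) Φ ≠ 0

theorem exists_isSLFunctional_charZero {F : Type*} [Field F] [CharZero F] (n J : ℕ) :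
    ∃ Φ, IsSLFunctional (F := F) n J Φ := by
  classical
  let h := genDet n F ^ J
  let Φ : MvPolynomial ((Fin n × Fin n) →₀ ℕ) F := ∑ a ∈ h.support,
    C (((a.prod fun _ i => i.factorial : ℕ) : F) * coeff a h) * X a
  have hΦ : ∀ p, eval (coeffs p) Φ = apolar p h := by
    intro p
    rw [apolar_eq_sum (s := h.support ∪ p.support) Finset.subset_union_right]
    simp only [Φ, map_sum, map_mul, eval_C, eval_X, coeffs]
    rw [Finset.sum_subset (Finset.subset_union_left (s₂ := p.support)) fun a _ ha => by
      rw [notMem_support_iff.1 ha]; simp]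
    exact Finset.sum_congr rfl fun a _ => by ring
  refine ⟨Φ, by simp [Φ], fun p g _ hg => ?_, ?_⟩
  · rw [hΦ, hΦ, apolar_rsub, map_pow, rsub_genDet]
    simp [hg, h]
  · rw [hΦ]
    have : h = map (Int.castRingHom F) (genDet n ℤ ^ J) := by
      simp [h, map_genDet]
    have h1 := apolar_self_intCast_ne_zero (F := F) (genDet n ℤ ^ J)
      (pow_ne_zero J (genDet_ne_zero n ℤ))
    rw [← this] at h1
    exact h1

section Truncation

variable {F : Type*} [Field F]

/-- The ideal generated by the `q`-th powers of the variables. -/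
noncomputable def powIdeal (S F : Type*) [Field F] (q : ℕ) : Ideal (MvPolynomial S F) :=
  Ideal.span ((fun e => monomial e 1) '' Set.range fun s : S => Finsupp.single s q)

theorem mem_powIdeal {S : Type*} {q : ℕ} {p : MvPolynomial S F} :
    p ∈ powIdeal S F q ↔ ∀ e, coeff e p ≠ 0 → ∃ s, q ≤ e s := by
  rw [powIdeal, mem_ideal_span_monomial_image]
  simp

theorem X_pow_mem_powIdeal {S : Type*} (q : ℕ) (s : S) : (X s ^ q : MvPolynomial S F) ∈ powIdeal S F q := by
  rw [X_pow_eq_monomial]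
  exact Ideal.subset_span ⟨_, ⟨s, rfl⟩, rfl⟩

theorem powIdeal_eq_span {S : Type*} (q : ℕ) :
    powIdeal S F q = Ideal.span (Set.range fun s : S => X s ^ q) := by
  rw [powIdeal, ← Set.range_comp]
  congr 2
  ext s : 1
  simp [X_pow_eq_monomial]

variable {R J : Type*} [Fintype J]

theorem rsub_mem_powIdeal {p s : ℕ} [ExpChar F p] (g : Matrix J J F)
    {f : MvPolynomial (R × J) F} (hf : f ∈ powIdeal (R × J) F (p ^ s)) :
    rsub g f ∈ powIdeal (R × J) F (p ^ s) := by
  have : powIdeal (R × J) F (p ^ s) ≤ (powIdeal (R × J) F (p ^ s)).comap (rsub g) := by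
    conv_lhs => rw [powIdeal_eq_span]
    rw [Ideal.span_le]
    rintro _ ⟨z, rfl⟩
    simp only [SetLike.mem_coe, Ideal.mem_comap, map_pow, rsub_X]
    have : ExpChar (MvPolynomial (R × J) F) p := inferInstance
    rw [sum_pow_char_pow p s]
    refine Ideal.sum_mem _ fun j _ => ?_
    rw [mul_pow]
    exact Ideal.mul_mem_left _ _ (X_pow_mem_powIdeal _ _)
  exact this hf

theorem rename_mem_powIdeal {S S' : Type*} {q : ℕ} (w : S → S') {f : MvPolynomial S F}
    (hf : f ∈ powIdeal S F q) : rename w f ∈ powIdeal S' F q := by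
  have : powIdeal S F q ≤ (powIdeal S' F q).comap (rename w) := by
    conv_lhs => rw [powIdeal_eq_span]
    rw [Ideal.span_le]
    rintro _ ⟨z, rfl⟩
    simpa using X_pow_mem_powIdeal q (w z)
  exact this hf

/-- The exponent all of whose entries are `q - 1`. -/
noncomputable def topExp (S : Type*) [Fintype S] (q : ℕ) : S →₀ ℕ :=
  Finsupp.equivFunOnFinite.symm fun _ => q - 1

theorem coeff_topExp_of_mem {S : Type*} [Fintype S] {q : ℕ} (hq : 0 < q) {f : MvPolynomial S F}
    (hf : f ∈ powIdeal S F q) : coeff (topExp S q) f = 0 := by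
  by_contra h
  obtain ⟨s, hs⟩ := mem_powIdeal.1 hf _ h
  simp [topExp] at hs
  omega

theorem monomial_topExp {S : Type*} [Fintype S] (q : ℕ) :
    (monomial (topExp S q) 1 : MvPolynomial S F) = ∏ s, X s ^ (q - 1) := by
  rw [monomial_eq, Finsupp.prod_fintype _ _ (by simp)]
  simp [topExp]

variable [Fintype R] [DecidableEq J]

theorem rsub_monomial_topExp {p s : ℕ} [ExpChar F p] (g : Matrix J J F) (hg : g.det ≠ 0) :
    rsub g (monomial (topExp (R × J) (p ^ s)) 1) -
      C (g.det ^ (Fintype.card R * (p ^ s - 1))) * monomial (topExp (R × J) (p ^ s)) 1 ∈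
      powIdeal (R × J) F (p ^ s) := by
  have hp : 0 < p ^ s := Nat.pow_pos (expChar_pos F p)
  refine Matrix.diagonal_transvection_induction_of_det_ne_zero (fun g =>
    rsub g (monomial (topExp (R × J) (p ^ s)) 1) -
      C (g.det ^ (Fintype.card R * (p ^ s - 1))) * monomial (topExp (R × J) (p ^ s)) 1 ∈
      powIdeal (R × J) F (p ^ s)) g hg ?_ ?_ ?_
  · intro D _
    convert Ideal.zero_mem _
    rw [sub_eq_zero, monomial_topExp, map_prod, Matrix.det_diagonal]
    simp only [map_pow, rsub_X, Matrix.diagonal_apply]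
    simp only [apply_ite C, map_zero, ite_mul, zero_mul, Finset.sum_ite_eq', Finset.mem_univ,
      if_true, mul_pow, Finset.prod_mul_distrib]
    congr 1
    rw [Fintype.prod_prod_type]
    simp [map_prod, pow_right_comm, Finset.prod_pow, Finset.prod_const, ← pow_mul]
  · rintro ⟨i, j, hij, c⟩
    simp only [Matrix.TransvectionStruct.toMatrix, Matrix.det_transvection_of_ne _ _ hij, one_pow,
      map_one, one_mul]
    rw [← Ideal.Quotient.mk_eq_mk_iff_sub_mem, monomial_topExp, map_prod, map_prod, map_prod,
      Fintype.prod_prod_type, Fintype.prod_prod_type]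
    refine Finset.prod_congr rfl fun r _ => ?_
    have h1 : ∀ l, rsub (Matrix.transvection i j c) (X (r, l) : MvPolynomial (R × J) F) =
        X (r, l) + if l = j then C c * X (r, i) else 0 := by
      intro l
      rw [rsub_X]
      simp only [Matrix.transvection, Matrix.add_apply, Matrix.one_apply, map_add, add_mul,
        Finset.sum_add_distrib]
      congr 1
      · simp
      · by_cases hl : l = j
        · subst hl
          simp [Matrix.single_apply, apply_ite C, ite_mul]
        · simp [hl, Ne.symm hl]
    rw [← map_prod, ← map_prod, ← map_prod, 
      map_prod (rsub (Matrix.transvection i j c))]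
    simp only [map_pow, h1]
    rw [Ideal.Quotient.mk_eq_mk_iff_sub_mem]
    rw [← Finset.mul_prod_erase _ _ (Finset.mem_univ j),
      ← Finset.mul_prod_erase (Finset.univ) (fun l => X (r, l) ^ (p ^ s - 1)) (Finset.mem_univ j)]
    rw [Finset.prod_congr rfl (g := fun l => (X (r, l) : MvPolynomial (R × J) F) ^ (p ^ s - 1))
      fun l hl => by rw [if_neg (Finset.ne_of_mem_erase hl), add_zero], ← sub_mul,
      ← Finset.mul_prod_erase _ _ (Finset.mem_erase.2 ⟨hij, Finset.mem_univ i⟩), if_pos rfl]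
    obtain ⟨d, hd⟩ := sub_dvd_pow_sub_pow (X (r, j) + C c * X (r, i) : MvPolynomial (R × J) F)
      (X (r, j)) (p ^ s - 1)
    rw [hd, add_sub_cancel_left]
    have h2 : (X (r, i) : MvPolynomial (R × J) F) ^ (p ^ s) = X (r, i) * X (r, i) ^ (p ^ s - 1) := by
      rw [← pow_succ', Nat.sub_add_cancel hp]
    have h3 := Ideal.mul_mem_left _ (C c * d * ∏ x ∈ (Finset.univ.erase j).erase i,
      X (r, x) ^ (p ^ s - 1)) (X_pow_mem_powIdeal (F := F) (p ^ s) (r, i))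
    rw [h2] at h3
    convert h3 using 1
    ring
  · intro A B _ _ hA hB
    have h1 := rsub_mem_powIdeal (p := p) (s := s) A hB
    rw [map_sub, rsub_rsub, map_mul, rsub_C] at h1
    have h2 := Ideal.mul_mem_left _ (C (B.det ^ (Fintype.card R * (p ^ s - 1)))) hA
    convert Ideal.add_mem _ h1 h2 using 1
    simp only [Matrix.det_mul, mul_pow, map_mul]
    ring

theorem coeff_topExp_rsub {p s : ℕ} [ExpChar F p] (g : Matrix J J F) (hg : g.det = 1)
    (f : MvPolynomial (R × J) F) :
    coeff (topExp (R × J) (p ^ s)) (rsub g f) = coeff (topExp (R × J) (p ^ s)) f := by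
  have hp : 0 < p ^ s := Nat.pow_pos (expChar_pos F p)
  induction f using MvPolynomial.induction_on' with
  | add f f' hf hf' => simp [hf, hf']
  | monomial e c =>
    by_cases he : e = topExp (R × J) (p ^ s)
    · have h := coeff_topExp_of_mem hp (rsub_monomial_topExp (F := F) (p := p) (s := s) (R := R) g
        (by simp [hg]))
      rw [hg, one_pow, C_1, one_mul, coeff_sub, sub_eq_zero] at h
      rw [he, ← mul_one c, ← C_mul_monomial, map_mul, rsub_C, coeff_C_mul, coeff_C_mul, h]
    · by_cases hex : ∃ z, p ^ s ≤ e z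
      · have h1 : monomial e c ∈ powIdeal (R × J) F (p ^ s) := by
          rw [mem_powIdeal]
          intro e' he'
          classical
          rw [coeff_monomial] at he'
          split_ifs at he' with h
          · exact h ▸ hex
          · exact absurd rfl he'
        rw [coeff_topExp_of_mem hp h1, coeff_topExp_of_mem hp (rsub_mem_powIdeal g h1)]
      · push Not at hex
        have hle : e < topExp (R × J) (p ^ s) := lt_of_le_of_ne (fun z => by
          have := hex z
          simp [topExp]
          omega) he
        have hdeg : e.degree ≠ (topExp (R × J) (p ^ s)).degree := by
          intro h
          apply he
          have h0 : (topExp (R × J) (p ^ s) - e).degree = 0 := by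
            have := congrArg Finsupp.degree (tsub_add_cancel_of_le hle.le)
            rw [map_add] at this
            omega
          rw [Finsupp.degree_eq_zero_iff] at h0
          exact le_antisymm hle.le (tsub_eq_zero_iff_le.1 h0)
        have h1 := isHomogeneous_rsub (isHomogeneous_monomial c (d := e) rfl) g
        rw [h1.coeff_eq_zero (Ne.symm hdeg)]
        rw [(isHomogeneous_monomial c (d := e) rfl).coeff_eq_zero (Ne.symm hdeg)]

end Truncation

section Truncated

/-- The exponent attached to a bounded exponent vector. -/
noncomputable def finExp {S : Type*} [Finite S] {q : ℕ} (α : S → Fin q) : S →₀ ℕ :=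
  Finsupp.equivFunOnFinite.symm fun s => (α s : ℕ)

@[simp] theorem finExp_apply {S : Type*} [Finite S] {q : ℕ} (α : S → Fin q) (s : S) :
    finExp α s = α s := rfl

theorem finExp_injective {S : Type*} [Finite S] {q : ℕ} :
    Function.Injective (finExp : (S → Fin q) → _) := fun α β h =>
  funext fun s => Fin.ext (by simpa using DFunLike.congr_fun h s)

/-- Complementary bounded exponent. -/
def starExp {S : Type*} {q : ℕ} (α : S → Fin q) : S → Fin q := fun s => (α s).rev

/-- The matrix of the bilinear pairing given by a polynomial in two blocks of rows. -/
noncomputable def pairMatrix {A : Type*} [CommSemiring A] {R J : Type*} [Fintype R] [Fintype J]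
    (q : ℕ) (B : MvPolynomial ((R ⊕ R) × J) A) : Matrix (R × J → Fin q) (R × J → Fin q) A :=
  Matrix.of fun α β => coeff (topExp ((R ⊕ R) × J) q)
    (B * rename (Prod.map Sum.inl id) (monomial (finExp (starExp α)) 1) *
      rename (Prod.map Sum.inr id) (monomial (finExp β) 1))

theorem map_pairMatrix {A B : Type*} [CommSemiring A] [CommSemiring B] {R J : Type*} [Fintype R]
    [Fintype J] (q : ℕ) (φ : A →+* B) (P : MvPolynomial ((R ⊕ R) × J) A) :
    (pairMatrix q P).map φ = pairMatrix q (map φ P) := by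
  ext α β
  simp only [pairMatrix, Matrix.map_apply, Matrix.of_apply]
  rw [← coeff_map, map_mul, map_mul, map_rename, map_rename, map_monomial, map_monomial, map_one]

variable {F : Type*} [Field F] {R J : Type*} [Fintype R] [Fintype J]

theorem sub_sum_mem_powIdeal {S : Type*} [Fintype S] [DecidableEq S] {q : ℕ} (f : MvPolynomial S F) :
    f - ∑ α : S → Fin q, C (coeff (finExp α) f) * monomial (finExp α) 1 ∈ powIdeal S F q := by
  classical
  rw [mem_powIdeal]
  intro e he
  by_contra! hlt
  apply he
  let α : S → Fin q := fun s => ⟨e s, hlt s⟩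
  have hα : finExp α = e := by ext s; rfl
  rw [coeff_sub, coeff_sum, Finset.sum_eq_single α]
  · simp [hα]
  · intro β _ hβ
    rw [coeff_C_mul, coeff_monomial, if_neg, mul_zero]
    intro h
    exact hβ (finExp_injective (h.trans hα.symm))
  · simp

theorem coeff_topExp_mul_monomial {S : Type*} [Fintype S] [DecidableEq S] {q : ℕ}
    (α β : S → Fin q) :
    coeff (topExp S q) (monomial (finExp (starExp α)) 1 * monomial (finExp β) 1 :
      MvPolynomial S F) = if α = β then 1 else 0 := by
  rw [monomial_mul, coeff_monomial, mul_one]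
  congr 1
  rw [eq_iff_iff]
  constructor
  · intro h
    funext s
    have := DFunLike.congr_fun h s
    simp [starExp, topExp, Fin.val_rev] at this
    ext
    omega
  · rintro rfl
    ext s
    simp [starExp, topExp, Fin.val_rev]
    omega

/-- The matrix of the truncated action. -/
noncomputable def truncAction (R : Type*) [Fintype R] (q : ℕ) (g : Matrix J J F) :
    Matrix (R × J → Fin q) (R × J → Fin q) F :=
  Matrix.of fun α β => coeff (finExp α) (rsub g (monomial (finExp β) 1))

variable [DecidableEq J] [DecidableEq R] {p s : ℕ} [ExpChar F p]

theorem truncAction_star_mul (g : Matrix J J F) (hg : g.det = 1) :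
    (Matrix.of fun α α' => truncAction R (p ^ s) g (starExp α') (starExp α)) *
      truncAction R (p ^ s) g = 1 := by
  have hp : 0 < p ^ s := Nat.pow_pos (expChar_pos F p)
  have hstar : ∀ α : R × J → Fin (p ^ s), starExp (starExp α) = α := fun α => by
    funext z; simp [starExp]
  ext α β
  rw [Matrix.one_apply, ← coeff_topExp_mul_monomial (F := F) α β,
    ← coeff_topExp_rsub (p := p) (s := s) g hg, map_mul, Matrix.mul_apply]
  set f := rsub g (monomial (finExp (starExp α)) 1 : MvPolynomial (R × J) F)
  set h := rsub g (monomial (finExp β) 1 : MvPolynomial (R × J) F)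
  have h1 := sub_sum_mem_powIdeal (q := p ^ s) f
  have h2 := sub_sum_mem_powIdeal (q := p ^ s) h
  have h3 := Ideal.add_mem _ (Ideal.mul_mem_right h _ h1) (Ideal.mul_mem_left _
    (∑ α : R × J → Fin (p ^ s), C (coeff (finExp α) f) * monomial (finExp α) 1) h2)
  have h4 := coeff_topExp_of_mem hp h3
  have h5 : ∀ a b c d : MvPolynomial (R × J) F, (a - b) * c + b * (c - d) = a * c - b * d := by
    intros; ring
  rw [h5, coeff_sub, sub_eq_zero] at h4
  rw [h4, Finset.sum_mul_sum, coeff_sum, ← (Equiv.ofBijective (starExp : (R × J → Fin (p ^ s)) → _)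
    (Function.Involutive.bijective hstar)).sum_comp]
  refine Finset.sum_congr rfl fun γ _ => ?_
  rw [coeff_sum, Finset.sum_eq_single (starExp γ)]
  · rw [mul_mul_mul_comm, ← C_mul, coeff_C_mul, Equiv.ofBijective_apply]
    nth_rewrite 5 [← hstar γ]
    rw [coeff_topExp_mul_monomial]
    simp [truncAction, f, h, hstar]
  · intro δ _ hδ
    rw [mul_mul_mul_comm, ← C_mul, coeff_C_mul]
    nth_rewrite 2 [← hstar γ]
    rw [coeff_topExp_mul_monomial, if_neg hδ.symm, mul_zero]
  · simp

theorem pairMatrix_rsub (g g' : Matrix J J F) (hg : g.det = 1) (hgg : g * g' = 1)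
    (B : MvPolynomial ((R ⊕ R) × J) F) :
    pairMatrix (p ^ s) (rsub g B) =
      (Matrix.of fun α α' => truncAction R (p ^ s) g' (starExp α') (starExp α)) *
        pairMatrix (p ^ s) B * truncAction R (p ^ s) g' := by
  have hp : 0 < p ^ s := Nat.pow_pos (expChar_pos F p)
  have hstar : ∀ α : R × J → Fin (p ^ s), starExp (starExp α) = α := fun α => by
    funext z; simp [starExp]
  ext α β
  have e1 : ∀ f : MvPolynomial ((R ⊕ R) × J) F, rsub g (rsub g' f) = f := fun f => by
    rw [rsub_rsub, hgg, rsub_one]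
  simp only [pairMatrix, Matrix.of_apply]
  rw [← e1 (rename _ (monomial (finExp (starExp α)) 1)), ← e1 (rename _ (monomial (finExp β) 1)),
    ← map_mul, ← map_mul, coeff_topExp_rsub g hg, rsub_rename, rsub_rename]
  set f := rsub g' (monomial (finExp (starExp α)) 1 : MvPolynomial (R × J) F)
  set h := rsub g' (monomial (finExp β) 1 : MvPolynomial (R × J) F)
  have h1 := rename_mem_powIdeal (Prod.map (Sum.inl : R → R ⊕ R) (id : J → J))
    (sub_sum_mem_powIdeal (q := p ^ s) f)
  have h2 := rename_mem_powIdeal (Prod.map (Sum.inr : R → R ⊕ R) (id : J → J))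
    (sub_sum_mem_powIdeal (q := p ^ s) h)
  rw [map_sub] at h1 h2
  set f' := rename (Prod.map (Sum.inl : R → R ⊕ R) (id : J → J)) f
  set h' := rename (Prod.map (Sum.inr : R → R ⊕ R) (id : J → J)) h
  set f'' := rename (Prod.map (Sum.inl : R → R ⊕ R) (id : J → J)) (∑ α : R × J → Fin (p ^ s),
    C (coeff (finExp α) f) * monomial (finExp α) 1) with hf''
  set h'' := rename (Prod.map (Sum.inr : R → R ⊕ R) (id : J → J)) (∑ α : R × J → Fin (p ^ s),
    C (coeff (finExp α) h) * monomial (finExp α) 1) with hh''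
  have h3 := Ideal.add_mem _ (Ideal.mul_mem_left _ (B * h') h1) (Ideal.mul_mem_left _ (B * f'') h2)
  have h4 := coeff_topExp_of_mem hp h3
  have h5 : B * h' * (f' - f'') + B * f'' * (h' - h'') = B * f' * h' - B * f'' * h'' := by ring
  rw [h5, coeff_sub, sub_eq_zero] at h4
  rw [h4, hf'', hh'', map_sum, map_sum, ← (Equiv.ofBijective (starExp : (R × J → Fin (p ^ s)) → _)
    (Function.Involutive.bijective hstar)).sum_comp]
  simp only [Matrix.mul_apply, Matrix.of_apply, Finset.mul_sum, Finset.sum_mul, coeff_sum,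
    Equiv.ofBijective_apply, map_mul, rename_C]
  refine Finset.sum_congr rfl fun γ _ => Finset.sum_congr rfl fun δ _ => ?_
  have h6 : ∀ (a b c d e : MvPolynomial ((R ⊕ R) × J) F), a * (b * c) * (d * e) =
    b * (d * (a * c * e)) := by intros; ring
  rw [h6, coeff_C_mul, coeff_C_mul]
  simp only [truncAction, Matrix.of_apply, f, h]
  ring

theorem charpoly_pairMatrix_rsub (g : Matrix J J F) (hg : g.det = 1)
    (B : MvPolynomial ((R ⊕ R) × J) F) :
    (pairMatrix (p ^ s) (rsub g B)).charpoly = (pairMatrix (p ^ s) B).charpoly := by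
  have hgg : g * g⁻¹ = 1 := Matrix.mul_nonsing_inv _ (by simp [hg])
  have hdet : (g⁻¹).det = 1 := by
    have := congrArg Matrix.det hgg
    simpa [hg] using this
  have h1 := truncAction_star_mul (R := R) (p := p) (s := s) g⁻¹ hdet
  rw [pairMatrix_rsub g g⁻¹ hg hgg, Matrix.mul_assoc, Matrix.charpoly_mul_comm, Matrix.mul_assoc]
  generalize (Matrix.of fun α α' => truncAction R (p ^ s) g⁻¹ (starExp α') (starExp α)) = U at h1 ⊢
  rw [mul_eq_one_comm.1 h1, Matrix.mul_one]

end Truncated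

section UniqueMax

variable {A : Type*} [CommRing A] {σ : Type*}

/-- All monomials of `p` other than `e` have smaller weight than `e`. -/
def UniqueMax (w : (σ →₀ ℕ) →+ ℤ) (p : MvPolynomial σ A) (e : σ →₀ ℕ) : Prop :=
  ∀ a, coeff a p ≠ 0 → a ≠ e → w a < w e

theorem UniqueMax.mul {w : (σ →₀ ℕ) →+ ℤ} {p q : MvPolynomial σ A} {e f : σ →₀ ℕ}
    (hp : UniqueMax w p e) (hq : UniqueMax w q f) :
    UniqueMax w (p * q) (e + f) ∧ coeff (e + f) (p * q) = coeff e p * coeff f q := by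
  classical
  have key : ∀ a b, coeff a p * coeff b q ≠ 0 → w a + w b ≤ w e + w f ∧
      (w a + w b = w e + w f → a = e ∧ b = f) := by
    intro a b hab
    have ha := hp a (left_ne_zero_of_mul hab)
    have hb := hq b (right_ne_zero_of_mul hab)
    by_cases h1 : a = e <;> by_cases h2 : b = f
    · simp [h1, h2]
    · have := hb h2; subst h1; exact ⟨by omega, fun h => by omega⟩
    · have := ha h1; subst h2; exact ⟨by omega, fun h => by omega⟩
    · have := ha h1; have := hb h2; exact ⟨by omega, fun h => by omega⟩
  constructor
  · intro a ha hne
    rw [coeff_mul] at ha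
    obtain ⟨x, hx, hxne⟩ := Finset.exists_ne_zero_of_sum_ne_zero ha
    rw [Finset.HasAntidiagonal.mem_antidiagonal] at hx
    obtain ⟨h1, h2⟩ := key _ _ hxne
    rw [← hx, map_add, map_add]
    refine lt_of_le_of_ne h1 fun h => hne ?_
    rw [← hx, (h2 h).1, (h2 h).2]
  · rw [coeff_mul, Finset.sum_eq_single (e, f)]
    · intro x hx hxne
      by_contra h
      rw [Finset.HasAntidiagonal.mem_antidiagonal] at hx
      have := (key _ _ h).2 (by rw [← map_add, ← map_add, hx])
      exact hxne (Prod.ext this.1 this.2)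
    · simp

theorem UniqueMax.one (w : (σ →₀ ℕ) →+ ℤ) : UniqueMax w (1 : MvPolynomial σ A) 0 := by
  classical
  intro a ha hne
  rw [coeff_one, if_neg (Ne.symm hne)] at ha
  exact absurd rfl ha

theorem UniqueMax.prod {ι : Type*} {w : (σ →₀ ℕ) →+ ℤ} (s : Finset ι) {p : ι → MvPolynomial σ A}
    {e : ι → σ →₀ ℕ} (h : ∀ i ∈ s, UniqueMax w (p i) (e i)) :
    UniqueMax w (∏ i ∈ s, p i) (∑ i ∈ s, e i) ∧
      coeff (∑ i ∈ s, e i) (∏ i ∈ s, p i) = ∏ i ∈ s, coeff (e i) (p i) := by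
  classical
  induction s using Finset.induction_on with
  | empty => simpa using UniqueMax.one w
  | insert a s ha ih =>
    have h1 := ih fun i hi => h i (Finset.mem_insert_of_mem hi)
    have h2 := (h a (Finset.mem_insert_self _ _)).mul h1.1
    rw [Finset.prod_insert ha, Finset.sum_insert ha, Finset.prod_insert ha, ← h1.2]
    exact h2

theorem UniqueMax.pow {w : (σ →₀ ℕ) →+ ℤ} {p : MvPolynomial σ A} {e : σ →₀ ℕ}
    (h : UniqueMax w p e) (m : ℕ) :
    UniqueMax w (p ^ m) (m • e) ∧ coeff (m • e) (p ^ m) = coeff e p ^ m := by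
  have := UniqueMax.prod (Finset.range m) (p := fun _ => p) (e := fun _ => e) fun _ _ => h
  simpa using this

end UniqueMax

section Windows

/-- The `i`-th row of the `s`-th window of `N + 1` consecutive rows among `2 N` rows. -/
def window {N : ℕ} (s : Fin N) (i : Fin (N + 1)) : Fin N ⊕ Fin N :=
  if h : (s + i : ℕ) < N then Sum.inl ⟨s + i, h⟩ else Sum.inr ⟨s + i - N, by omega⟩

/-- Row number. -/
def rowIdx {N : ℕ} : Fin N ⊕ Fin N → ℕ := Sum.elim (fun r => r) fun r => N + r

theorem rowIdx_window {N : ℕ} (s : Fin N) (i : Fin (N + 1)) : rowIdx (window s i) = s + i := by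
  unfold window
  split_ifs with h
  · rfl
  · simp [rowIdx]; omega

/-- Product of a form over all windows. -/
noncomputable def windowProd {A : Type*} [CommSemiring A] (N : ℕ)
    (f : MvPolynomial (Fin (N + 1) × Fin (N + 1)) A) :
    MvPolynomial ((Fin N ⊕ Fin N) × Fin (N + 1)) A :=
  ∏ s : Fin N, rename (Prod.map (window s) id) f

theorem windowProd_rsub {A : Type*} [CommSemiring A] {N : ℕ} (g : Matrix (Fin (N + 1)) (Fin (N + 1)) A)
    (f : MvPolynomial (Fin (N + 1) × Fin (N + 1)) A) :
    windowProd N (rsub g f) = rsub g (windowProd N f) := by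
  simp only [windowProd, map_prod, rsub_rename]

theorem map_windowProd {A B : Type*} [CommSemiring A] [CommSemiring B] {N : ℕ} (φ : A →+* B)
    (f : MvPolynomial (Fin (N + 1) × Fin (N + 1)) A) :
    map φ (windowProd N f) = windowProd N (map φ f) := by
  simp only [windowProd, map_prod, map_rename]

variable {F : Type*} [Field F] {N : ℕ}

theorem rename_genDet_eq_sum (s : Fin N) :
    rename (Prod.map (window s) id) (genDet (N + 1) F) =
      ∑ τ : Equiv.Perm (Fin (N + 1)), monomial (∑ i, Finsupp.single (window s (τ i), i) 1)
        ((Equiv.Perm.sign τ : ℤ) : F) := by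
  rw [genDet, Matrix.det_apply', map_sum]
  refine Finset.sum_congr rfl fun τ _ => ?_
  rw [monomial_eq]
  simp only [map_mul, map_intCast, map_prod, Matrix.of_apply, rename_X, Prod.map_apply, id]
  congr 1
  rw [← Finsupp.prod_finsetSum_index (by simp) (by intros; exact pow_add _ _ _)]
  simp

/-- The exponent of the diagonal of a window. -/
noncomputable def diagExp (s : Fin N) : (Fin N ⊕ Fin N) × Fin (N + 1) →₀ ℕ :=
  ∑ i, Finsupp.single (window s i, i) 1

/-- A weight singling out diagonals. -/
noncomputable def diagWeight (N : ℕ) : ((Fin N ⊕ Fin N) × Fin (N + 1) →₀ ℕ) →+ ℤ :=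
  Finsupp.liftAddHom fun z => (AddMonoidHom.mulRight (-(rowIdx z.1 - z.2 : ℤ) ^ 2)).comp
    (Nat.castAddMonoidHom ℤ)

theorem diagWeight_sum_single (s : Fin N) (τ : Equiv.Perm (Fin (N + 1))) :
    diagWeight N (∑ i, Finsupp.single (window s (τ i), i) 1) =
      -((N + 1) * (s : ℤ) ^ 2) - ∑ i, ((τ i : ℤ) - (i : ℤ)) ^ 2 := by
  have h : ∑ i, ((τ i : ℕ) : ℤ) = ∑ i : Fin (N + 1), ((i : ℕ) : ℤ) :=
    Equiv.sum_comp τ fun i => ((i : ℕ) : ℤ)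
  rw [map_sum]
  simp only [diagWeight, Finsupp.liftAddHom_apply_single, AddMonoidHom.comp_apply,
    AddMonoidHom.coe_mulRight, Nat.coe_castAddMonoidHom, Nat.cast_one, one_mul, rowIdx_window]
  have h2 : ∀ i, (-((s + τ i : ℕ) - (i : ℕ) : ℤ) ^ 2) = -(s : ℤ) ^ 2 - 2 * s * (τ i : ℕ) +
    2 * s * (i : ℕ) - ((τ i : ℕ) - (i : ℕ)) ^ 2 := fun i => by push_cast; ring
  simp only [h2, Finset.sum_sub_distrib, Finset.sum_add_distrib, ← Finset.mul_sum, h]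
  simp

theorem uniqueMax_rename_genDet (s : Fin N) :
    UniqueMax (diagWeight N) (rename (Prod.map (window s) id) (genDet (N + 1) F)) (diagExp s) ∧
      coeff (diagExp s) (rename (Prod.map (window s) id) (genDet (N + 1) F)) = 1 := by
  classical
  have hlt : ∀ τ : Equiv.Perm (Fin (N + 1)), τ ≠ 1 →
      diagWeight N (∑ i, Finsupp.single (window s (τ i), i) 1) < diagWeight N (diagExp s) := by
    intro τ hτ
    have h1 := diagWeight_sum_single s 1
    simp only [Equiv.Perm.coe_one, id, sub_self, ne_eq, OfNat.ofNat_ne_zero, not_false_eq_true,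
      zero_pow, Finset.sum_const_zero] at h1
    rw [diagExp, h1, diagWeight_sum_single]
    have : ∃ i, τ i ≠ i := by
      by_contra! h
      exact hτ (Equiv.ext h)
    obtain ⟨i, hi⟩ := this
    have : 0 < ∑ i, ((τ i : ℤ) - (i : ℤ)) ^ 2 :=
      Finset.sum_pos' (fun _ _ => sq_nonneg _) ⟨i, Finset.mem_univ _, by
        have : ((τ i : ℕ) : ℤ) - (i : ℕ) ≠ 0 := by
          rw [sub_ne_zero]
          exact_mod_cast fun h => hi (Fin.ext h)
        positivity⟩
    omega
  rw [rename_genDet_eq_sum]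
  constructor
  · intro a ha hne
    rw [coeff_sum] at ha
    obtain ⟨τ, _, hτ⟩ := Finset.exists_ne_zero_of_sum_ne_zero ha
    rw [coeff_monomial] at hτ
    split_ifs at hτ with h
    · subst h
      refine hlt τ ?_
      rintro rfl
      exact hne rfl
    · exact absurd rfl hτ
  · rw [coeff_sum, Finset.sum_eq_single 1]
    · simp [diagExp]
    · intro τ _ hτ
      rw [coeff_monomial, if_neg]
      intro h
      have := hlt τ hτ
      rw [h] at this
      exact lt_irrefl _ this
    · simp

/-- The exponent of the eigenvector of the window pairing of a power of the determinant. -/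
def stepExp (N : ℕ) {q : ℕ} (hq : 0 < q) : Fin N × Fin (N + 1) → Fin q := fun z =>
  if (z.2 : ℕ) ≤ z.1 then ⟨q - 1, by omega⟩ else ⟨0, hq⟩

/-- The exponent of the product of the window diagonals. -/
noncomputable def bandExp (N q : ℕ) : (Fin N ⊕ Fin N) × Fin (N + 1) →₀ ℕ :=
  ∑ s : Fin N, (q - 1) • diagExp s

theorem coeff_bandExp (q : ℕ) :
    coeff (bandExp N q) (windowProd N (genDet (N + 1) F ^ (q - 1))) = 1 := by
  have h := (UniqueMax.prod Finset.univ fun (s : Fin N) _ =>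
    ((uniqueMax_rename_genDet (F := F) s).1.pow (q - 1)).1).2
  simp only [windowProd, map_pow, bandExp]
  rw [h]
  refine Finset.prod_eq_one fun s _ => ?_
  rw [((uniqueMax_rename_genDet (F := F) s).1.pow (q - 1)).2,
    (uniqueMax_rename_genDet (F := F) s).2, one_pow]

theorem diagExp_apply (s : Fin N) (z : (Fin N ⊕ Fin N) × Fin (N + 1)) :
    diagExp s z = if (s + z.2 : ℕ) = rowIdx z.1 then 1 else 0 := by
  classical
  obtain ⟨r, c⟩ := z
  simp only [diagExp, Finsupp.coe_finsetSum, Finset.sum_apply, Finsupp.single_apply,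
    Prod.mk.injEq]
  rw [Finset.sum_eq_single c]
  · congr 1
    rw [eq_iff_iff]
    constructor
    · rintro ⟨h, -⟩
      rw [← h, rowIdx_window]
    · intro h
      refine ⟨?_, rfl⟩
      rcases r with r | r <;> simp [rowIdx] at h
      · simp [window, h]
      · have : ¬ ((s : ℕ) + c < N) := by omega
        simp [window, h]
  · intro b _ hb
    simp [hb]
  · simp

theorem bandExp_apply (q : ℕ) (z : (Fin N ⊕ Fin N) × Fin (N + 1)) :
    bandExp N q z = if (z.2 : ℕ) ≤ rowIdx z.1 ∧ rowIdx z.1 < N + z.2 then q - 1 else 0 := by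
  simp only [bandExp, Finsupp.coe_finsetSum, Finset.sum_apply, Finsupp.smul_apply, diagExp_apply]
  split_ifs with h
  · rw [Finset.sum_eq_single (⟨rowIdx z.1 - z.2, by omega⟩ : Fin N)]
    · simp [h.1]
    · intro b _ hb
      rw [if_neg, smul_zero]
      intro h'
      exact hb (Fin.ext (by simp; omega))
    · simp
  · refine Finset.sum_eq_zero fun b _ => ?_
    rw [if_neg, smul_zero]
    intro h'
    have := b.2
    omega

theorem topExp_eq_band_add (hq : 0 < (q : ℕ)) :
    topExp ((Fin N ⊕ Fin N) × Fin (N + 1)) q = bandExp N q +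
      Finsupp.mapDomain (Prod.map Sum.inl id) (finExp (starExp (stepExp N hq))) +
      Finsupp.mapDomain (Prod.map Sum.inr id) (finExp (stepExp N hq)) := by
  have hl : Function.Injective (Prod.map (Sum.inl : Fin N → Fin N ⊕ Fin N)
    (id : Fin (N + 1) → Fin (N + 1))) := Sum.inl_injective.prodMap Function.injective_id
  have hr : Function.Injective (Prod.map (Sum.inr : Fin N → Fin N ⊕ Fin N)
    (id : Fin (N + 1) → Fin (N + 1))) := Sum.inr_injective.prodMap Function.injective_id
  ext ⟨r | r, c⟩
  · have h1 := Finsupp.mapDomain_apply hl (finExp (starExp (stepExp N hq))) (r, c)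
    have h2 := Finsupp.mapDomain_of_notMem_range (finExp (stepExp N hq)) ((Sum.inl r, c))
      (f := Prod.map (Sum.inr : Fin N → Fin N ⊕ Fin N) id) (by simp)
    simp only [Prod.map_apply, id] at h1
    simp only [Finsupp.add_apply, h1, h2, bandExp_apply, rowIdx, finExp_apply, starExp, stepExp,
      topExp, Finsupp.equivFunOnFinite_symm_apply_apply, Sum.elim_inl]
    by_cases h : (c : ℕ) ≤ r
    · simp [h, Fin.val_rev, show (r : ℕ) < N + c by omega]
      omega
    · simp [h, Fin.val_rev]
  · have h1 := Finsupp.mapDomain_apply hr (finExp (stepExp N hq)) (r, c)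
    have h2 := Finsupp.mapDomain_of_notMem_range (finExp (starExp (stepExp N hq))) ((Sum.inr r, c))
      (f := Prod.map (Sum.inl : Fin N → Fin N ⊕ Fin N) id) (by simp)
    simp only [Prod.map_apply, id] at h1
    simp only [Finsupp.add_apply, h1, h2, bandExp_apply, rowIdx, finExp_apply, stepExp,
      topExp, Finsupp.equivFunOnFinite_symm_apply_apply, Sum.elim_inr]
    by_cases h : (c : ℕ) ≤ r
    · simp [h]
    · have : (c : ℕ) ≤ N + r ∧ r < (c : ℕ) := by omega
      simp [h, this]

/-- A weight for which window determinants are homogeneous. -/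
def rowColWeight (N : ℕ) (z : (Fin N ⊕ Fin N) × Fin (N + 1)) : ℤ := 2 * (rowIdx z.1 - z.2) + 1

theorem isWeightedHomogeneous_windowProd (j : ℕ) : ∃ d, IsWeightedHomogeneous (rowColWeight N)
    (windowProd N (genDet (N + 1) F ^ j)) d := by
  refine ⟨∑ s : Fin N, j • ((N + 1) * (2 * (s : ℤ) + 1)), ?_⟩
  simp only [windowProd, map_pow]
  refine IsWeightedHomogeneous.prod _ _ _ fun s _ => IsWeightedHomogeneous.pow ?_ j
  rw [rename_genDet_eq_sum]
  refine Submodule.sum_mem (weightedHomogeneousSubmodule F (rowColWeight N) _) fun τ _ => ?_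
  refine isWeightedHomogeneous_monomial _ _ _ ?_
  rw [map_sum]
  simp only [Finsupp.weight_single, one_smul, rowColWeight, rowIdx_window]
  have h : ∑ i, ((τ i : ℕ) : ℤ) = ∑ i : Fin (N + 1), ((i : ℕ) : ℤ) :=
    Equiv.sum_comp τ fun i => ((i : ℕ) : ℤ)
  push_cast
  simp only [mul_sub, mul_add, Finset.sum_sub_distrib, Finset.sum_add_distrib, ← Finset.mul_sum, h]
  simp
  ring

theorem pairMatrix_windowProd_stepExp {q : ℕ} (hq : 0 < q) (α : Fin N × Fin (N + 1) → Fin q) :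
    pairMatrix q (windowProd N (genDet (N + 1) F ^ (q - 1))) α (stepExp N hq) =
      if α = stepExp N hq then 1 else 0 := by
  have hl : Function.Injective (Prod.map (Sum.inl : Fin N → Fin N ⊕ Fin N)
    (id : Fin (N + 1) → Fin (N + 1))) := Sum.inl_injective.prodMap Function.injective_id
  have hr : Function.Injective (Prod.map (Sum.inr : Fin N → Fin N ⊕ Fin N)
    (id : Fin (N + 1) → Fin (N + 1))) := Sum.inr_injective.prodMap Function.injective_id
  simp only [pairMatrix, Matrix.of_apply, rename_monomial]
  rw [topExp_eq_band_add hq, coeff_mul_monomial, mul_one]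
  split_ifs with h
  · subst h
    rw [coeff_mul_monomial, coeff_bandExp, mul_one]
  · rw [coeff_mul_monomial', mul_one]
    split_ifs with hle
    swap
    · rfl
    by_contra hne
    apply h
    obtain ⟨d, hd⟩ := isWeightedHomogeneous_windowProd (F := F) (N := N) (q - 1)
    have e1 := hd hne
    have e2 := hd (d := bandExp N q) (by rw [coeff_bandExp]; exact one_ne_zero)
    have e3 := tsub_add_cancel_of_le hle
    have e4 := congrArg (Finsupp.weight (rowColWeight N)) e3
    rw [map_add, map_add, e1, e2] at e4
    have e5 := add_left_cancel e4
    have hw : ∀ β : Fin N × Fin (N + 1) → Fin q, Finsupp.weight (rowColWeight N)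
        (Finsupp.mapDomain (Prod.map Sum.inl id) (finExp (starExp β))) =
        ∑ z : Fin N × Fin (N + 1), ((q : ℤ) - (β z + 1)) * (2 * (z.1 - z.2 : ℤ) + 1) := by
      intro β
      rw [Finsupp.weight_apply, Finsupp.sum_mapDomain_index_inj hl, Finsupp.sum_fintype _ _ (by simp)]
      refine Finset.sum_congr rfl fun z _ => ?_
      simp only [finExp_apply, starExp, Fin.val_rev, rowColWeight, rowIdx,
        nsmul_eq_mul]
      rw [Nat.cast_sub (by omega)]
      push_cast
      simp only [Prod.map_fst, Prod.map_snd, Sum.elim_inl, id]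
    rw [hw, hw, ← sub_eq_zero, ← Finset.sum_sub_distrib] at e5
    have hz : ∀ z : Fin N × Fin (N + 1), 0 ≤ ((q : ℤ) - (α z + 1)) * (2 * (z.1 - z.2 : ℤ) + 1) -
        ((q : ℤ) - (stepExp N hq z + 1)) * (2 * (z.1 - z.2 : ℤ) + 1) ∧
        (((q : ℤ) - (α z + 1)) * (2 * (z.1 - z.2 : ℤ) + 1) -
        ((q : ℤ) - (stepExp N hq z + 1)) * (2 * (z.1 - z.2 : ℤ) + 1) = 0 → α z = stepExp N hq z) := by
      intro z
      have e : ((q : ℤ) - (α z + 1)) * (2 * (z.1 - z.2 : ℤ) + 1) -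
        ((q : ℤ) - (stepExp N hq z + 1)) * (2 * (z.1 - z.2 : ℤ) + 1) =
        ((stepExp N hq z : ℤ) - α z) * (2 * (z.1 - z.2 : ℤ) + 1) := by ring
      rw [e]
      have hα := (α z).2
      by_cases hc : (z.2 : ℕ) ≤ z.1
      · have hs : ((stepExp N hq z : ℕ) : ℤ) = q - 1 := by
          simp [stepExp, hc]
          omega
        rw [hs]
        refine ⟨mul_nonneg (by omega) (by omega), fun h => ?_⟩
        rcases mul_eq_zero.1 h with h | h
        · exact Fin.ext (by omega)
        · omega
      · have hs : ((stepExp N hq z : ℕ) : ℤ) = 0 := by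
          simp [stepExp, hc]
        rw [hs]
        refine ⟨mul_nonneg_of_nonpos_of_nonpos (by omega) (by omega), fun h => ?_⟩
        rcases mul_eq_zero.1 h with h | h
        · exact Fin.ext (by omega)
        · omega
    funext z
    exact (hz z).2 ((Finset.sum_eq_zero_iff_of_nonneg fun z _ => (hz z).1).1 e5 z (Finset.mem_univ z))

end Windows

theorem exists_isSLFunctional_charP {F : Type*} [Field F] (N : ℕ) (hN : 0 < N) (p s : ℕ)
    [ExpChar F p] : ∃ Φ, IsSLFunctional (F := F) (N + 1) (p ^ s - 1) Φ := by
  classical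
  have hp : 0 < p ^ s := Nat.pow_pos (expChar_pos F p)
  let T : MvPolynomial (Fin (N + 1) × Fin (N + 1)) F →
    Matrix (Fin N × Fin (N + 1) → Fin (p ^ s)) (Fin N × Fin (N + 1) → Fin (p ^ s)) F :=
    fun f => pairMatrix (p ^ s) (windowProd N f)
  let U := pairMatrix (p ^ s) (windowProd N (univForm (Fin (N + 1) × Fin (N + 1)) F
    ((N + 1) * (p ^ s - 1))))
  have hU : ∀ f : MvPolynomial (Fin (N + 1) × Fin (N + 1)) F, f.IsHomogeneous ((N + 1) * (p ^ s - 1)) →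
      ∀ i, eval (coeffs f) (U.charpoly.coeff i) = (T f).charpoly.coeff i := by
    intro f hf i
    rw [← Polynomial.coeff_map, ← Matrix.charpoly_map, map_pairMatrix, map_windowProd,
      map_univForm hf]
  have hdet : (genDet (N + 1) F ^ (p ^ s - 1)).IsHomogeneous ((N + 1) * (p ^ s - 1)) := by
    have := (genDet_isHomogeneous (N + 1) F).pow (p ^ s - 1)
    simpa [mul_comm] using this
  obtain ⟨i, hi, hne⟩ : ∃ i, i ≠ Fintype.card (Fin N × Fin (N + 1) → Fin (p ^ s)) ∧
      (T (genDet (N + 1) F ^ (p ^ s - 1))).charpoly.coeff i ≠ 0 := by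
    by_contra! h
    have h1 : (T (genDet (N + 1) F ^ (p ^ s - 1))).charpoly =
        Polynomial.X ^ Fintype.card (Fin N × Fin (N + 1) → Fin (p ^ s)) := by
      ext i
      rw [Polynomial.coeff_X_pow]
      split_ifs with hi
      · rw [hi]
        have := (Matrix.charpoly_monic (T (genDet (N + 1) F ^ (p ^ s - 1)))).coeff_natDegree
        rwa [Matrix.charpoly_natDegree_eq_dim] at this
      · exact h i hi
    have h2 := Matrix.eval_charpoly (T (genDet (N + 1) F ^ (p ^ s - 1))) 1
    rw [h1, Polynomial.eval_pow, Polynomial.eval_X, one_pow] at h2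
    have h3 : (Matrix.scalar (Fin N × Fin (N + 1) → Fin (p ^ s)) (1 : F) -
        T (genDet (N + 1) F ^ (p ^ s - 1))).det = 0 := by
      refine Matrix.det_eq_zero_of_column_eq_zero (stepExp N hp) fun α => ?_
      simp only [Matrix.sub_apply, T, pairMatrix_windowProd_stepExp, Matrix.scalar_apply,
        Matrix.diagonal_apply]
      simp
    rw [h3] at h2
    exact one_ne_zero h2
  refine ⟨U.charpoly.coeff i, ?_, fun f g hf hg => ?_, ?_⟩
  · rw [← Polynomial.coeff_map, ← Matrix.charpoly_map, map_pairMatrix, map_windowProd,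
      map_constantCoeff_univForm]
    have h0 : pairMatrix (p ^ s) (windowProd N (0 : MvPolynomial (Fin (N + 1) × Fin (N + 1)) F)) = 0 := by
      have : windowProd N (0 : MvPolynomial (Fin (N + 1) × Fin (N + 1)) F) = 0 := by
        simp only [windowProd, map_zero]
        exact Finset.prod_eq_zero (Finset.mem_univ ⟨0, hN⟩) rfl
      ext α β
      simp [pairMatrix, this]
    rw [h0, Matrix.charpoly_zero, Polynomial.coeff_X_pow, if_neg hi]
  · rw [hU _ hf, hU _ (isHomogeneous_rsub hf g)]
    simp only [T, windowProd_rsub]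
    rw [charpoly_pairMatrix_rsub g hg]
  · rwa [hU _ hdet]

/-- Arbitrarily high powers of the determinant are separated from `0` by invariants of `SL_n`. -/
theorem exists_isSLFunctional {F : Type*} [Field F] (n : ℕ) (hn : 0 < n) (J₀ : ℕ) :
    ∃ J, J₀ ≤ J ∧ ∃ Φ, IsSLFunctional (F := F) n J Φ := by
  obtain ⟨p, hp⟩ := ExpChar.exists F
  cases hp with
  | zero => exact ⟨J₀, le_rfl, exists_isSLFunctional_charZero n J₀⟩
  | prime hp =>
    rename_i hchar
    obtain ⟨N, rfl⟩ : ∃ N, n = N + 1 := ⟨n - 1, by omega⟩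
    rcases Nat.eq_zero_or_pos N with rfl | hN
    · refine ⟨J₀, le_rfl, X (Finsupp.single (0, 0) J₀), by simp, fun f g _ hg => ?_, ?_⟩
      · have : g = 1 := by
          change Matrix (Fin 1) (Fin 1) F at g
          change Matrix.det (n := Fin 1) g = 1 at hg
          change g = (1 : Matrix (Fin 1) (Fin 1) F)
          ext i j
          rw [Matrix.det_fin_one] at hg
          rw [Subsingleton.elim i 0, Subsingleton.elim j 0, hg, Matrix.one_apply_eq]
        rw [this, rsub_one]
      · have : genDet (0 + 1) F = X (0, 0) := by
          change genDet 1 F = X (0, 0)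
          simp [genDet]
        simp [coeffs, this, X_pow_eq_monomial]
    · have : ExpChar F p := ExpChar.prime hp
      exact ⟨p ^ (J₀ + 1) - 1, by have := Nat.lt_pow_self hp.one_lt (n := J₀ + 1); omega,
        exists_isSLFunctional_charP N hN p (J₀ + 1)⟩

section scaling

variable {σ F : Type*}

theorem eval_smul_of_isHomogeneous [CommSemiring F] {p : MvPolynomial σ F} {d : ℕ}
    (hp : p.IsHomogeneous d) (t : F) (x : σ → F) : eval (t • x) p = t ^ d * eval x p := by
  rw [eval_eq, eval_eq, Finset.mul_sum]
  refine Finset.sum_congr rfl fun e he => ?_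
  have h1 := hp (mem_support_iff.1 he)
  rw [Finsupp.weight_apply, Finsupp.sum] at h1
  simp only [Pi.smul_apply, smul_eq_mul, mul_pow, Finset.prod_mul_distrib, Finset.prod_pow_eq_pow_sum]
  rw [show ∑ i ∈ e.support, e i = d by simpa using h1]
  ring

theorem eq_of_sum_mul_pow_eq [Field F] [Infinite F] (D : ℕ) (a b : ℕ → F)
    (h : ∀ t : F, ∑ l ∈ Finset.range D, a l * t ^ l = ∑ l ∈ Finset.range D, b l * t ^ l)
    (l : ℕ) (hl : l < D) : a l = b l := by
  have : (∑ l ∈ Finset.range D, Polynomial.monomial l (a l)) =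
      ∑ l ∈ Finset.range D, Polynomial.monomial l (b l) := by
    refine Polynomial.funext fun t => ?_
    simpa [Polynomial.eval_finsetSum] using h t
  have h2 := congrArg (fun p => Polynomial.coeff p l) this
  simpa [Polynomial.coeff_monomial, hl] using h2

theorem sum_eval_homogeneousComponent [CommSemiring F] (p : MvPolynomial σ F) {D : ℕ}
    (hD : p.totalDegree < D) (t : F) (x : σ → F) :
    eval (t • x) p = ∑ l ∈ Finset.range D, eval x (homogeneousComponent l p) * t ^ l := by
  have h : p = ∑ l ∈ Finset.range D, homogeneousComponent l p := by
    conv_lhs => rw [← sum_homogeneousComponent p]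
    refine Finset.sum_subset (fun l hl => ?_) fun l _ hl => ?_
    · rw [Finset.mem_range] at *; omega
    · rw [Finset.mem_range] at hl
      exact homogeneousComponent_eq_zero _ _ (by omega)
  conv_lhs => rw [h]
  rw [map_sum]
  refine Finset.sum_congr rfl fun l _ => ?_
  rw [eval_smul_of_isHomogeneous (homogeneousComponent_isHomogeneous l p), mul_comm]

theorem eval_homogeneousComponent_eq [Field F] [Infinite F] (p : MvPolynomial σ F) (x y : σ → F)
    (h : ∀ t : F, eval (t • x) p = eval (t • y) p) (l : ℕ) :
    eval x (homogeneousComponent l p) = eval y (homogeneousComponent l p) := by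
  refine eq_of_sum_mul_pow_eq (p.totalDegree + l + 1)
    (fun l => eval x (homogeneousComponent l p)) (fun l => eval y (homogeneousComponent l p))
    (fun t => ?_) l (by omega)
  rw [← sum_eval_homogeneousComponent p (by omega), ← sum_eval_homogeneousComponent p (by omega), h]

theorem isHomogeneous_of_eval_smul [Field F] [Infinite F] {p : MvPolynomial σ F} {d : ℕ}
    (h : ∀ (t : F) x, eval (t • x) p = t ^ d * eval x p) : p.IsHomogeneous d := by
  have key : ∀ l, l ≠ d → homogeneousComponent l p = 0 := by
    intro l hl
    refine funext fun x => ?_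
    have := eq_of_sum_mul_pow_eq (p.totalDegree + l + d + 1)
      (fun l => eval x (homogeneousComponent l p)) (fun l => if l = d then eval x p else 0)
      (fun t => ?_) l (by omega)
    · simpa [hl] using this
    · rw [← sum_eval_homogeneousComponent p (by omega), h]
      simp only [ite_mul, zero_mul, Finset.sum_ite_eq', Finset.mem_range]
      rw [if_pos (by omega), mul_comm]
  have h2 : p = homogeneousComponent d p := by
    conv_lhs => rw [← sum_homogeneousComponent p]
    by_cases hd : d ∈ Finset.range (p.totalDegree + 1)
    · rw [Finset.sum_eq_single_of_mem d hd fun l _ hl => key l hl]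
    · rw [Finset.sum_eq_zero fun l hl => key l (by rintro rfl; exact hd hl)]
      rw [homogeneousComponent_eq_zero]
      simpa [Nat.lt_succ_iff] using hd
  rw [h2]
  exact homogeneousComponent_isHomogeneous d p

end scaling

section blocks

variable {R ι : Type*} [DecidableEq ι] {n : ι → ℕ}

/-- The weight recording the block of the column index. -/
def blockWeight (R : Type*) (n : ι → ℕ) : R × (Σ i, Fin (n i)) → (ι → ℕ) :=
  fun z => Pi.single z.2.1 1

/-- `p` is homogeneous of degree `m i` in the columns of block `i`. -/
abbrev IsMultihom {A : Type*} [CommSemiring A] (p : MvPolynomial (R × (Σ i, Fin (n i))) A)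
    (m : ι → ℕ) : Prop :=
  IsWeightedHomogeneous (blockWeight R n) p m

theorem IsMultihom.map {A B : Type*} [CommSemiring A] [CommSemiring B] (φ : A →+* B)
    {p : MvPolynomial (R × (Σ i, Fin (n i))) A} {m : ι → ℕ} (hp : IsMultihom p m) :
    IsMultihom (map φ p) m := by
  intro e he
  rw [coeff_map] at he
  exact hp fun h => he (by rw [h, map_zero])

theorem weight_blockWeight_apply (e : R × (Σ i, Fin (n i)) →₀ ℕ) (i : ι) :
    Finsupp.weight (blockWeight R n) e i = ∑ z ∈ e.support, if z.2.1 = i then e z else 0 := by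
  rw [Finsupp.weight_apply, Finsupp.sum, Finset.sum_apply]
  refine Finset.sum_congr rfl fun z _ => ?_
  simp only [blockWeight, Pi.smul_apply, Pi.single_apply, smul_eq_mul, mul_ite, mul_one, mul_zero]
  simp only [eq_comm]

theorem IsMultihom.isHomogeneous [Fintype ι] {A : Type*} [CommSemiring A]
    {p : MvPolynomial (R × (Σ i, Fin (n i))) A} {m : ι → ℕ} (hp : IsMultihom p m) :
    p.IsHomogeneous (∑ i, m i) := by
  intro e he
  have h := hp he
  simp only [← h, weight_blockWeight_apply]
  rw [Finset.sum_comm]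
  simp [Finsupp.weight_apply, Finsupp.sum]

theorem IsMultihom.rsub [Fintype ι] {A : Type*} [CommSemiring A]
    {p : MvPolynomial (R × (Σ i, Fin (n i))) A} {m : ι → ℕ} (hp : IsMultihom p m)
    (g : ∀ i, Matrix (Fin (n i)) (Fin (n i)) A) :
    IsMultihom (rsub (Matrix.blockDiagonal' g) p) m := by
  rw [p.as_sum, map_sum]
  refine IsWeightedHomogeneous.sum _ _ _ fun e he => ?_
  have h := hp (mem_support_iff.1 he)
  rw [monomial_eq, map_mul, AlgebraicMonoid.rsub_C]
  refine IsWeightedHomogeneous.C_mul ?_ _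
  rw [Finsupp.prod, map_prod, ← h, Finsupp.weight_apply, Finsupp.sum]
  refine IsWeightedHomogeneous.prod _ _ _ fun z _ => ?_
  rw [map_pow]
  refine IsWeightedHomogeneous.pow ?_ _
  rw [rsub_X]
  refine IsWeightedHomogeneous.sum _ _ _ fun j _ => ?_
  by_cases hj : j.1 = z.2.1
  · refine IsWeightedHomogeneous.C_mul ?_ _
    rw [show blockWeight R n z = blockWeight R n (z.1, j) by simp [blockWeight, hj]]
    exact isWeightedHomogeneous_X _ _ _
  · rw [Matrix.blockDiagonal'_apply_ne _ _ _ hj, C_0, zero_mul]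
    exact isWeightedHomogeneous_zero _ _ _

theorem blockDiagonal'_smul_one {A : Type*} [CommSemiring A] (s : ι → A) :
    Matrix.blockDiagonal' (fun i => s i • (1 : Matrix (Fin (n i)) (Fin (n i)) A)) =
      Matrix.diagonal fun j : Σ i, Fin (n i) => s j.1 := by
  ext ⟨i, a⟩ ⟨j, b⟩
  by_cases h : i = j
  · subst h
    rw [Matrix.blockDiagonal'_apply_eq]
    simp only [Matrix.diagonal_apply, Matrix.smul_apply, Matrix.one_apply, smul_eq_mul, mul_ite,
      mul_one, mul_zero]
    by_cases hab : a = b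
    · simp [hab]
    · rw [if_neg hab, if_neg]
      rintro ⟨⟩
      exact hab rfl
  · rw [Matrix.blockDiagonal'_apply_ne _ _ _ h, Matrix.diagonal_apply_ne]
    rintro ⟨⟩
    exact h rfl

theorem IsMultihom.rsub_smul [Fintype ι] {A : Type*} [CommSemiring A]
    {p : MvPolynomial (R × (Σ i, Fin (n i))) A} {m : ι → ℕ} (hp : IsMultihom p m) (s : ι → A) :
    AlgebraicMonoid.rsub (Matrix.blockDiagonal' fun i => s i • (1 : Matrix (Fin (n i)) (Fin (n i)) A)) p =
      C (∏ i, s i ^ m i) * p := by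
  rw [blockDiagonal'_smul_one]
  conv_lhs => rw [p.as_sum, map_sum]
  conv_rhs => rw [p.as_sum, Finset.mul_sum]
  refine Finset.sum_congr rfl fun e he => ?_
  have h := hp (mem_support_iff.1 he)
  rw [monomial_eq, map_mul, AlgebraicMonoid.rsub_C, mul_left_comm]
  congr 1
  rw [Finsupp.prod, map_prod]
  have h1 : ∀ z ∈ e.support, AlgebraicMonoid.rsub (Matrix.diagonal fun j : Σ i, Fin (n i) => s j.1)
      (X z ^ e z : MvPolynomial (R × (Σ i, Fin (n i))) A) = C (∏ i, s i ^ (if z.2.1 = i then e z else 0)) * X z ^ e z := by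
    intro z _
    rw [map_pow, rsub_X, Finset.sum_eq_single z.2]
    · rw [Matrix.diagonal_apply_eq, mul_pow, Finset.prod_eq_single z.2.1]
      · simp
      · intro i _ hi
        rw [if_neg (Ne.symm hi), pow_zero]
      · simp
    · intro j _ hj
      rw [Matrix.diagonal_apply_ne _ hj, C_0, zero_mul]
    · simp
  rw [Finset.prod_congr rfl h1, Finset.prod_mul_distrib, ← map_prod, Finset.prod_comm]
  congr 2
  refine Finset.prod_congr rfl fun i _ => ?_
  rw [Finset.prod_pow_eq_pow_sum, ← weight_blockWeight_apply, h]

end blocks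

section average

variable {R ι : Type*} [DecidableEq ι] {n : ι → ℕ}

/-- The generic matrix in block `i`, the identity in the other blocks. -/
noncomputable def blockGen (n : ι → ℕ) (i : ι) (A : Type*) [CommRing A] :
    ∀ j, Matrix (Fin (n j)) (Fin (n j)) (MvPolynomial (Fin (n i) × Fin (n i)) A) :=
  Function.update 1 i (Matrix.of fun a b => X (a, b))

/-- Right substitution of the generic block. -/
noncomputable def spread [Fintype ι] (i : ι) {A : Type*} [CommRing A]
    (p : MvPolynomial (R × (Σ i, Fin (n i))) A) :
    MvPolynomial (R × (Σ i, Fin (n i))) (MvPolynomial (Fin (n i) × Fin (n i)) A) :=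
  rsub (Matrix.blockDiagonal' (blockGen n i A)) (map C p)

theorem map_update_one {A B : Type*} [CommRing A] [CommRing B] (φ : A →+* B) (i : ι)
    (x : Matrix (Fin (n i)) (Fin (n i)) A) :
    (Matrix.blockDiagonal' (Function.update (1 : ∀ j, Matrix (Fin (n j)) (Fin (n j)) A) i x)).map φ =
      Matrix.blockDiagonal' (Function.update (1 : ∀ j, Matrix (Fin (n j)) (Fin (n j)) B) i (x.map φ)) := by
  rw [Matrix.blockDiagonal'_map _ _ (map_zero φ)]
  congr 1
  funext j
  by_cases h : j = i
  · subst h; simp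
  · simp [Function.update_of_ne h]

theorem map_spread [Fintype ι] (i : ι) {A B : Type*} [CommRing A] [CommRing B] (φ : A →+* B)
    (p : MvPolynomial (R × (Σ i, Fin (n i))) A) :
    map (map φ) (spread i p) = spread i (map φ p) := by
  rw [spread, map_rsub, spread, blockGen, map_update_one, map_map, map_map]
  congr 2
  · rw [blockGen]
    congr 2
    ext a b
    simp
  · congr 2
    exact RingHom.ext fun a => by simp

theorem eval_spread [Fintype ι] (i : ι) {A : Type*} [CommRing A]
    (p : MvPolynomial (R × (Σ i, Fin (n i))) A) (x : Matrix (Fin (n i)) (Fin (n i)) A) :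
    map (eval fun z => x z.1 z.2) (spread i p) =
      rsub (Matrix.blockDiagonal' (Function.update 1 i x)) p := by
  rw [spread, map_rsub, blockGen, map_update_one, map_map]
  congr 2
  · congr 2
    ext a b
    simp
  · conv_rhs => rw [← map_id p]
    congr 2
    exact RingHom.ext fun a => by simp

/-- The weighted sum of the homogeneous components of `Φ` on the generic translate of `p`. -/
noncomputable def blockAverage {F : Type*} [Field F] [Fintype ι] (i : ι) (D : ℕ) (e : ℕ → ℕ)
    (Φ : MvPolynomial ((R × (Σ i, Fin (n i))) →₀ ℕ) F) {A : Type*} [CommRing A] [Algebra F A]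
    (p : MvPolynomial (R × (Σ i, Fin (n i))) A) : MvPolynomial (Fin (n i) × Fin (n i)) A :=
  ∑ l ∈ Finset.range D, genDet (n i) A ^ e l *
    aeval (coeffs (spread i p)) (homogeneousComponent l Φ)

theorem map_blockAverage {F : Type*} [Field F] [Fintype ι] (i : ι) (D : ℕ) (e : ℕ → ℕ)
    (Φ : MvPolynomial ((R × (Σ i, Fin (n i))) →₀ ℕ) F) {A B : Type*} [CommRing A] [Algebra F A]
    [CommRing B] [Algebra F B] (φ : A →ₐ[F] B) (p : MvPolynomial (R × (Σ i, Fin (n i))) A) :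
    map (φ : A →+* B) (blockAverage i D e Φ p) = blockAverage i D e Φ (map (φ : A →+* B) p) := by
  rw [blockAverage, map_sum, blockAverage]
  refine Finset.sum_congr rfl fun l _ => ?_
  rw [map_mul, map_pow, map_genDet]
  congr 1
  rw [map_aeval, ← map_spread, aeval_def, ← coe_eval₂Hom]
  congr 2
  · refine RingHom.ext fun a => ?_
    simp only [RingHom.comp_apply, MvPolynomial.algebraMap_apply, map_C]
    exact congrArg C (φ.commutes a)

theorem eval_blockAverage {F : Type*} [Field F] [Fintype ι] (i : ι) (D : ℕ) (e : ℕ → ℕ)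
    (Φ : MvPolynomial ((R × (Σ i, Fin (n i))) →₀ ℕ) F) (p : MvPolynomial (R × (Σ i, Fin (n i))) F)
    (x : Matrix (Fin (n i)) (Fin (n i)) F) :
    eval (fun z => x z.1 z.2) (blockAverage i D e Φ p) = ∑ l ∈ Finset.range D, x.det ^ e l *
      eval (coeffs (rsub (Matrix.blockDiagonal' (Function.update 1 i x)) p))
        (homogeneousComponent l Φ) := by
  rw [blockAverage, map_sum]
  refine Finset.sum_congr rfl fun l _ => ?_
  rw [map_mul, map_pow, eval_genDet, map_aeval, ← eval_spread]
  congr 1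
  rw [coe_eval₂Hom]
  change _ = eval₂ (RingHom.id F) _ _
  congr 1
  · exact RingHom.ext fun a => by simp

theorem rsub_update_smul {F : Type*} [Field F] [Fintype ι] {m : ι → ℕ} (i : ι)
    {p : MvPolynomial (R × (Σ i, Fin (n i))) F} (hp : IsMultihom p m) (s : F)
    (x : Matrix (Fin (n i)) (Fin (n i)) F) :
    rsub (Matrix.blockDiagonal' (Function.update 1 i (s • x))) p =
      C (s ^ m i) * rsub (Matrix.blockDiagonal' (Function.update 1 i x)) p := by
  have h1 : (Function.update (1 : ∀ j, Matrix (Fin (n j)) (Fin (n j)) F) i (s • x)) = fun j =>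
      Function.update (1 : ∀ j, Matrix (Fin (n j)) (Fin (n j)) F) i x j *
        (Function.update (1 : ι → F) i s j • (1 : Matrix (Fin (n j)) (Fin (n j)) F)) := by
    funext j
    by_cases h : j = i
    · subst h; simp
    · simp [Function.update_of_ne h]
  rw [h1, Matrix.blockDiagonal'_mul, ← rsub_rsub, hp.rsub_smul, map_mul, rsub_C]
  congr 2
  rw [Finset.prod_eq_single i]
  · simp
  · intro j _ hj
    simp [Function.update_of_ne hj]
  · simp

theorem coeffs_C_mul {σ F : Type*} [CommSemiring F] (c : F) (p : MvPolynomial σ F) :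
    coeffs (C c * p) = c • coeffs p := by
  funext e
  simp [coeffs, coeff_C_mul]

theorem exists_smul_det_one {F : Type*} [Field F] [IsAlgClosed F] {N : ℕ} (hN : 0 < N)
    (x : Matrix (Fin N) (Fin N) F) (hx : x.det ≠ 0) :
    ∃ (s : F) (y : Matrix (Fin N) (Fin N) F), x = s • y ∧ y.det = 1 ∧ s ^ N = x.det := by
  obtain ⟨s, hs⟩ := IsAlgClosed.exists_pow_nat_eq x.det hN
  have hs0 : s ≠ 0 := by rintro rfl; rw [zero_pow hN.ne'] at hs; exact hx hs.symm
  refine ⟨s, s⁻¹ • x, by rw [smul_smul, mul_inv_cancel₀ hs0, one_smul], ?_, hs⟩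
  rw [Matrix.det_smul, Fintype.card_fin, ← hs, inv_pow, inv_mul_cancel₀ (pow_ne_zero _ hs0)]

/-- A polynomial taking the value `1` along an `SL`-orbit and `0` at the origin can be averaged
to an invariant, block by block. -/
theorem exists_invariant_of_isolated {F : Type*} [Field F] [IsAlgClosed F] [Fintype R] [Fintype ι]
    (hn : ∀ i, 0 < n i) {m : ι → ℕ} (hm : ∀ i, n i ∣ m i)
    {Θ : MvPolynomial (R × (Σ i, Fin (n i))) F} (hΘ : IsMultihom Θ m)
    (f : MvPolynomial ((R × (Σ i, Fin (n i))) →₀ ℕ) F) (hf0 : constantCoeff f = 0)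
    (hf : ∀ g : ∀ i, Matrix (Fin (n i)) (Fin (n i)) F, (∀ i, (g i).det = 1) →
      eval (coeffs (rsub (Matrix.blockDiagonal' g) Θ)) f = 1) :
    ∃ Φ : MvPolynomial ((R × (Σ i, Fin (n i))) →₀ ℕ) F, constantCoeff Φ = 0 ∧
      (∀ p : MvPolynomial (R × (Σ i, Fin (n i))) F, IsMultihom p m →
        ∀ g : ∀ i, Matrix (Fin (n i)) (Fin (n i)) F, (∀ i, (g i).det = 1) →
          eval (coeffs (rsub (Matrix.blockDiagonal' g) p)) Φ = eval (coeffs p) Φ) ∧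
      eval (coeffs Θ) Φ ≠ 0 := by
  classical
  have : Infinite F := IsAlgClosed.instInfinite
  suffices H : ∀ S : Finset ι, ∃ Φ : MvPolynomial ((R × (Σ i, Fin (n i))) →₀ ℕ) F,
      constantCoeff Φ = 0 ∧
      (∀ p : MvPolynomial (R × (Σ i, Fin (n i))) F, IsMultihom p m →
        ∀ g : ∀ i, Matrix (Fin (n i)) (Fin (n i)) F, (∀ i, (g i).det = 1) → (∀ i ∉ S, g i = 1) →
          eval (coeffs (rsub (Matrix.blockDiagonal' g) p)) Φ = eval (coeffs p) Φ) ∧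
      ∀ g : ∀ i, Matrix (Fin (n i)) (Fin (n i)) F, (∀ i, (g i).det = 1) →
        eval (coeffs (rsub (Matrix.blockDiagonal' g) Θ)) Φ = 1 by
    obtain ⟨Φ, h0, h1, h2⟩ := H Finset.univ
    refine ⟨Φ, h0, fun p hp g hg => h1 p hp g hg fun i hi => absurd (Finset.mem_univ i) hi, ?_⟩
    have := h2 1 fun i => by simp
    rw [Matrix.blockDiagonal'_one, rsub_one] at this
    rw [this]; exact one_ne_zero
  intro S
  induction S using Finset.induction_on with
  | empty =>
    refine ⟨f, hf0, fun p _ g _ hg => ?_, hf⟩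
    rw [show g = 1 from _root_.funext fun i => hg i (Finset.notMem_empty i),
      Matrix.blockDiagonal'_one, rsub_one]
  | insert i S hi ih =>
    obtain ⟨Φ, h0, h1, h2⟩ := ih
    obtain ⟨b, hb⟩ := hm i
    set D := Φ.totalDegree + 1 with hD
    obtain ⟨J, hJ, Ψ, hΨ0, hΨ1, hΨ2⟩ := exists_isSLFunctional (F := F) (n i) (hn i) (D * b)
    set e : ℕ → ℕ := fun l => J - l * b with he
    have hle : ∀ l < D, l * b ≤ J := fun l hl => (Nat.mul_le_mul_right b hl.le).trans hJ
    have hcomp : ∀ p : MvPolynomial (R × (Σ i, Fin (n i))) F, IsMultihom p m →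
        ∀ g : ∀ i, Matrix (Fin (n i)) (Fin (n i)) F, (∀ i, (g i).det = 1) → (∀ i ∉ S, g i = 1) →
          ∀ l, eval (coeffs (rsub (Matrix.blockDiagonal' g) p)) (homogeneousComponent l Φ) =
            eval (coeffs p) (homogeneousComponent l Φ) := by
      intro p hp g hg hgS l
      refine eval_homogeneousComponent_eq _ _ _ (fun t => ?_) l
      rw [← coeffs_C_mul, ← coeffs_C_mul, ← h1 (C t * p) (hp.C_mul t) g hg hgS, map_mul, rsub_C]
    -- homogeneity of the average
    have hhom : ∀ p : MvPolynomial (R × (Σ i, Fin (n i))) F, IsMultihom p m →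
        (blockAverage i D e Φ p).IsHomogeneous (n i * J) := by
      intro p hp
      refine isHomogeneous_of_eval_smul fun t x => ?_
      have hx := eval_blockAverage i D e Φ p (Matrix.of fun a b => x (a, b))
      have htx := eval_blockAverage i D e Φ p (t • Matrix.of fun a b => x (a, b))
      rw [show (fun z : Fin (n i) × Fin (n i) => (t • Matrix.of fun a b => x (a, b)) z.1 z.2) =
        t • x from _root_.funext fun z => rfl] at htx
      rw [show (fun z : Fin (n i) × Fin (n i) => (Matrix.of fun a b => x (a, b)) z.1 z.2) =
        x from _root_.funext fun z => rfl] at hx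
      rw [htx, hx, Finset.mul_sum]
      refine Finset.sum_congr rfl fun l hl => ?_
      rw [rsub_update_smul i hp, coeffs_C_mul,
        eval_smul_of_isHomogeneous (homogeneousComponent_isHomogeneous l Φ), Matrix.det_smul,
        Fintype.card_fin, mul_pow]
      have h3 : (t ^ n i) ^ e l * (t ^ m i) ^ l = t ^ (n i * J) := by
        have := hle l (Finset.mem_range.1 hl)
        rw [hb, ← pow_mul, ← pow_mul, ← pow_add]
        congr 1
        simp only [he]
        rw [mul_assoc, mul_comm b l, ← mul_add, Nat.sub_add_cancel this]
      rw [← h3]; ring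
    -- the new functional
    let U := blockAverage i D e Φ (univForm (R × (Σ i, Fin (n i))) F (∑ i, m i))
    have hU : ∀ p : MvPolynomial (R × (Σ i, Fin (n i))) F, p.IsHomogeneous (∑ i, m i) →
        map (eval (coeffs p)) U = blockAverage i D e Φ p := by
      intro p hp
      have h4 := map_blockAverage i D e Φ (aeval (coeffs p)) (univForm _ F (∑ i, m i))
      have h5 : ((aeval (coeffs p) : _ →ₐ[F] F) : _ →+* F) = eval (coeffs p) := by
        refine RingHom.ext fun q => ?_
        simp
      rw [h5, map_univForm hp] at h4
      exact h4
    let Φ' := aeval (coeffs U) Ψ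
    have hΦ' : ∀ p : MvPolynomial (R × (Σ i, Fin (n i))) F, p.IsHomogeneous (∑ i, m i) →
        eval (coeffs p) Φ' = eval (coeffs (blockAverage i D e Φ p)) Ψ := by
      intro p hp
      simp only [Φ']
      rw [map_aeval, ← hU p hp, coe_eval₂Hom]
      change _ = eval₂ (RingHom.id F) _ _
      congr 1
      · exact RingHom.ext fun a => by simp
    have hcoeffs0 : coeffs (0 : MvPolynomial (R × (Σ i, Fin (n i))) F) = 0 := by
      funext e; simp [coeffs]
    have hcoeffs0' : coeffs (0 : MvPolynomial (Fin (n i) × Fin (n i)) F) = 0 := by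
      funext e; simp [coeffs]
    set c := eval (coeffs (genDet (n i) F ^ J)) Ψ with hc
    have hc0 : c ≠ 0 := hΨ2
    refine ⟨C c⁻¹ * Φ', ?_, ?_, ?_⟩
    · have h6 := hΦ' 0 (isHomogeneous_zero _ _ _)
      have h7 : blockAverage i D e Φ (0 : MvPolynomial (R × (Σ i, Fin (n i))) F) = 0 := by
        refine Finset.sum_eq_zero fun l _ => ?_
        rw [spread, map_zero, map_zero]
        have : (coeffs (0 : MvPolynomial (R × (Σ i, Fin (n i))) (MvPolynomial (Fin (n i) × Fin (n i)) F))) =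
            0 := by funext e; simp [coeffs]
        rw [this, aeval_zero, constantCoeff_eq, coeff_homogeneousComponent, ← constantCoeff_eq, h0,
          ite_self, map_zero, mul_zero]
      rw [h7, hcoeffs0, hcoeffs0', eval_zero, eval_zero, hΨ0] at h6
      rw [map_mul, h6, mul_zero]
    · intro p hp g hg hgS
      rw [map_mul, map_mul, hΦ' _ hp.isHomogeneous, hΦ' _ (hp.rsub g).isHomogeneous]
      rw [eval_C, eval_C, ← hΨ1 _ (g i) (hhom p hp) (hg i)]
      congr 3
      refine congrArg coeffs (MvPolynomial.funext fun x => ?_)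
      have hx := eval_blockAverage i D e Φ (rsub (Matrix.blockDiagonal' g) p)
        (Matrix.of fun a b => x (a, b))
      have hx' := eval_blockAverage i D e Φ p ((Matrix.of fun a b => x (a, b)) * g i)
      rw [← eval_rsub] at hx'
      refine hx.trans (Eq.trans (Finset.sum_congr rfl fun l _ => ?_) hx'.symm)
      rw [Matrix.det_mul, hg i, mul_one, rsub_rsub, ← Matrix.blockDiagonal'_mul]
      refine congrArg _ (Eq.trans ?_ (hcomp _ (hp.rsub _) (Function.update g i 1) ?_ ?_ l))
      · rw [rsub_rsub, ← Matrix.blockDiagonal'_mul]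
        rw [show (fun k => Function.update (1 : ∀ j, Matrix (Fin (n j)) (Fin (n j)) F) i
            (Matrix.of fun a b => x (a, b)) k * g k) = fun k => Function.update g i 1 k *
            Function.update (1 : ∀ j, Matrix (Fin (n j)) (Fin (n j)) F) i
              ((Matrix.of fun a b => x (a, b)) * g i) k from _root_.funext fun j => by
          by_cases h : j = i
          · subst h; simp
          · simp [Function.update_of_ne h]]
      · intro j
        by_cases h : j = i
        · subst h; simp
        · rw [Function.update_of_ne h]; exact hg j
      · intro j hj
        by_cases h : j = i
        · subst h; simp
        · rw [Function.update_of_ne h]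
          exact hgS j (by simp [h, hj])
    · intro g hg
      rw [map_mul, eval_C, hΦ' _ (hΘ.rsub g).isHomogeneous]
      have h8 : blockAverage i D e Φ (rsub (Matrix.blockDiagonal' g) Θ) = genDet (n i) F ^ J := by
        refine mul_left_cancel₀ (a := genDet (n i) F) (genDet_ne_zero _ _) ?_
        refine MvPolynomial.funext fun x => ?_
        have hx := eval_blockAverage i D e Φ (rsub (Matrix.blockDiagonal' g) Θ)
          (Matrix.of fun a b => x (a, b))
        have hdx : eval x (genDet (n i) F) = (Matrix.of fun a b => x (a, b)).det :=
          eval_genDet (Matrix.of fun a b => x (a, b))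
        rw [map_mul, map_mul, map_pow, hdx]
        by_cases h0 : (Matrix.of fun a b => x (a, b)).det = 0
        · rw [h0, zero_mul, zero_mul]
        congr 1
        refine hx.trans ?_
        obtain ⟨s, y, hsy, hy, hs⟩ := exists_smul_det_one (hn i) _ h0
        rw [← hs, hsy]
        rw [Finset.sum_congr rfl (g := fun l => (s ^ n i) ^ J *
          (eval (coeffs (rsub (Matrix.blockDiagonal' (Function.update 1 i y))
            (rsub (Matrix.blockDiagonal' g) Θ))) (homogeneousComponent l Φ) * 1 ^ l))]
        · rw [← Finset.mul_sum, ← sum_eval_homogeneousComponent Φ (by omega), one_smul, rsub_rsub,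
            ← Matrix.blockDiagonal'_mul, h2, mul_one]
          intro j
          by_cases h : j = i
          · subst h; simp [hy, hg]
          · simp [Function.update_of_ne h, hg]
        · intro l hl
          rw [rsub_update_smul i (hΘ.rsub g), coeffs_C_mul,
            eval_smul_of_isHomogeneous (homogeneousComponent_isHomogeneous l Φ)]
          have := hle l (Finset.mem_range.1 hl)
          have h3 : (s ^ n i) ^ e l * (s ^ m i) ^ l = (s ^ n i) ^ J := by
            rw [hb, ← pow_mul, ← pow_mul, ← pow_add, ← pow_mul]
            congr 1
            simp only [he]
            rw [mul_assoc, mul_comm b l, ← mul_add, Nat.sub_add_cancel this]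
          rw [← h3, one_pow]; ring
      rw [h8, ← hc, inv_mul_cancel₀ hc0]

end average

section gordan

/-- A finite subset of an additively closed set of integer vectors avoiding `0` lies in an open
half space. -/
theorem exists_halfspace (N : ℕ) (P : (Fin N → ℤ) → Prop) (hadd : ∀ a b, P a → P b → P (a + b))
    (h0 : ¬ P 0) (S : Finset (Fin N → ℤ)) (hS : ∀ d ∈ S, P d) :
    ∃ x : Fin N → ℝ, ∀ d ∈ S, 0 < ∑ j, x j * d j := by
  classical
  induction N with
  | zero =>
    refine ⟨0, fun d hd => absurd ?_ h0⟩
    have := hS d hd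
    rwa [Subsingleton.elim d 0] at this
  | succ N ih =>
    have hsmul : ∀ (c : ℕ) a, 0 < c → P a → P (c • a) := by
      intro c a hc ha
      induction c, hc using Nat.le_induction with
      | base => simpa using ha
      | succ c _ h => rw [succ_nsmul]; exact hadd _ _ h ha
    have hzsmul : ∀ (c : ℤ) a, 0 < c → P a → P (c • a) := by
      intro c a hc ha
      have := hsmul c.toNat a (by omega) ha
      rwa [← natCast_zsmul, Int.toNat_of_nonneg hc.le] at this
    let comb : (Fin (N + 1) → ℤ) → (Fin (N + 1) → ℤ) → (Fin (N + 1) → ℤ) :=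
      fun p q => p 0 • q + (-q 0) • p
    let S' : Finset (Fin (N + 1) → ℤ) := S.filter (fun d => d 0 = 0) ∪
      ((S.filter (fun d => 0 < d 0)) ×ˢ (S.filter (fun d => d 0 < 0))).image
        (fun z => comb z.1 z.2)
    have hS' : ∀ d ∈ S', d 0 = 0 ∧ P d := by
      intro d hd
      rcases Finset.mem_union.1 hd with hd | hd
      · rw [Finset.mem_filter] at hd
        exact ⟨hd.2, hS d hd.1⟩
      · obtain ⟨z, hz, rfl⟩ := Finset.mem_image.1 hd
        rw [Finset.mem_product, Finset.mem_filter, Finset.mem_filter] at hz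
        refine ⟨?_, hadd _ _ (hzsmul _ _ hz.1.2 (hS _ hz.2.1))
          (hzsmul _ _ (by have := hz.2.2; omega) (hS _ hz.1.1))⟩
        simp [comb]; ring
    obtain ⟨x, hx⟩ := ih (fun e => P (Fin.cons 0 e)) (fun a b ha hb => by
        have := hadd _ _ ha hb
        rwa [show (Fin.cons 0 a + Fin.cons 0 b : Fin (N + 1) → ℤ) = Fin.cons 0 (a + b) by
          funext i; refine Fin.cases ?_ (fun i => ?_) i <;> simp] at this)
      (fun h => h0 (by
        rwa [show (Fin.cons 0 0 : Fin (N + 1) → ℤ) = 0 by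
          funext i; refine Fin.cases ?_ (fun i => ?_) i <;> simp] at h))
      (S'.image Fin.tail) (fun e he => by
        obtain ⟨d, hd, rfl⟩ := Finset.mem_image.1 he
        have := hS' d hd
        rw [← this.1, Fin.cons_self_tail]
        exact this.2)
    have hx' : ∀ d ∈ S', 0 < ∑ j : Fin N, x j * d j.succ := fun d hd =>
      hx _ (Finset.mem_image_of_mem _ hd)
    obtain ⟨y, hy1, hy2⟩ := Order.exists_between_finsets
      ((S.filter (fun d => 0 < d 0)).image fun p => -(∑ j : Fin N, x j * p j.succ) / (p 0 : ℝ))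
      ((S.filter (fun d => d 0 < 0)).image fun q => (∑ j : Fin N, x j * q j.succ) / (-(q 0 : ℝ)))
      (by
        intro a ha b hb
        obtain ⟨p, hp, rfl⟩ := Finset.mem_image.1 ha
        obtain ⟨q, hq, rfl⟩ := Finset.mem_image.1 hb
        have h1 := hx' (comb p q) (Finset.mem_union_right _
          (Finset.mem_image.2 ⟨(p, q), Finset.mem_product.2 ⟨hp, hq⟩, rfl⟩))
        rw [Finset.mem_filter] at hp hq
        have hp0 : (0 : ℝ) < p 0 := by exact_mod_cast hp.2
        have hq0 : (0 : ℝ) < -(q 0) := by have := hq.2; rw [Left.neg_pos_iff]; exact_mod_cast this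
        rw [div_lt_div_iff₀ hp0 hq0]
        have h2 : ∑ j : Fin N, x j * (comb p q j.succ : ℝ) =
            (p 0 : ℝ) * ∑ j : Fin N, x j * q j.succ - q 0 * ∑ j : Fin N, x j * p j.succ := by
          rw [Finset.mul_sum, Finset.mul_sum, ← Finset.sum_sub_distrib]
          refine Finset.sum_congr rfl fun j _ => ?_
          simp [comb]; ring
        rw [h2] at h1
        linarith)
    refine ⟨Fin.cons y x, fun d hd => ?_⟩
    rw [Fin.sum_univ_succ]
    simp only [Fin.cons_zero, Fin.cons_succ]
    rcases lt_trichotomy (d 0) 0 with h | h | h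
    · have h1 := hy2 _ (Finset.mem_image_of_mem _ (Finset.mem_filter.2 ⟨hd, h⟩))
      have hq0 : (0 : ℝ) < -(d 0) := by rw [Left.neg_pos_iff]; exact_mod_cast h
      rw [lt_div_iff₀ hq0] at h1
      linarith
    · rw [h]
      simpa using hx' d (Finset.mem_union_left _ (Finset.mem_filter.2 ⟨hd, h⟩))
    · have h1 := hy1 _ (Finset.mem_image_of_mem _ (Finset.mem_filter.2 ⟨hd, h⟩))
      have hp0 : (0 : ℝ) < d 0 := by exact_mod_cast h
      rw [div_lt_iff₀ hp0] at h1
      linarith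

end gordan

section monomial

variable {J K : Type*} [Fintype J] [DecidableEq J] [Field K]

/-- The hypothesis on the available row operations `Lm` and column operations `Rm` under which
Gaussian elimination to a monomial matrix is possible. -/
def HasPivots (Lm Rm : Submonoid (Matrix J J K)) : Prop :=
  ∀ (g : Matrix J J K) (U V : Finset J), U.Nonempty → (∀ i ∈ U, ∃ j ∈ V, g i j ≠ 0) →
    ∃ r ∈ U, ∃ c ∈ V, g r c ≠ 0 ∧ ∀ s : K, (s = 1 ∨ s = -1) →
      1 + s • Matrix.vecMulVec (fun i => if i ∈ U ∧ i ≠ r then g i c / g r c else 0)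
        (Pi.single r 1) ∈ Lm ∧
      1 + s • Matrix.vecMulVec (Pi.single c 1)
        (fun j => if j ∈ V ∧ j ≠ c then g r j / g r c else 0) ∈ Rm

theorem exists_nonzero_of_det_ne_zero {g : Matrix J J K} (hg : g.det ≠ 0) (i : J) :
    ∃ j, g i j ≠ 0 := by
  by_contra! h
  exact hg (Matrix.det_eq_zero_of_row_eq_zero i h)

theorem exists_monomial_aux {Lm Rm : Submonoid (Matrix J J K)} (H : HasPivots Lm Rm)
    (N : ℕ) (U V : Finset J) (hU : U.card = N) (g : Matrix J J K) (hg : g.det ≠ 0)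
    (h1 : ∀ i ∉ U, ∀ j j', g i j ≠ 0 → g i j' ≠ 0 → j = j')
    (h2 : ∀ j ∉ V, ∀ i i', g i j ≠ 0 → g i' j ≠ 0 → i = i')
    (h3 : ∀ i ∈ U, ∀ j ∉ V, g i j = 0) (h4 : ∀ i ∉ U, ∀ j ∈ V, g i j = 0) :
    ∃ l ∈ Lm, ∃ l' ∈ Lm, ∃ r ∈ Rm, ∃ r' ∈ Rm, l * l' = 1 ∧ r * r' = 1 ∧
      (∀ i j j', (l * g * r) i j ≠ 0 → (l * g * r) i j' ≠ 0 → j = j') ∧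
      ∀ j i i', (l * g * r) i j ≠ 0 → (l * g * r) i' j ≠ 0 → i = i' := by
  induction N generalizing U V g with
  | zero =>
    rw [Finset.card_eq_zero] at hU
    subst hU
    refine ⟨1, Lm.one_mem, 1, Lm.one_mem, 1, Rm.one_mem, 1, Rm.one_mem, by simp, by simp, ?_, ?_⟩
    · rw [one_mul, mul_one]
      exact fun i => h1 i (Finset.notMem_empty i)
    · rw [one_mul, mul_one]
      intro j i i' hi
      by_cases hj : j ∈ V
      · exact absurd (h4 i (Finset.notMem_empty i) j hj) hi
      · exact h2 j hj i i' hi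
  | succ N ih =>
    obtain ⟨r, hr, c, hc, hrc, hops⟩ := H g U V (Finset.card_pos.1 (by omega)) (fun i hi => by
      obtain ⟨j, hj⟩ := exists_nonzero_of_det_ne_zero hg i
      exact ⟨j, by_contra fun hjV => hj (h3 i hi j hjV), hj⟩)
    set u : J → K := fun i => if i ∈ U ∧ i ≠ r then g i c / g r c else 0 with hu
    set v : J → K := fun j => if j ∈ V ∧ j ≠ c then g r j / g r c else 0 with hv
    have hur : u r = 0 := by simp [hu]
    have hvc : v c = 0 := by simp [hv]
    set A := Matrix.vecMulVec u (Pi.single r 1) with hA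
    set B := Matrix.vecMulVec (Pi.single c 1) v with hB
    have hAA : A * A = 0 := by
      rw [hA, Matrix.vecMulVec_mul_vecMulVec]
      simp [hur]
    have hBB : B * B = 0 := by
      rw [hB, Matrix.vecMulVec_mul_vecMulVec]
      simp [hvc]
    have hA1 : (1 + (1 : K) • A) * (1 + (-1 : K) • A) = 1 := by
      rw [one_smul, neg_one_smul, add_mul, mul_add, mul_add, mul_neg, mul_neg, hAA]; simp
    have hA2 : (1 + (-1 : K) • A) * (1 + (1 : K) • A) = 1 := by
      rw [one_smul, neg_one_smul, add_mul, mul_add, mul_add, neg_mul, neg_mul, hAA]; simp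
    have hB2 : (1 + (-1 : K) • B) * (1 + (1 : K) • B) = 1 := by
      rw [one_smul, neg_one_smul, add_mul, mul_add, mul_add, neg_mul, neg_mul, hBB]; simp
    set g' := (1 + (-1 : K) • A) * g * (1 + (-1 : K) • B) with hg'
    have hdet : g'.det ≠ 0 := by
      rw [hg', Matrix.det_mul, Matrix.det_mul]
      have e1 := congrArg Matrix.det hA2
      have e2 := congrArg Matrix.det hB2
      rw [Matrix.det_mul, Matrix.det_one] at e1 e2
      exact mul_ne_zero (mul_ne_zero (left_ne_zero_of_mul_eq_one e1) hg)
        (left_ne_zero_of_mul_eq_one e2)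
    have hAg : ∀ (x : Matrix J J K) i j, (A * x) i j = u i * x r j := by
      intro x i j
      simp [hA, Matrix.vecMulVec_mul, Matrix.vecMulVec_apply]
    have hgB : ∀ (x : Matrix J J K) i j, (x * B) i j = x i c * v j := by
      intro x i j
      simp [hB, Matrix.mul_vecMulVec, Matrix.vecMulVec_apply]
    have hent : ∀ i j, g' i j = g i j - g i c * v j - u i * (g r j - g r c * v j) := by
      intro i j
      rw [hg', neg_one_smul, neg_one_smul, ← sub_eq_add_neg, ← sub_eq_add_neg, mul_sub, mul_one,
        sub_mul, one_mul, Matrix.sub_apply, Matrix.sub_apply, hAg, hgB, Matrix.sub_apply, hAg]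
      ring
    have hrj : ∀ j, j ≠ c → g r j - g r c * v j = 0 := by
      intro j hj
      by_cases hjV : j ∈ V
      · simp only [hv, hjV, hj, ne_eq, not_false_eq_true, and_self, if_true]
        field_simp
        ring
      · simp [hv, hjV, h3 r hr j hjV]
    have hrow : ∀ i ∉ U, ∀ j, g' i j = g i j := by
      intro i hi j
      have e1 : u i = 0 := by simp [hu, hi]
      rw [hent, h4 i hi c hc, e1]; ring
    have hcol : ∀ j ∉ V, ∀ i, g' i j = g i j := by
      intro j hj i
      have e1 : v j = 0 := by simp [hv, hj]
      rw [hent, e1, h3 r hr j hj]; ring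
    have hr' : ∀ j, j ≠ c → g' r j = 0 := by
      intro j hj
      rw [hent, hur, zero_mul, sub_zero]; exact hrj j hj
    have hc' : ∀ i, i ≠ r → g' i c = 0 := by
      intro i hi
      rw [hent, hvc]
      by_cases hiU : i ∈ U
      · simp only [hu, hiU, hi, ne_eq, not_false_eq_true, and_self, if_true]
        field_simp
        ring
      · rw [h4 i hiU c hc]; simp [hu, hiU]
    obtain ⟨l, hl, l', hl', q, hq, q', hq', e1, e2, m1, m2⟩ := ih (U.erase r) (V.erase c)
      (by rw [Finset.card_erase_of_mem hr, hU]; rfl) g' hdet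
      (by
        intro i hi j j' hj hj'
        by_cases hir : i = r
        · subst hir
          exact (by_contra fun h => hj (hr' j h) : j = c).trans
            (by_contra fun h => hj' (hr' j' h) : j' = c).symm
        · have hiU : i ∉ U := fun h => hi (Finset.mem_erase.2 ⟨hir, h⟩)
          rw [hrow i hiU] at hj hj'
          exact h1 i hiU j j' hj hj')
      (by
        intro j hj i i' hi hi'
        by_cases hjc : j = c
        · subst hjc
          exact (by_contra fun h => hi (hc' i h) : i = r).trans
            (by_contra fun h => hi' (hc' i' h) : i' = r).symm
        · have hjV : j ∉ V := fun h => hj (Finset.mem_erase.2 ⟨hjc, h⟩)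
          rw [hcol j hjV] at hi hi'
          exact h2 j hjV i i' hi hi')
      (by
        intro i hi j hj
        rw [Finset.mem_erase] at hi
        by_cases hjc : j = c
        · subst hjc; exact hc' i hi.1
        · have hjV : j ∉ V := fun h => hj (Finset.mem_erase.2 ⟨hjc, h⟩)
          rw [hcol j hjV, h3 i hi.2 j hjV])
      (by
        intro i hi j hj
        rw [Finset.mem_erase] at hj
        by_cases hir : i = r
        · subst hir; exact hr' j hj.1
        · have hiU : i ∉ U := fun h => hi (Finset.mem_erase.2 ⟨hir, h⟩)
          rw [hrow i hiU, h4 i hiU j hj.2])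
    refine ⟨l * (1 + (-1 : K) • A), Lm.mul_mem hl (hops _ (Or.inr rfl)).1,
      (1 + (1 : K) • A) * l', Lm.mul_mem (hops _ (Or.inl rfl)).1 hl',
      (1 + (-1 : K) • B) * q, Rm.mul_mem (hops _ (Or.inr rfl)).2 hq,
      q' * (1 + (1 : K) • B), Rm.mul_mem hq' (hops _ (Or.inl rfl)).2, ?_, ?_, ?_⟩
    · rw [mul_assoc, ← mul_assoc _ _ l', hA2, one_mul, e1]
    · rw [mul_assoc, ← mul_assoc q, e2, one_mul, hB2]
    · rw [show l * (1 + (-1 : K) • A) * g * ((1 + (-1 : K) • B) * q) = l * g' * q by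
        rw [hg']; simp only [mul_assoc]]
      exact ⟨m1, m2⟩

/-- Gaussian elimination to a monomial matrix. -/
theorem exists_monomial {Lm Rm : Submonoid (Matrix J J K)} (H : HasPivots Lm Rm)
    (g : Matrix J J K) (hg : g.det ≠ 0) :
    ∃ l ∈ Lm, ∃ l' ∈ Lm, ∃ r ∈ Rm, ∃ r' ∈ Rm, l * l' = 1 ∧ r * r' = 1 ∧
      ∃ (σ : Equiv.Perm J) (c : J → K), (∀ j, c j ≠ 0) ∧
        l * g * r = Matrix.of fun i j => if i = σ j then c j else 0 := by
  obtain ⟨l, hl, l', hl', r, hr, r', hr', e1, e2, m1, m2⟩ := exists_monomial_aux H _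
    Finset.univ Finset.univ rfl g hg (by simp) (by simp) (by simp) (by simp)
  refine ⟨l, hl, l', hl', r, hr, r', hr', e1, e2, ?_⟩
  set w := l * g * r with hw
  have hdet : w.det ≠ 0 := by
    rw [hw, Matrix.det_mul, Matrix.det_mul]
    have d1 := congrArg Matrix.det e1
    have d2 := congrArg Matrix.det e2
    rw [Matrix.det_mul, Matrix.det_one] at d1 d2
    exact mul_ne_zero (mul_ne_zero (left_ne_zero_of_mul_eq_one d1) hg)
      (left_ne_zero_of_mul_eq_one d2)
  have hcol : ∀ j, ∃ i, w i j ≠ 0 := by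
    intro j
    by_contra! h
    exact hdet (Matrix.det_eq_zero_of_column_eq_zero j h)
  choose s hs using hcol
  have hinj : Function.Injective s := fun j j' h => m1 (s j) j j' (hs j) (by rw [h]; exact hs j')
  refine ⟨Equiv.ofBijective s (Finite.injective_iff_bijective.1 hinj), fun j => w (s j) j, hs, ?_⟩
  ext i j
  rw [Matrix.of_apply]
  split_ifs with h
  · rw [h]; rfl
  · by_contra hne
    exact h (m2 j i (s j) hne (hs j))

end monomial

section weights

variable {R J K : Type*} [Fintype R] [Fintype J] [Field K]

/-- The weight of a monomial for real column weights `x`. -/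
noncomputable def colWeight (x : J → ℝ) (α : R × J →₀ ℕ) : ℝ := ∑ j, x j * ∑ r, (α (r, j) : ℝ)

theorem colWeight_add (x : J → ℝ) (α β : R × J →₀ ℕ) :
    colWeight x (α + β) = colWeight x α + colWeight x β := by
  simp [colWeight, mul_add, Finset.sum_add_distrib]

@[simp] theorem colWeight_zero (x : J → ℝ) : colWeight x (0 : R × J →₀ ℕ) = 0 := by
  simp [colWeight]

theorem colWeight_single [DecidableEq J] (x : J → ℝ) (i : R × J) (e : ℕ) :
    colWeight x (Finsupp.single i e) = e * x i.2 := by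
  classical
  rw [colWeight, Finset.sum_eq_single i.2]
  · rw [Finset.sum_eq_single i.1]
    · simp [mul_comm]
    · intro r _ hr
      rw [Finsupp.single_eq_of_ne]; · simp
      intro h; exact hr (by rw [← h])
    · simp
  · intro j _ hj
    rw [Finset.sum_eq_zero, mul_zero]
    intro r _
    rw [Finsupp.single_eq_of_ne]; · simp
    intro h; exact hj (by rw [← h])
  · simp

/-- All monomials of `p` have `x`-weight at least `c`. -/
def WeightGE (x : J → ℝ) (c : ℝ) (p : MvPolynomial (R × J) K) : Prop :=
  ∀ α ∈ p.support, c ≤ colWeight x α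

theorem WeightGE.mono {x : J → ℝ} {c c' : ℝ} {p : MvPolynomial (R × J) K} (h : WeightGE x c p)
    (hc : c' ≤ c) : WeightGE x c' p := fun α hα => hc.trans (h α hα)

theorem WeightGE.zero {x : J → ℝ} {c : ℝ} : WeightGE x c (0 : MvPolynomial (R × J) K) := by
  intro α hα; simp at hα

theorem WeightGE.add {x : J → ℝ} {c : ℝ} {p q : MvPolynomial (R × J) K} (hp : WeightGE x c p)
    (hq : WeightGE x c q) : WeightGE x c (p + q) := by
  classical
  intro α hα
  rcases Finset.mem_union.1 (support_add hα) with h | h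
  exacts [hp α h, hq α h]

theorem WeightGE.sum {κ : Type*} {x : J → ℝ} {c : ℝ} {s : Finset κ} {p : κ → MvPolynomial (R × J) K}
    (hp : ∀ i ∈ s, WeightGE x c (p i)) : WeightGE x c (∑ i ∈ s, p i) := by
  classical
  induction s using Finset.induction_on with
  | empty => simpa using WeightGE.zero
  | insert a s ha ih =>
    rw [Finset.sum_insert ha]
    exact (hp a (Finset.mem_insert_self a s)).add
      (ih fun i hi => hp i (Finset.mem_insert_of_mem hi))

theorem WeightGE.mul {x : J → ℝ} {c d : ℝ} {p q : MvPolynomial (R × J) K} (hp : WeightGE x c p)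
    (hq : WeightGE x d q) : WeightGE x (c + d) (p * q) := by
  classical
  intro α hα
  obtain ⟨a, ha, b, hb, rfl⟩ := Finset.mem_add.1 (support_mul p q hα)
  rw [colWeight_add]
  exact add_le_add (hp a ha) (hq b hb)

theorem WeightGE.C (x : J → ℝ) (a : K) : WeightGE x 0 (C a : MvPolynomial (R × J) K) := by
  classical
  intro α hα
  rw [mem_support_iff, coeff_C] at hα
  have : α = 0 := by
    by_contra h
    exact hα (if_neg (Ne.symm h))
  simp [this]

theorem WeightGE.pow {x : J → ℝ} {c : ℝ} {p : MvPolynomial (R × J) K} (hp : WeightGE x c p)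
    (e : ℕ) : WeightGE x (e * c) (p ^ e) := by
  induction e with
  | zero => simpa using WeightGE.C x (1 : K)
  | succ e ih =>
    rw [pow_succ]
    exact (ih.mul hp).mono (by push_cast; linarith)

theorem WeightGE.X [DecidableEq J] (x : J → ℝ) (i : R × J) :
    WeightGE x (x i.2) (X i : MvPolynomial (R × J) K) := by
  classical
  intro α hα
  rw [support_X, Finset.mem_singleton] at hα
  rw [hα, colWeight_single]; simp

theorem WeightGE.rsub [DecidableEq J] {x y : J → ℝ} {c : ℝ} {p : MvPolynomial (R × J) K}
    (hp : WeightGE x c p) {g : Matrix J J K} (hg : ∀ i j, g i j ≠ 0 → x j ≤ y i) :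
    WeightGE y c (rsub g p) := by
  have hX : ∀ i : R × J, WeightGE y (x i.2) (AlgebraicMonoid.rsub g (MvPolynomial.X i : MvPolynomial (R × J) K)) := by
    intro i
    rw [rsub_X]
    refine WeightGE.sum fun j _ => ?_
    by_cases h : g j i.2 = 0
    · simpa [h] using WeightGE.zero
    · refine ((WeightGE.C y (g j i.2)).mul (WeightGE.X y (i.1, j))).mono ?_
      simpa using hg _ _ h
  have hmon : ∀ (α : R × J →₀ ℕ) (a : K), WeightGE y (colWeight x α)
      (AlgebraicMonoid.rsub g (monomial α a)) := by
    intro α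
    induction α using Finsupp.induction_linear with
    | zero =>
      intro a
      rw [colWeight_zero, ← C_apply, rsub_C]
      exact WeightGE.C y a
    | add f g' h1 h2 =>
      intro a
      rw [colWeight_add, show monomial (f + g') a = monomial f a * monomial g' (1 : K) by
        rw [monomial_mul, mul_one], map_mul]
      exact (h1 a).mul (h2 1)
    | single i e =>
      intro a
      rw [colWeight_single, ← C_mul_X_pow_eq_monomial, map_mul, map_pow, rsub_C]
      exact ((WeightGE.C y a).mul ((hX i).pow e)).mono (by simp)
  rw [← support_sum_monomial_coeff p, map_sum]
  exact WeightGE.sum fun α hα => (hmon α _).mono (hp α hα)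

theorem exists_min_sum_sq {C : Set (J → ℝ)} (hC : IsClosed C) (hne : C.Nonempty) :
    ∃ x ∈ C, ∀ y ∈ C, ∑ j, x j ^ 2 ≤ ∑ j, y j ^ 2 := by
  let e := (EuclideanSpace.equiv J ℝ)
  have h1 : IsClosed (e ⁻¹' C) := hC.preimage e.continuous
  obtain ⟨z, hz⟩ := hne
  obtain ⟨x, hx, hd⟩ := h1.exists_infDist_eq_dist ⟨e.symm z, by simpa using hz⟩ 0
  refine ⟨e x, hx, fun y hy => ?_⟩
  have h2 : Metric.infDist 0 (e ⁻¹' C) ≤ dist 0 (e.symm y) :=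
    Metric.infDist_le_dist_of_mem (by simpa using hy)
  rw [hd, dist_zero_left, dist_zero_left] at h2
  have h3 := pow_le_pow_left₀ (norm_nonneg _) h2 2
  rw [EuclideanSpace.norm_sq_eq, EuclideanSpace.norm_sq_eq] at h3
  simp only [Real.norm_eq_abs, sq_abs] at h3
  exact h3

/-- Matrices which do not decrease the weight `x`. -/
def parabolic (K : Type*) [Field K] [DecidableEq J] (x : J → ℝ) : Submonoid (Matrix J J K) where
  carrier := {g | ∀ i j, g i j ≠ 0 → x j ≤ x i}
  one_mem' := by
    intro i j h
    by_cases hij : i = j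
    · rw [hij]
    · exact absurd (Matrix.one_apply_ne hij) h
  mul_mem' := by
    intro g h hg hh i j hij
    rw [Matrix.mul_apply] at hij
    obtain ⟨l, _, hl⟩ := Finset.exists_ne_zero_of_sum_ne_zero hij
    exact (hh l j (right_ne_zero_of_mul hl)).trans (hg i l (left_ne_zero_of_mul hl))

theorem hasPivots_parabolic [DecidableEq J] (x : J → ℝ) :
    HasPivots (parabolic K x) (parabolic K x) := by
  classical
  intro g U V hU hV
  obtain ⟨r, hr, hmin⟩ := U.exists_min_image x hU
  obtain ⟨c₀, hc₀, hc₀'⟩ := hV r hr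
  obtain ⟨c, hc, hmax⟩ := (V.filter fun j => g r j ≠ 0).exists_max_image x
    ⟨c₀, Finset.mem_filter.2 ⟨hc₀, hc₀'⟩⟩
  rw [Finset.mem_filter] at hc
  refine ⟨r, hr, c, hc.1, hc.2, fun s _ => ⟨fun i j hij => ?_, fun i j hij => ?_⟩⟩
  · by_cases h : i = j
    · rw [h]
    rw [Matrix.add_apply, Matrix.one_apply_ne h, zero_add, Matrix.smul_apply,
      Matrix.vecMulVec_apply, smul_eq_mul] at hij
    have h1 := right_ne_zero_of_mul hij
    have h2 := right_ne_zero_of_mul h1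
    have hj : j = r := by
      by_contra hj
      exact h2 (Pi.single_eq_of_ne hj _)
    have h3 := left_ne_zero_of_mul h1
    rw [hj]
    refine hmin i ?_
    by_contra hi
    exact h3 (if_neg fun hh => hi hh.1)
  · by_cases h : i = j
    · rw [h]
    rw [Matrix.add_apply, Matrix.one_apply_ne h, zero_add, Matrix.smul_apply,
      Matrix.vecMulVec_apply, smul_eq_mul] at hij
    have h1 := right_ne_zero_of_mul hij
    have h2 := left_ne_zero_of_mul h1
    have hj : i = c := by
      by_contra hj
      exact h2 (Pi.single_eq_of_ne hj _)
    have h3 := right_ne_zero_of_mul h1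
    rw [hj]
    by_cases h4 : j ∈ V ∧ j ≠ c
    · rw [if_pos h4] at h3
      exact hmax j (Finset.mem_filter.2 ⟨h4.1, fun h0 => h3 (by rw [h0, zero_div])⟩)
    · exact absurd (if_neg h4) h3

end weights

section kempf

variable {R ι K : Type*} [Fintype R] [Fintype ι] [DecidableEq ι] {n : ι → ℕ} [Field K]

theorem isClosed_destabilizing {m : ι → ℕ} {Θ : MvPolynomial (R × (Σ i, Fin (n i))) K}
    (hΘ : IsMultihom Θ m) :
    IsClosed {x : (Σ i, Fin (n i)) → ℝ | (∀ i, ∑ a, x ⟨i, a⟩ = 0) ∧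
      ∃ b : ∀ i, Matrix (Fin (n i)) (Fin (n i)) K, (∀ i, (b i).det ≠ 0) ∧
        WeightGE x 1 (rsub (Matrix.blockDiagonal' b) Θ)} := by
  classical
  let d := ∑ i, m i
  let cs : (R × (Σ i, Fin (n i)) →₀ ℕ) → ((Σ i, Fin (n i)) → ℕ) := fun α j => ∑ r, α (r, j)
  let 𝒮 : Set (Finset ((Σ i, Fin (n i)) → ℕ)) := {S | ∃ b : ∀ i, Matrix (Fin (n i)) (Fin (n i)) K,
    (∀ i, (b i).det ≠ 0) ∧ S = (rsub (Matrix.blockDiagonal' b) Θ).support.image cs}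
  have hfin : 𝒮.Finite := by
    refine Set.Finite.subset
      (Finset.finite_toSet (Fintype.piFinset fun _ => Finset.range (d + 1)).powerset) ?_
    rintro S ⟨b, _, rfl⟩
    rw [Finset.mem_coe, Finset.mem_powerset]
    intro a ha
    obtain ⟨α, hα, rfl⟩ := Finset.mem_image.1 ha
    rw [Fintype.mem_piFinset]
    intro j
    rw [Finset.mem_range, Nat.lt_succ_iff]
    have h := (hΘ.rsub b).isHomogeneous (mem_support_iff.1 hα)
    rw [Finsupp.weight_apply, Finsupp.sum_fintype _ _ (by simp), Fintype.sum_prod_type_right] at h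
    simp only [Pi.one_apply, smul_eq_mul, mul_one] at h
    show ∑ r, α (r, j) ≤ ∑ i, m i
    rw [← h]
    exact Finset.single_le_sum (f := fun j => ∑ r, α (r, j)) (fun _ _ => Nat.zero_le _)
      (Finset.mem_univ j)
  have heq : {x : (Σ i, Fin (n i)) → ℝ | (∀ i, ∑ a, x ⟨i, a⟩ = 0) ∧
      ∃ b : ∀ i, Matrix (Fin (n i)) (Fin (n i)) K, (∀ i, (b i).det ≠ 0) ∧
        WeightGE x 1 (rsub (Matrix.blockDiagonal' b) Θ)} =
      {x | ∀ i, ∑ a, x ⟨i, a⟩ = 0} ∩ ⋃ S ∈ 𝒮, {x | ∀ a ∈ S, 1 ≤ ∑ j, x j * (a j : ℝ)} := by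
    ext x
    simp only [Set.mem_ofPred_eq, Set.mem_inter_iff, Set.mem_iUnion, exists_prop]
    refine and_congr_right fun _ => ⟨?_, ?_⟩
    · rintro ⟨b, hb, h⟩
      refine ⟨_, ⟨b, hb, rfl⟩, fun a ha => ?_⟩
      obtain ⟨α, hα, rfl⟩ := Finset.mem_image.1 ha
      have := h α hα
      simp only [cs]
      push_cast
      exact this
    · rintro ⟨_, ⟨b, hb, rfl⟩, h⟩
      refine ⟨b, hb, fun α hα => ?_⟩
      have := h (cs α) (Finset.mem_image_of_mem _ hα)
      simp only [cs] at this
      push_cast at this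
      exact this
  rw [heq]
  refine IsClosed.inter ?_ (hfin.isClosed_biUnion fun S _ => ?_)
  · rw [Set.ofPred_forall]
    exact isClosed_iInter fun i => isClosed_eq (by fun_prop) continuous_const
  · simp only [Set.ofPred_forall]
    exact isClosed_iInter fun a => isClosed_iInter fun _ =>
      isClosed_le continuous_const (by fun_prop)

theorem blockDiagonal'_weight {x y : (Σ i, Fin (n i)) → ℝ}
    {g : ∀ i, Matrix (Fin (n i)) (Fin (n i)) K}
    (hg : ∀ i a a', g i a a' ≠ 0 → x ⟨i, a'⟩ ≤ y ⟨i, a⟩) :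
    ∀ j j', Matrix.blockDiagonal' g j j' ≠ 0 → x j' ≤ y j := by
  rintro ⟨i, a⟩ ⟨i', a'⟩ h
  by_cases hi : i = i'
  · subst hi
    rw [Matrix.blockDiagonal'_apply_eq] at h
    exact hg i a a' h
  · exact absurd (Matrix.blockDiagonal'_apply_ne _ _ _ hi) h

theorem colWeight_midpoint {J : Type*} [Fintype J] (x y : J → ℝ) (α : R × J →₀ ℕ) :
    colWeight (fun j => (x j + y j) / 2) α = (colWeight x α + colWeight y α) / 2 := by
  simp only [colWeight]
  rw [← Finset.sum_add_distrib, Finset.sum_div]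
  exact Finset.sum_congr rfl fun j _ => by ring

/-- A form which is semi-invariant under a spanning set of block matrices is semistable for the
product of the special linear groups of the blocks. -/
theorem not_destabilized {m : ι → ℕ} {Θ : MvPolynomial (R × (Σ i, Fin (n i))) K}
    (hΘ : IsMultihom Θ m) (hΘ0 : Θ ≠ 0) (T : Set (∀ i, Matrix (Fin (n i)) (Fin (n i)) K))
    (hdet : ∀ t ∈ T, ∀ i, (t i).det ≠ 0)
    (hT : ∀ t ∈ T, ∃ c, rsub (Matrix.blockDiagonal' t) Θ = C c * Θ)
    (hspan : Submodule.span K T = ⊤) (b₀ : ∀ i, Matrix (Fin (n i)) (Fin (n i)) K)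
    (hb₀ : ∀ i, (b₀ i).det ≠ 0) (x₀ : (Σ i, Fin (n i)) → ℝ) (hx₀ : ∀ i, ∑ a, x₀ ⟨i, a⟩ = 0) :
    ¬ ∀ α ∈ (rsub (Matrix.blockDiagonal' b₀) Θ).support, 0 < colWeight x₀ α := by
  classical
  intro hpos
  have hinv : ∀ b : ∀ i, Matrix (Fin (n i)) (Fin (n i)) K, (∀ i, (b i).det ≠ 0) →
      rsub (Matrix.blockDiagonal' b) Θ ≠ 0 := by
    intro b hb h
    have h1 : rsub (Matrix.blockDiagonal' fun i => (b i)⁻¹) (rsub (Matrix.blockDiagonal' b) Θ) = Θ := by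
      rw [rsub_rsub, ← Matrix.blockDiagonal'_mul,
        show (fun i => (b i)⁻¹ * b i) = 1 from _root_.funext fun i =>
          Matrix.nonsing_inv_mul _ (isUnit_iff_ne_zero.2 (hb i)), Matrix.blockDiagonal'_one, rsub_one]
    rw [h, map_zero] at h1
    exact hΘ0 h1.symm
  have hne : {x : (Σ i, Fin (n i)) → ℝ | (∀ i, ∑ a, x ⟨i, a⟩ = 0) ∧
      ∃ b : ∀ i, Matrix (Fin (n i)) (Fin (n i)) K, (∀ i, (b i).det ≠ 0) ∧
        WeightGE x 1 (rsub (Matrix.blockDiagonal' b) Θ)}.Nonempty := by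
    obtain ⟨α₀, hα₀, hmin⟩ := (rsub (Matrix.blockDiagonal' b₀) Θ).support.exists_min_image
      (colWeight x₀) (support_nonempty.2 (hinv b₀ hb₀))
    set c := colWeight x₀ α₀ with hc
    have hc0 : 0 < c := hpos α₀ hα₀
    refine ⟨fun j => c⁻¹ * x₀ j, fun i => ?_, b₀, hb₀, fun α hα => ?_⟩
    · rw [← Finset.mul_sum, hx₀, mul_zero]
    · have : colWeight (fun j => c⁻¹ * x₀ j) α = c⁻¹ * colWeight x₀ α := by
        simp only [colWeight, Finset.mul_sum, mul_assoc]
      rw [this, ← inv_mul_cancel₀ hc0.ne']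
      exact mul_le_mul_of_nonneg_left (hmin α hα) (inv_nonneg.2 hc0.le)
  obtain ⟨x, ⟨hx0, b, hb, hxb⟩, hmin⟩ := exists_min_sum_sq (isClosed_destabilizing hΘ) hne
  have hb1 : ∀ i, b i * (b i)⁻¹ = 1 := fun i =>
    Matrix.mul_nonsing_inv _ (isUnit_iff_ne_zero.2 (hb i))
  have hb2 : ∀ i, (b i)⁻¹ * b i = 1 := fun i =>
    Matrix.nonsing_inv_mul _ (isUnit_iff_ne_zero.2 (hb i))
  have hbi : ∀ i, ((b i)⁻¹).det ≠ 0 := fun i h => by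
    have := congrArg Matrix.det (hb1 i)
    rw [Matrix.det_mul, h, mul_zero, Matrix.det_one] at this
    exact zero_ne_one this
  have key : ∀ t ∈ T, ∀ i a a', (b i * t i * (b i)⁻¹) a a' ≠ 0 → x ⟨i, a'⟩ ≤ x ⟨i, a⟩ := by
    intro t ht
    have hmon := fun i => exists_monomial (hasPivots_parabolic (K := K) fun a : Fin (n i) => x ⟨i, a⟩)
      (b i * t i * (b i)⁻¹) (by
        rw [Matrix.det_mul, Matrix.det_mul]
        exact mul_ne_zero (mul_ne_zero (hb i) (hdet t ht i)) (hbi i))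
    choose l hl l' hl' r hr r' hr' e1 e2 σ c hc hw using hmon
    let winv : ∀ i, Matrix (Fin (n i)) (Fin (n i)) K := fun i =>
      Matrix.of fun a a' => if a' = σ i a then (c i a)⁻¹ else 0
    have hwinv : ∀ i, winv i * (l i * (b i * t i * (b i)⁻¹) * r i) = 1 := by
      intro i
      rw [hw]
      ext a a'
      rw [Matrix.mul_apply, Finset.sum_eq_single (σ i a)]
      · simp only [winv, Matrix.of_apply, if_true, Matrix.one_apply]
        by_cases h : a = a'
        · subst h; simp [hc i a]
        · simp [h]
      · intro s _ hs
        simp [winv, hs]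
      · simp
    let y : (Σ i, Fin (n i)) → ℝ := fun j => x ⟨j.1, σ j.1 j.2⟩
    obtain ⟨ct, hct⟩ := hT t ht
    have hb1det : ∀ i, (r' i * b i).det ≠ 0 := by
      intro i
      rw [Matrix.det_mul]
      refine mul_ne_zero (fun h => ?_) (hb i)
      have := congrArg Matrix.det (e2 i)
      rw [Matrix.det_mul, h, mul_zero, Matrix.det_one] at this
      exact zero_ne_one this
    have W1 : WeightGE x 1 (rsub (Matrix.blockDiagonal' fun i => r' i * b i) Θ) := by
      rw [Matrix.blockDiagonal'_mul, ← rsub_rsub]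
      exact hxb.rsub (blockDiagonal'_weight fun i => hr' i)
    have W2 : WeightGE y 1 (rsub (Matrix.blockDiagonal' fun i => r' i * b i) Θ) := by
      have e3 : (fun i => r' i * b i) = fun i => winv i * (l i * (b i * t i)) := by
        refine _root_.funext fun i => ?_
        calc r' i * b i = (winv i * (l i * (b i * t i * (b i)⁻¹) * r i)) * (r' i * b i) := by
              rw [hwinv, one_mul]
          _ = winv i * (l i * (b i * t i * (b i)⁻¹)) * (r i * r' i) * b i := by
              simp only [mul_assoc]
          _ = winv i * (l i * (b i * t i)) * ((b i)⁻¹ * b i) := by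
              rw [e2, mul_one]; simp only [mul_assoc]
          _ = winv i * (l i * (b i * t i)) := by rw [hb2, mul_one]
      rw [e3, Matrix.blockDiagonal'_mul, Matrix.blockDiagonal'_mul, Matrix.blockDiagonal'_mul,
        ← rsub_rsub, ← rsub_rsub, ← rsub_rsub, hct, map_mul, rsub_C]
      refine WeightGE.rsub (x := x) (WeightGE.rsub (x := x) ?_ (blockDiagonal'_weight fun i => hl i))
        (blockDiagonal'_weight fun i a a' h => ?_)
      · exact ((WeightGE.C x ct).mul hxb).mono (by simp)
      · have : a' = σ i a := by
          by_contra hne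
          exact h (by simp [winv, hne])
        rw [this]
    have hsumsq : ∀ φ : ℝ → ℝ, ∑ j, φ (y j) = ∑ j, φ (x j) := by
      intro φ
      rw [Fintype.sum_sigma, Fintype.sum_sigma]
      exact Finset.sum_congr rfl fun i _ => Equiv.sum_comp (σ i) fun a => φ (x ⟨i, a⟩)
    have hsumy : ∀ i, ∑ a, y ⟨i, a⟩ = 0 := fun i => by
      rw [← hx0 i]
      exact Equiv.sum_comp (σ i) fun a => x ⟨i, a⟩
    have hm := hmin (fun j => (x j + y j) / 2) ⟨fun i => by
      rw [← Finset.sum_div, Finset.sum_add_distrib, hx0, hsumy]; simp,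
      _, hb1det, fun α hα => by
        rw [colWeight_midpoint]
        have := W1 α hα
        have := W2 α hα
        linarith⟩
    have hpar : ∑ j, ((x j + y j) / 2) ^ 2 =
        (∑ j, x j ^ 2 + ∑ j, y j ^ 2) / 2 - ∑ j, ((x j - y j) / 2) ^ 2 := by
      rw [← Finset.sum_add_distrib, Finset.sum_div, ← Finset.sum_sub_distrib]
      exact Finset.sum_congr rfl fun j _ => by ring
    have h0 : ∑ j, ((x j - y j) / 2) ^ 2 ≤ 0 := by
      have := hsumsq (fun s => s ^ 2)
      linarith
    have hxy : ∀ j, x j = y j := by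
      intro j
      have h1 := (Finset.sum_eq_zero_iff_of_nonneg (fun j _ => sq_nonneg ((x j - y j) / 2))).1
        (le_antisymm h0 (Finset.sum_nonneg fun j _ => sq_nonneg _)) j (Finset.mem_univ j)
      have h2 := pow_eq_zero_iff (two_ne_zero) |>.1 h1
      linarith
    intro i
    have hg : b i * t i * (b i)⁻¹ = l' i * (l i * (b i * t i * (b i)⁻¹) * r i) * r' i := by
      calc b i * t i * (b i)⁻¹ = (l' i * l i) * (b i * t i * (b i)⁻¹) * (r i * r' i) := by
            rw [e2, mul_eq_one_comm.1 (e1 i), one_mul, mul_one]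
        _ = _ := by simp only [mul_assoc]
    have hmem : b i * t i * (b i)⁻¹ ∈ parabolic K fun a : Fin (n i) => x ⟨i, a⟩ := by
      rw [hg]
      refine Submonoid.mul_mem _ (Submonoid.mul_mem _ (hl' i) ?_) (hr' i)
      rw [hw]
      intro a a' h
      have : a = σ i a' := by
        by_contra hne
        exact h (by simp [hne])
      show x ⟨i, a'⟩ ≤ x ⟨i, a⟩
      rw [this]
      exact (hxy ⟨i, a'⟩).le
    exact hmem
  let V : Submodule K (∀ i, Matrix (Fin (n i)) (Fin (n i)) K) :=
    { carrier := {t | ∀ i a a', ¬ x ⟨i, a'⟩ ≤ x ⟨i, a⟩ → (b i * t i * (b i)⁻¹) a a' = 0}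
      add_mem' := by
        intro s t hs ht i a a' h
        rw [Pi.add_apply, mul_add, add_mul, Matrix.add_apply, hs i a a' h, ht i a a' h, add_zero]
      zero_mem' := by
        intro i a a' _
        simp
      smul_mem' := by
        intro c t ht i a a' h
        rw [Pi.smul_apply, Matrix.mul_smul, Matrix.smul_mul, Matrix.smul_apply, ht i a a' h,
          smul_zero] }
  have hV : V = ⊤ := by
    rw [eq_top_iff, ← hspan, Submodule.span_le]
    intro t ht i a a' h
    by_contra h'
    exact h (key t ht i a a' h')
  have hall : ∀ i a a', x ⟨i, a'⟩ ≤ x ⟨i, a⟩ := by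
    intro i a a'
    by_contra h
    have hmem : (fun i => (b i)⁻¹ * Matrix.of (fun _ _ => (1 : K)) * b i) ∈ V := by
      rw [hV]; trivial
    have h1 := hmem i a a' h
    rw [show b i * ((b i)⁻¹ * Matrix.of (fun _ _ => (1 : K)) * b i) * (b i)⁻¹ =
      (b i * (b i)⁻¹) * Matrix.of (fun _ _ => (1 : K)) * (b i * (b i)⁻¹) by simp only [mul_assoc],
      hb1, one_mul, mul_one] at h1
    exact one_ne_zero h1
  have hzero : ∀ j, x j = 0 := by
    rintro ⟨i, a⟩
    have h1 : ∑ a', x ⟨i, a'⟩ = ∑ _a' : Fin (n i), x ⟨i, a⟩ :=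
      Finset.sum_congr rfl fun a' _ => le_antisymm (hall i a a') (hall i a' a)
    rw [hx0, Finset.sum_const, Finset.card_univ, Fintype.card_fin, nsmul_eq_mul] at h1
    exact (mul_eq_zero.1 h1.symm).resolve_left (by
      have := a.pos
      exact_mod_cast this.ne')
  obtain ⟨α, hα⟩ := support_nonempty.2 (hinv b hb)
  have := hxb α hα
  simp only [colWeight, hzero, zero_mul, Finset.sum_const_zero] at this
  linarith

end kempf

section valuations

variable {R J K : Type*} [Fintype R] [Fintype J] [DecidableEq J] [Field K]

/-- Matrices of determinant one over a valuation ring. -/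
def integralSL (J : Type*) [Fintype J] [DecidableEq J] (O : ValuationSubring K) :
    Submonoid (Matrix J J K) where
  carrier := {g | (∀ i j, g i j ∈ O) ∧ g.det = 1}
  one_mem' := by
    refine ⟨fun i j => ?_, Matrix.det_one⟩
    rw [Matrix.one_apply]
    split_ifs
    exacts [O.one_mem, O.zero_mem]
  mul_mem' := by
    intro g h hg hh
    refine ⟨fun i j => ?_, by rw [Matrix.det_mul, hg.2, hh.2, one_mul]⟩
    rw [Matrix.mul_apply]
    exact sum_mem fun l _ => O.mul_mem _ _ (hg.1 i l) (hh.1 l j)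

theorem det_one_add_vecMulVec (u v : J → K) (h : ∑ j, v j * u j = 0) :
    (1 + Matrix.vecMulVec u v).det = 1 := by
  rw [Matrix.vecMulVec_eq Unit, Matrix.det_one_add_replicateCol_mul_replicateRow]
  simp [dotProduct, h]

theorem hasPivots_integralSL (O : ValuationSubring K) :
    HasPivots (integralSL J O) (integralSL J O) := by
  classical
  intro g U V hU hV
  obtain ⟨r₀, hr₀⟩ := hU
  obtain ⟨c₀, hc₀, hne⟩ := hV r₀ hr₀
  obtain ⟨⟨r, c⟩, hrc, hmax⟩ := (U ×ˢ V).exists_max_image (fun z => O.valuation (g z.1 z.2))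
    ⟨(r₀, c₀), Finset.mem_product.2 ⟨hr₀, hc₀⟩⟩
  rw [Finset.mem_product] at hrc
  have hmax' : ∀ i ∈ U, ∀ j ∈ V, O.valuation (g i j) ≤ O.valuation (g r c) :=
    fun i hi j hj => hmax (i, j) (Finset.mem_product.2 ⟨hi, hj⟩)
  have hg : g r c ≠ 0 := by
    intro h
    have := hmax' r₀ hr₀ c₀ hc₀
    rw [h, map_zero, le_zero_iff, map_eq_zero] at this
    exact hne this
  have hdiv : ∀ i ∈ U, ∀ j ∈ V, g i j / g r c ∈ O := by
    intro i hi j hj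
    rw [← O.valuation_le_one_iff, map_div₀]
    exact div_le_one_of_le₀ (hmax' i hi j hj) zero_le
  have hone : ∀ i j : J, (1 : Matrix J J K) i j ∈ O := (integralSL J O).one_mem.1
  have hsingle : ∀ i j : J, (Pi.single i (1 : K) : J → K) j ∈ O := by
    intro i j
    rw [Pi.single_apply]
    split_ifs
    exacts [O.one_mem, O.zero_mem]
  refine ⟨r, hrc.1, c, hrc.2, hg, fun s hs => ?_⟩
  have hsO : s ∈ O := by
    rcases hs with rfl | rfl
    exacts [O.one_mem, O.neg_mem _ O.one_mem]
  refine ⟨⟨fun i j => ?_, ?_⟩, fun i j => ?_, ?_⟩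
  · refine O.add_mem _ _ (hone i j) (O.mul_mem _ _ hsO (O.mul_mem _ _ ?_ (hsingle _ _)))
    dsimp only
    split_ifs with h
    exacts [hdiv i h.1 c hrc.2, O.zero_mem]
  · rw [← Matrix.smul_vecMulVec]
    refine det_one_add_vecMulVec _ _ ?_
    rw [Finset.sum_eq_single r]
    · simp
    · intro j _ hj
      simp [hj]
    · simp
  · refine O.add_mem _ _ (hone i j) (O.mul_mem _ _ hsO (O.mul_mem _ _ (hsingle _ _) ?_))
    dsimp only
    split_ifs with h
    exacts [hdiv r hrc.1 j h.1, O.zero_mem]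
  · rw [← Matrix.smul_vecMulVec]
    refine det_one_add_vecMulVec _ _ ?_
    rw [Finset.sum_eq_single c]
    · simp
    · intro j _ hj
      simp [hj]
    · simp

theorem coeff_rsub_diagonal (c : J → K) (p : MvPolynomial (R × J) K) (α : R × J →₀ ℕ) :
    coeff α (rsub (Matrix.diagonal c) p) = coeff α p * ∏ j, c j ^ ∑ r, α (r, j) := by
  classical
  have hX : ∀ z : R × J, rsub (Matrix.diagonal c) (X z : MvPolynomial (R × J) K) = C (c z.2) * X z := by
    intro z
    rw [rsub_X, Finset.sum_eq_single z.2]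
    · rw [Matrix.diagonal_apply_eq]
    · intro j _ hj
      rw [Matrix.diagonal_apply_ne _ hj, C_0, zero_mul]
    · simp
  have hmon : ∀ (β : R × J →₀ ℕ) (a : K), rsub (Matrix.diagonal c) (monomial β a) =
      C (∏ j, c j ^ ∑ r, β (r, j)) * monomial β a := by
    intro β
    induction β using Finsupp.induction_linear with
    | zero =>
      intro a
      rw [← C_apply, rsub_C]
      simp
    | add f g h1 h2 =>
      intro a
      rw [show monomial (f + g) a = monomial f a * monomial g (1 : K) by
        rw [monomial_mul, mul_one], map_mul, h1, h2]
      simp only [Finsupp.add_apply, Finset.sum_add_distrib, pow_add, Finset.prod_mul_distrib,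
        map_mul]
      ring
    | single z e =>
      intro a
      rw [← C_mul_X_pow_eq_monomial, map_mul, map_pow, rsub_C, hX, Finset.prod_eq_single z.2]
      · rw [Finset.sum_eq_single z.1]
        · simp only [Prod.mk.eta, Finsupp.single_eq_same, map_pow]
          ring
        · intro r _ hr
          rw [Finsupp.single_eq_of_ne]
          intro h; exact hr (by rw [← h])
        · simp
      · intro j _ hj
        rw [Finset.sum_eq_zero, pow_zero]
        intro r _
        rw [Finsupp.single_eq_of_ne]
        intro h; exact hj (by rw [← h])
      · simp
  induction p using MvPolynomial.induction_on' with
  | monomial β a =>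
    rw [hmon, coeff_C_mul, coeff_monomial]
    split_ifs with h
    · rw [h, mul_comm]
    · simp
  | add p q hp hq => rw [map_add, coeff_add, coeff_add, hp, hq, add_mul]

theorem valuation_coeff_rsub_lt (O : ValuationSubring K) {g : Matrix J J K} (hg : ∀ i j, g i j ∈ O)
    {ε : O.ValueGroup} (hε : ε ≠ 0) {p : MvPolynomial (R × J) K}
    (hp : ∀ α, O.valuation (coeff α p) < ε) (α : R × J →₀ ℕ) :
    O.valuation (coeff α (rsub g p)) < ε := by
  have h1 : ∀ β : R × J →₀ ℕ, coeff α (rsub g (monomial β 1)) ∈ O := by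
    intro β
    have : rsub g (monomial β (1 : K)) = map O.subtype
        (rsub (Matrix.of fun i j => (⟨g i j, hg i j⟩ : O)) (monomial β 1)) := by
      rw [map_rsub, map_monomial, map_one O.subtype]
      rfl
    rw [this, coeff_map]
    exact Subtype.property _
  rw [← support_sum_monomial_coeff p, map_sum, coeff_sum]
  refine Valuation.map_sum_lt _ hε fun β _ => ?_
  rw [show monomial β (coeff β p) = C (coeff β p) * monomial β 1 by
    rw [C_mul_monomial, mul_one], map_mul, rsub_C, coeff_C_mul, map_mul]
  exact (mul_le_of_le_one_right' ((O.valuation_le_one_iff _).2 (h1 β))).trans_lt (hp β)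

end valuations

theorem span_map_eq_top {ι F K : Type*} [Fintype ι] [DecidableEq ι] {n : ι → ℕ} [Field F] [Field K]
    (φ : F →+* K) (T : Set (∀ i, Matrix (Fin (n i)) (Fin (n i)) F))
    (hspan : Submodule.span F T = ⊤) :
    Submodule.span K ((fun t i => (t i).map φ) '' T) = ⊤ := by
  classical
  have h1 : ∀ t : ∀ i, Matrix (Fin (n i)) (Fin (n i)) F, (fun i => (t i).map φ) ∈
      Submodule.span K ((fun (t : ∀ i, Matrix (Fin (n i)) (Fin (n i)) F) i => (t i).map φ) '' T) := by
    intro t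
    have ht : t ∈ Submodule.span F T := by rw [hspan]; trivial
    induction ht using Submodule.span_induction with
    | mem t ht => exact Submodule.subset_span ⟨t, ht, rfl⟩
    | zero =>
      convert Submodule.zero_mem _ using 1
      ext i a b
      simp
    | add s t _ _ hs ht =>
      convert Submodule.add_mem _ hs ht using 1
      ext i a b
      simp
    | smul c t _ ht =>
      convert Submodule.smul_mem _ (φ c) ht using 1
      ext i a b
      simp
  rw [eq_top_iff]
  intro X _
  have hX : X = ∑ i, ∑ a, ∑ b, X i a b • (fun i' =>
      (Pi.single (M := fun i => Matrix (Fin (n i)) (Fin (n i)) F) i (Matrix.single a b (1 : F)) i').map φ) := by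
    ext i' a' b'
    rw [Finset.sum_apply, Matrix.sum_apply, Finset.sum_eq_single i']
    · rw [Finset.sum_apply, Matrix.sum_apply, Finset.sum_eq_single a']
      · rw [Finset.sum_apply, Matrix.sum_apply, Finset.sum_eq_single b']
        · simp
        · intro b _ hb
          simp [hb]
        · simp
      · intro a _ ha
        rw [Finset.sum_apply, Matrix.sum_apply]
        refine Finset.sum_eq_zero fun b _ => ?_
        simp [ha]
      · simp
    · intro i _ hi
      rw [Finset.sum_apply, Matrix.sum_apply]
      refine Finset.sum_eq_zero fun a _ => ?_
      rw [Finset.sum_apply, Matrix.sum_apply]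
      refine Finset.sum_eq_zero fun b _ => ?_
      simp [Pi.single_eq_of_ne (Ne.symm hi)]
    · simp
  rw [hX]
  exact Submodule.sum_mem _ fun i _ => Submodule.sum_mem _ fun a _ => Submodule.sum_mem _ fun b _ =>
    Submodule.smul_mem _ _ (h1 _)

section isolation

variable {R ι F : Type*} [Fintype R] [Fintype ι] [DecidableEq ι] {n : ι → ℕ} [Field F]

theorem IsMultihom.sum_block {A : Type*} [CommSemiring A]
    {p : MvPolynomial (R × (Σ i, Fin (n i))) A} {m : ι → ℕ} (hp : IsMultihom p m)
    {α : R × (Σ i, Fin (n i)) →₀ ℕ} (hα : coeff α p ≠ 0) (i : ι) :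
    ∑ a, ∑ r, α (r, ⟨i, a⟩) = m i := by
  classical
  have h := congrFun (hp hα) i
  rw [weight_blockWeight_apply, Finset.sum_subset (Finset.subset_univ _) (fun z _ hz => by
    rw [Finsupp.notMem_support_iff.1 hz]; simp), Fintype.sum_prod_type_right,
    Fintype.sum_sigma, Finset.sum_eq_single i] at h
  · simpa using h
  · intro i' _ hi'
    simp [hi']
  · simp

theorem det_monomial {J K : Type*} [Fintype J] [DecidableEq J] [Field K] (σ : Equiv.Perm J)
    (c : J → K) : (Matrix.of fun i j => if i = σ j then c j else 0).det =
      (Equiv.Perm.sign σ : ℤ) * ∏ j, c j := by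
  have : (Matrix.of fun i j => if i = σ j then c j else 0) =
      (Matrix.diagonal c).submatrix σ.symm id := by
    ext i j
    rw [Matrix.of_apply, Matrix.submatrix_apply, Matrix.diagonal_apply]
    by_cases h : i = σ j
    · subst h; simp
    · rw [if_neg h, if_neg]
      intro h'
      exact h (by rw [← id_eq (a := j), ← h']; simp)
  rw [this, Matrix.det_permute, Matrix.det_diagonal]
  simp

set_option maxHeartbeats 1000000 in
theorem not_valuation_lt {K : Type*} [Field K] [Algebra F K] (O : ValuationSubring K)
    (hF : ∀ a : F, algebraMap F K a ∈ O) {m q : ι → ℕ} (hq : ∀ i, m i = n i * q i)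
    {Θ : MvPolynomial (R × (Σ i, Fin (n i))) F}
    (hΘ : IsMultihom Θ m) (hΘ0 : Θ ≠ 0) (T : Set (∀ i, Matrix (Fin (n i)) (Fin (n i)) F))
    (hdet : ∀ t ∈ T, ∀ i, (t i).det ≠ 0)
    (hT : ∀ t ∈ T, ∃ c, rsub (Matrix.blockDiagonal' t) Θ = C c * Θ)
    (hspan : Submodule.span F T = ⊤) (G : ∀ i, Matrix (Fin (n i)) (Fin (n i)) K)
    (hG : ∀ i, (G i).det ≠ 0) :
    ¬ ∀ α, O.valuation (coeff α (rsub (Matrix.blockDiagonal' G) (map (algebraMap F K) Θ))) <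
      O.valuation (∏ i, (G i).det ^ q i) := by
  classical
  intro hlt
  have hmon := fun i => exists_monomial (hasPivots_integralSL (J := Fin (n i)) O) (G i) (hG i)
  choose l hl l' hl' r hr r' hr' e1 e2 σ c hc hw using hmon
  let π : ∀ i, Matrix (Fin (n i)) (Fin (n i)) K := fun i =>
    Matrix.of fun a a' => if a' = σ i a then 1 else 0
  have hπ : ∀ i, π i * (l i * G i * r i) = Matrix.diagonal (c i) := by
    intro i
    rw [hw]
    ext a a'
    rw [Matrix.mul_apply, Finset.sum_eq_single (σ i a)]
    · simp only [π, Matrix.of_apply, if_true, Matrix.diagonal_apply, one_mul,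
        EmbeddingLike.apply_eq_iff_eq]
      split_ifs with h
      · rw [h]
      · rfl
    · intro s _ hs
      simp [π, hs]
    · simp
  let γ : (Σ i, Fin (n i)) → O.ValueGroup := fun j => O.valuation (c j.1 j.2)
  have hγ : ∀ j, γ j ≠ 0 := fun j => (Valuation.ne_zero_iff _).2 (hc _ _)
  have hδ : O.valuation (∏ i, (G i).det ^ q i) = ∏ j, γ j ^ q j.1 := by
    rw [Fintype.prod_sigma, map_prod]
    refine Finset.prod_congr rfl fun i _ => ?_
    have h1 := congrArg Matrix.det (hw i)
    rw [Matrix.det_mul, Matrix.det_mul, (hl i).2, (hr i).2, one_mul, mul_one, det_monomial] at h1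
    rw [map_pow, h1, show (∏ a, γ ⟨i, a⟩ ^ q (⟨i, a⟩ : Σ i, Fin (n i)).1) = (∏ a, γ ⟨i, a⟩) ^ q i from by
      dsimp only; exact Finset.prod_pow _ _ _, map_mul, map_prod]
    rcases Int.units_eq_one_or (Equiv.Perm.sign (σ i)) with h | h <;> simp [h, γ]
  have hδ0 : O.valuation (∏ i, (G i).det ^ q i) ≠ 0 :=
    (Valuation.ne_zero_iff _).2 (Finset.prod_ne_zero_iff.2 fun i _ => pow_ne_zero _ (hG i))
  let φ : F →+* O := (algebraMap F K).codRestrict O.toSubring hF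
  let rO : ∀ i, Matrix (Fin (n i)) (Fin (n i)) O := fun i =>
    Matrix.of fun a b => ⟨r' i a b, (hr' i).1 a b⟩
  have hrO : ∀ i, (rO i).map O.subtype = r' i := fun i => rfl
  let ΘO := rsub (Matrix.blockDiagonal' rO) (map φ Θ)
  have hΘO : map O.subtype ΘO = rsub (Matrix.blockDiagonal' r') (map (algebraMap F K) Θ) := by
    rw [map_rsub, Matrix.blockDiagonal'_map _ _ (map_zero _), map_map]
    rfl
  have hmain : ∀ α, O.valuation (O.subtype (coeff α ΘO)) * ∏ j, γ j ^ ∑ s, α (s, j) < ∏ j, γ j ^ q j.1 := by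
    intro α
    have h1 : rsub (Matrix.diagonal fun j : (Σ i, Fin (n i)) => c j.1 j.2)
        (rsub (Matrix.blockDiagonal' r') (map (algebraMap F K) Θ)) =
        rsub (Matrix.blockDiagonal' fun i => π i * l i)
          (rsub (Matrix.blockDiagonal' G) (map (algebraMap F K) Θ)) := by
      rw [← Matrix.blockDiagonal'_diagonal, rsub_rsub, rsub_rsub, ← Matrix.blockDiagonal'_mul,
        ← Matrix.blockDiagonal'_mul]
      congr 2
      congr 1
      refine _root_.funext fun i => ?_
      rw [← hπ, mul_assoc, mul_assoc (l i * G i), e2, mul_one, mul_assoc]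
    have h2 := valuation_coeff_rsub_lt O (g := Matrix.blockDiagonal' fun i => π i * l i) (by
      rintro ⟨i, a⟩ ⟨i', a'⟩
      by_cases hi : i = i'
      · subst hi
        rw [Matrix.blockDiagonal'_apply_eq, Matrix.mul_apply]
        refine sum_mem fun s _ => O.mul_mem _ _ ?_ ((hl i).1 _ _)
        simp only [π, Matrix.of_apply]
        split_ifs
        exacts [O.one_mem, O.zero_mem]
      · rw [Matrix.blockDiagonal'_apply_ne _ _ _ hi]
        exact O.zero_mem) hδ0 hlt α
    rw [← h1, coeff_rsub_diagonal, ← hΘO, coeff_map, map_mul, map_prod, hδ] at h2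
    simpa only [map_pow] using h2
  let κ := IsLocalRing.ResidueField O
  let ρ : O →+* κ := IsLocalRing.residue O
  let bκ : ∀ i, Matrix (Fin (n i)) (Fin (n i)) κ := fun i => (rO i).map ρ
  have hbκ : ∀ i, (bκ i).det ≠ 0 := by
    intro i
    have h1 : (rO i).det = 1 := by
      have h2 := (hr' i).2
      rw [← hrO, ← RingHom.mapMatrix_apply, ← RingHom.map_det] at h2
      exact Subtype.ext h2
    have h3 : (bκ i).det = ρ (rO i).det := (RingHom.map_det ρ _).symm
    rw [h3, h1, map_one]
    exact one_ne_zero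
  have hΘκ : map ρ ΘO = rsub (Matrix.blockDiagonal' bκ) (map (ρ.comp φ) Θ) := by
    rw [map_rsub, Matrix.blockDiagonal'_map _ _ (map_zero _), map_map]
  have hΘh : IsMultihom (map (ρ.comp φ) Θ) m := hΘ.map _
  let J := Σ i, Fin (n i)
  let e : J ≃ Fin (Fintype.card J) := Fintype.equivFin J
  let dd : (R × J →₀ ℕ) → (Fin (Fintype.card J) → ℤ) := fun α s =>
    (∑ r, (α (r, e.symm s) : ℤ)) - q (e.symm s).1
  obtain ⟨x, hx⟩ := exists_halfspace (Fintype.card J) (fun d => ∏ s, γ (e.symm s) ^ d s < 1)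
    (by
      intro a b ha hb
      simp only [Pi.add_apply, zpow_add₀ (hγ _), Finset.prod_mul_distrib]
      exact (mul_le_of_le_one_right' hb.le).trans_lt ha)
    (by simp)
    ((map ρ ΘO).support.image dd) (by
      intro d hd
      obtain ⟨α, hα, rfl⟩ := Finset.mem_image.1 hd
      rw [mem_support_iff, coeff_map] at hα
      have hu : O.valuation (O.subtype (coeff α ΘO)) = 1 := by
        refine (O.valuation_eq_one_iff _).1 (by_contra fun h => ?_)
        exact hα ((IsLocalRing.residue_eq_zero_iff _).2 h)
      have h1 := hmain α
      rw [hu, one_mul] at h1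
      rw [Equiv.prod_comp e.symm (fun j => γ j ^ ((∑ r, (α (r, j) : ℤ)) - q j.1)) |>.symm |> fun h => h.symm]
      simp only [zpow_sub₀ (hγ _), Finset.prod_div_distrib, ← Nat.cast_sum, zpow_natCast]
      rwa [div_lt_one₀ (zero_lt_iff.2 (Finset.prod_ne_zero_iff.2 fun j _ => pow_ne_zero _ (hγ j)))])
  let avg : ι → ℝ := fun i => (∑ a, x (e ⟨i, a⟩)) / n i
  refine not_destabilized hΘh
    (fun h => hΘ0 (map_injective _ (ρ.comp φ).injective (by rw [h, map_zero])))
    ((fun t i => (t i).map (ρ.comp φ)) '' T) ?_ ?_ (span_map_eq_top _ T hspan) bκ hbκ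
    (fun j => x (e j) - avg j.1) ?_ ?_
  · rintro _ ⟨t, ht, rfl⟩ i
    have h3 : ((t i).map (ρ.comp φ)).det = (ρ.comp φ) (t i).det := (RingHom.map_det _ _).symm
    dsimp only
    rw [h3]
    exact (map_ne_zero _).2 (hdet t ht i)
  · rintro _ ⟨t, ht, rfl⟩
    obtain ⟨ct, hct⟩ := hT t ht
    refine ⟨(ρ.comp φ) ct, ?_⟩
    have h1 := congrArg (map (ρ.comp φ)) hct
    rw [map_rsub, Matrix.blockDiagonal'_map _ _ (map_zero _), map_mul, map_C] at h1
    exact h1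
  · intro i
    simp only [Finset.sum_sub_distrib, Finset.sum_const, Finset.card_univ, Fintype.card_fin,
      nsmul_eq_mul, avg]
    rcases Nat.eq_zero_or_pos (n i) with h | h
    · have : IsEmpty (Fin (n i)) := by rw [h]; infer_instance
      simp
    · field_simp
      ring
  · intro α hα
    rw [← hΘκ] at hα
    have h1 := hx _ (Finset.mem_image_of_mem dd hα)
    rw [hΘκ] at hα
    have h2 : colWeight (fun j : J => x (e j) - avg j.1) α = ∑ s, x s * (dd α s : ℝ) := by
      rw [← Equiv.sum_comp e]
      simp only [dd, Equiv.symm_apply_apply]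
      rw [colWeight, Fintype.sum_sigma, Fintype.sum_sigma]
      refine Finset.sum_congr rfl fun i _ => ?_
      have h3 := (hΘh.rsub bκ).sum_block (mem_support_iff.1 hα) i
      have h4 : ∑ a, ∑ r, (α (r, (⟨i, a⟩ : J)) : ℝ) = n i * q i := by
        have h5 := congrArg (Nat.cast : ℕ → ℝ) h3
        push_cast at h5
        rw [h5, hq]
        push_cast
        ring
      push_cast
      simp only [sub_mul, mul_sub, Finset.sum_sub_distrib]
      rw [← Finset.mul_sum, h4, ← Finset.sum_mul]
      congr 1
      simp only [avg]
      rcases Nat.eq_zero_or_pos (n i) with h | h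
      · have : IsEmpty (Fin (n i)) := by rw [h]; infer_instance
        simp
      · field_simp
    rw [h2]
    exact h1

end isolation

theorem ringHom_eval {A B σ : Type*} [CommSemiring A] [CommSemiring B] (φ : A →+* B) (x : σ → A)
    (p : MvPolynomial σ A) : φ (eval x p) = eval (fun i => φ (x i)) (map φ p) := by
  induction p using MvPolynomial.induction_on with
  | C a => simp
  | add p q hp hq => simp [hp, hq]
  | mul_X p i hp => simp [hp]

theorem map_homogeneousComponent {A B σ : Type*} [CommSemiring A] [CommSemiring B] (φ : A →+* B)
    (l : ℕ) (p : MvPolynomial σ A) :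
    map φ (homogeneousComponent l p) = homogeneousComponent l (map φ p) := by
  ext e
  rw [coeff_map, coeff_homogeneousComponent, coeff_homogeneousComponent, coeff_map]
  split_ifs <;> simp

section isolation

variable {R ι F : Type*} [Fintype R] [Fintype ι] [DecidableEq ι] {n : ι → ℕ} [Field F]

/-- The orbit of a form which is semi-invariant under a spanning set of block matrices stays away
from the origin. -/
theorem exists_isolating {m : ι → ℕ} (hm : ∀ i, n i ∣ m i)
    {Θ : MvPolynomial (R × (Σ i, Fin (n i))) F}
    (hΘ : IsMultihom Θ m) (hΘ0 : Θ ≠ 0) (T : Set (∀ i, Matrix (Fin (n i)) (Fin (n i)) F))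
    (hdet : ∀ t ∈ T, ∀ i, (t i).det ≠ 0)
    (hT : ∀ t ∈ T, ∃ c, rsub (Matrix.blockDiagonal' t) Θ = C c * Θ)
    (hspan : Submodule.span F T = ⊤) :
    ∃ f : MvPolynomial (R × (Σ i, Fin (n i)) →₀ ℕ) F, constantCoeff f = 0 ∧
      ∀ g : ∀ i, Matrix (Fin (n i)) (Fin (n i)) F, (∀ i, (g i).det = 1) →
        eval (coeffs (rsub (Matrix.blockDiagonal' g) Θ)) f = 1 := by
  classical
  choose q hq using hm
  let P := MvPolynomial (Σ i, Fin (n i) × Fin (n i)) F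
  let K := FractionRing P
  let gen : ∀ i, Matrix (Fin (n i)) (Fin (n i)) P := fun i => Matrix.of fun a b => X ⟨i, a, b⟩
  let ev : (∀ i, Matrix (Fin (n i)) (Fin (n i)) F) → P →+* F := fun g => eval fun z => g z.1 z.2.1 z.2.2
  have hgen : ∀ g i, (gen i).map (ev g) = g i := by
    intro g i
    ext a b
    exact eval_X (f := fun z : Σ i, Fin (n i) × Fin (n i) => g z.1 z.2.1 z.2.2) _
  have hgendet : ∀ i, (gen i).det ≠ 0 := by
    intro i h
    have h1 := congrArg (ev fun _ => 1) h
    rw [RingHom.map_det, RingHom.mapMatrix_apply, hgen (fun _ => 1) i, map_zero] at h1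
    exact one_ne_zero (Matrix.det_one.symm.trans h1)
  let cP : (R × (Σ i, Fin (n i)) →₀ ℕ) → P :=
    coeffs (rsub (Matrix.blockDiagonal' gen) (map (C : F →+* P) Θ))
  let δP : P := ∏ i, (gen i).det ^ q i
  let τ : P →+* K := algebraMap P K
  have hτ : Function.Injective τ := IsFractionRing.injective P K
  have hδ : τ δP ≠ 0 := (map_ne_zero_iff _ hτ).2
    (Finset.prod_ne_zero_iff.2 fun i _ => pow_ne_zero _ (hgendet i))
  let c' : (R × (Σ i, Fin (n i)) →₀ ℕ) → K := (τ δP)⁻¹ • fun α => τ (cP α)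
  have hFK : (τ.comp (C : F →+* P)) = algebraMap F K := rfl
  obtain ⟨f, hf0, hf⟩ : ∃ f : MvPolynomial (R × (Σ i, Fin (n i)) →₀ ℕ) F,
      constantCoeff f = 0 ∧ eval c' (map (algebraMap F K) f) = 1 := by
    by_contra hcon
    push Not at hcon
    let φ : MvPolynomial (R × (Σ i, Fin (n i)) →₀ ℕ) F →+* K :=
      (eval c').comp (map (algebraMap F K))
    have hI : (RingHom.ker (constantCoeff (R := F) (σ := R × (Σ i, Fin (n i)) →₀ ℕ))).map
        φ.rangeRestrict ≠ ⊤ := by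
      intro h
      rw [Ideal.eq_top_iff_one, Ideal.mem_map_iff_of_surjective _ φ.rangeRestrict_surjective] at h
      obtain ⟨f, hf, h1⟩ := h
      exact hcon f hf (congrArg Subtype.val h1)
    obtain ⟨O, hO1, hO2⟩ := Ideal.image_subset_nonunits_valuationSubring _ hI
    refine not_valuation_lt O (fun a => hO1 ⟨C a, ?_⟩) hq hΘ hΘ0 T hdet hT hspan
      (fun i => (gen i).map τ) (fun i => ?_) fun α => ?_
    · simp [φ]
    · rw [← RingHom.mapMatrix_apply, ← RingHom.map_det]
      exact (map_ne_zero_iff _ hτ).2 (hgendet i)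
    · have h1 : ∏ i, ((gen i).map τ).det ^ q i = τ δP := by
        rw [map_prod]
        refine Finset.prod_congr rfl fun i _ => ?_
        rw [← RingHom.mapMatrix_apply, ← RingHom.map_det, map_pow]
      have h2 : coeff α (rsub (Matrix.blockDiagonal' fun i => (gen i).map τ)
          (map (algebraMap F K) Θ)) = τ (cP α) := by
        rw [← hFK, ← map_map, ← Matrix.blockDiagonal'_map _ _ (map_zero _), ← map_rsub, coeff_map]
        rfl
      have h3 : c' α ∈ O.nonunits := by
        refine hO2 ⟨φ.rangeRestrict (X α), Ideal.mem_map_of_mem _ ?_, ?_⟩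
        · rw [RingHom.mem_ker, constantCoeff_X]
        · simp [φ]
      rw [h1, h2]
      rw [ValuationSubring.mem_nonunits_iff] at h3
      simp only [c', Pi.smul_apply, smul_eq_mul, map_mul, map_inv₀] at h3
      rwa [inv_mul_lt_one₀ (zero_lt_iff.2 ((Valuation.ne_zero_iff _).2 hδ))] at h3
  refine ⟨f, hf0, fun g hg => ?_⟩
  let D := f.totalDegree + 1
  have hPeq : δP ^ D = ∑ l ∈ Finset.range D,
      eval cP (map C (homogeneousComponent l f)) * δP ^ (D - l) := by
    apply hτ
    rw [sum_eval_homogeneousComponent (D := D) _ (by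
      exact Nat.lt_succ_of_le (Finset.sup_mono (support_map_subset _ _)))] at hf
    rw [map_pow, ← mul_one (τ δP ^ D), ← hf, Finset.mul_sum, map_sum]
    refine Finset.sum_congr rfl fun l hl => ?_
    rw [Finset.mem_range] at hl
    rw [map_mul, map_pow, ringHom_eval, map_map, hFK, map_homogeneousComponent, inv_pow,
      pow_sub₀ _ hδ hl.le]
    ring
  have h1 := congrArg (ev g) hPeq
  have hev : (ev g).comp C = RingHom.id F := by
    ext a
    exact eval_C _
  have hδg : ev g δP = 1 := by
    rw [map_prod]
    refine Finset.prod_eq_one fun i _ => ?_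
    rw [map_pow, RingHom.map_det, RingHom.mapMatrix_apply, hgen, hg, one_pow]
  have hcg : ∀ α, ev g (cP α) = coeffs (rsub (Matrix.blockDiagonal' g) Θ) α := by
    intro α
    show ev g (coeff α _) = coeff α _
    rw [← coeff_map, map_rsub, Matrix.blockDiagonal'_map _ _ (map_zero _), map_map, hev, map_id]
    simp only [hgen]
  rw [map_pow, map_sum, hδg, one_pow] at h1
  rw [← one_smul F (coeffs (rsub (Matrix.blockDiagonal' g) Θ)),
    sum_eval_homogeneousComponent (D := D) _ (Nat.lt_succ_self _)]
  refine Eq.trans ?_ h1.symm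
  refine Finset.sum_congr rfl fun l _ => ?_
  rw [map_mul, map_pow, hδg, one_pow, one_pow, mul_one, mul_one, ringHom_eval, map_map, hev, map_id]
  simp only [hcg]

end isolation

section semiinvariant

variable {R ι F X : Type*} [Fintype ι] [DecidableEq ι] {n : ι → ℕ} [Field F]

theorem rsub_weightedHomogeneousComponent (g : ∀ i, Matrix (Fin (n i)) (Fin (n i)) F) (m : ι → ℕ)
    (p : MvPolynomial (R × (Σ i, Fin (n i))) F) :
    weightedHomogeneousComponent (blockWeight R n) m (rsub (Matrix.blockDiagonal' g) p) =
      rsub (Matrix.blockDiagonal' g) (weightedHomogeneousComponent (blockWeight R n) m p) := by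
  classical
  induction p using MvPolynomial.induction_on' with
  | add p q hp hq => simp only [map_add, hp, hq]
  | monomial a c =>
    have h : IsMultihom (monomial a c) (Finsupp.weight (blockWeight R n) a) :=
      isWeightedHomogeneous_monomial _ _ _ rfl
    by_cases hm : m = Finsupp.weight (blockWeight R n) a
    · subst hm
      rw [(h.rsub g).weightedHomogeneousComponent_same, h.weightedHomogeneousComponent_same]
    · rw [(h.rsub g).weightedHomogeneousComponent_ne _ hm, h.weightedHomogeneousComponent_ne _ hm,
        map_zero]

theorem map_weightedHomogeneousComponent {A B σ M : Type*} [CommSemiring A] [CommSemiring B]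
    [AddCommMonoid M] (w : σ → M) (φ : A →+* B) (l : M) (p : MvPolynomial σ A) :
    map φ (weightedHomogeneousComponent w l p) = weightedHomogeneousComponent w l (map φ p) := by
  classical
  ext e
  rw [coeff_map, coeff_weightedHomogeneousComponent, coeff_weightedHomogeneousComponent, coeff_map]
  split_ifs <;> simp

theorem exists_weightedHomogeneousComponent_ne_zero {A σ M : Type*} [CommSemiring A]
    [AddCommMonoid M] (w : σ → M) {p : MvPolynomial σ A} (hp : p ≠ 0) :
    ∃ m, weightedHomogeneousComponent w m p ≠ 0 := by
  by_contra! h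
  exact hp (by rw [← sum_weightedHomogeneousComponent w p]; simp [h])

/-- A family of forms, permuted up to scalars by a group spanning the block matrices, gives rise to
an invariant polynomial. -/
theorem exists_invariant_of_semiinvariant [IsAlgClosed F] [Fintype R] (hn : ∀ i, 0 < n i)
    (ω : MvPolynomial (R × (Σ i, Fin (n i))) (MvPolynomial X F)) (hω0 : map (eval 0) ω = 0)
    (e : X → F) (hωe : map (eval e) ω ≠ 0) {Γ : Type*}
    (t : Γ → ∀ i, Matrix (Fin (n i)) (Fin (n i)) F) (ht : ∀ h i, (t h i).det ≠ 0)
    (hspan : Submodule.span F (Set.range t) = ⊤) (ρ : Γ → (X → F) → (X → F))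
    (hρ : ∀ h (s : F) x, ρ h (s • x) = s • ρ h x) (hρe : ∀ h, ρ h e = e)
    (hω : ∀ h, ∃ c : F, ∀ x, rsub (Matrix.blockDiagonal' (t h)) (map (eval x) ω) =
      C c * map (eval (ρ h x)) ω) :
    ∃ (d : ℕ) (P : MvPolynomial X F), 0 < d ∧ P.IsHomogeneous d ∧ eval e P ≠ 0 ∧
      ∀ h x, eval (ρ h x) P = eval x P := by
  classical
  have : Infinite F := IsAlgClosed.instInfinite
  obtain ⟨m₀, hm₀⟩ := exists_weightedHomogeneousComponent_ne_zero (blockWeight R n) hωe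
  obtain ⟨N, hN, hdvd⟩ : ∃ N, 0 < N ∧ ∀ i, n i ∣ N :=
    ⟨∏ i, n i, Finset.prod_pos fun i _ => hn i, fun i => Finset.dvd_prod_of_mem _ (Finset.mem_univ i)⟩
  let m : ι → ℕ := N • m₀
  have hm : ∀ i, n i ∣ m i := fun i => (hdvd i).mul_right _
  let w : MvPolynomial (R × (Σ i, Fin (n i))) (MvPolynomial X F) :=
    weightedHomogeneousComponent (blockWeight R n) m₀ ω ^ N
  have hwx : ∀ x : X → F, map (eval x) w =
      weightedHomogeneousComponent (blockWeight R n) m₀ (map (eval x) ω) ^ N := by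
    intro x
    rw [map_pow, map_weightedHomogeneousComponent]
  have hwm : ∀ x : X → F, IsMultihom (map (eval x) w) m := by
    intro x
    rw [hwx]
    exact (weightedHomogeneousComponent_isWeightedHomogeneous _ _).pow N
  have hw0 : map (eval (0 : X → F)) w = 0 := by
    rw [hwx, hω0, map_zero, zero_pow hN.ne']
  have hwe : map (eval e) w ≠ 0 := by
    rw [hwx]
    exact pow_ne_zero _ hm₀
  have hw : ∀ h, ∃ c : F, ∀ x, rsub (Matrix.blockDiagonal' (t h)) (map (eval x) w) =
      C c * map (eval (ρ h x)) w := by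
    intro h
    obtain ⟨c, hc⟩ := hω h
    refine ⟨c ^ N, fun x => ?_⟩
    rw [hwx, hwx, map_pow, ← rsub_weightedHomogeneousComponent, hc, ← smul_eq_C_mul, map_smul,
      smul_pow, smul_eq_C_mul]
  obtain ⟨f, hf0, hf⟩ := exists_isolating hm (hwm e) hwe (Set.range t) (by
    rintro _ ⟨h, rfl⟩
    exact ht h) (by
    rintro _ ⟨h, rfl⟩
    obtain ⟨c, hc⟩ := hw h
    exact ⟨c, by rw [hc, hρe]⟩) hspan
  obtain ⟨Φ, hΦ0, hΦ, hΦe⟩ := exists_invariant_of_isolated hn hm (hwm e) f hf0 hf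
  obtain ⟨δ, hδ⟩ : ∃ δ, eval (coeffs (map (eval e) w)) (homogeneousComponent δ Φ) ≠ 0 := by
    by_contra! hcon
    apply hΦe
    rw [← one_smul F (coeffs (map (eval e) w)),
      sum_eval_homogeneousComponent _ (Nat.lt_succ_self _)]
    simp [hcon]
  have hδ0 : δ ≠ 0 := by
    rintro rfl
    apply hδ
    rw [homogeneousComponent_zero, ← constantCoeff_eq, hΦ0]
    simp
  set Ψ := homogeneousComponent δ Φ with hΨ
  have hΨh : Ψ.IsHomogeneous δ := homogeneousComponent_isHomogeneous _ _
  have hΨinv : ∀ p : MvPolynomial (R × (Σ i, Fin (n i))) F, IsMultihom p m →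
      ∀ g : ∀ i, Matrix (Fin (n i)) (Fin (n i)) F, (∀ i, (g i).det = 1) →
        eval (coeffs (rsub (Matrix.blockDiagonal' g) p)) Ψ = eval (coeffs p) Ψ := by
    intro p hp g hg
    refine eval_homogeneousComponent_eq Φ _ _ (fun s => ?_) δ
    rw [← coeffs_C_mul, ← coeffs_C_mul, ← hΦ (C s * p) _ g hg, map_mul, rsub_C]
    rw [← smul_eq_C_mul]
    exact (weightedHomogeneousSubmodule F (blockWeight R n) m).smul_mem s hp
  let P : MvPolynomial X F := aeval (coeffs w) Ψ
  have hPx : ∀ x, eval x P = eval (coeffs (map (eval x) w)) Ψ := by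
    intro x
    have h1 : (eval x).comp (algebraMap F (MvPolynomial X F)) = RingHom.id F := by
      ext a
      exact eval_C _
    simp only [P, aeval_def, hom_eval₂, h1]
    rw [eval₂_id]
    exact congrArg (fun y => eval y Ψ) (_root_.funext fun a => (coeff_map _ _ _).symm)
  have hP0 : eval (0 : X → F) P = 0 := by
    rw [hPx, hw0]
    have : coeffs (0 : MvPolynomial (R × (Σ i, Fin (n i))) F) = (0 : F) • 0 := by
      ext
      simp [coeffs]
    rw [this, eval_smul_of_isHomogeneous hΨh, zero_pow hδ0, zero_mul]
  have hPinv : ∀ h x, eval (ρ h x) P = eval x P := by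
    intro h
    obtain ⟨c, hc⟩ := hw h
    choose s y hsy hy _ using fun i => exists_smul_det_one (hn i) (t h i) (ht h i)
    let τ : F := ∏ i, s i ^ m i
    have hbd : Matrix.blockDiagonal' (t h) =
        Matrix.blockDiagonal' (fun i => s i • (1 : Matrix (Fin (n i)) (Fin (n i)) F)) *
          Matrix.blockDiagonal' y := by
      rw [← Matrix.blockDiagonal'_mul]
      exact congrArg _ (_root_.funext fun i => by rw [hsy i, Matrix.smul_mul, one_mul])
    have hs : ∀ i, s i ≠ 0 := by
      intro i h0
      have : Nonempty (Fin (n i)) := ⟨⟨0, hn i⟩⟩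
      apply ht h i
      rw [hsy i, h0, zero_smul, Matrix.det_zero]
    have hτ : τ ≠ 0 := Finset.prod_ne_zero_iff.2 fun i _ => pow_ne_zero _ (hs i)
    have key : ∀ x, τ ^ δ * eval x P = c ^ δ * eval (ρ h x) P := by
      intro x
      rw [hPx, hPx, ← eval_smul_of_isHomogeneous hΨh c, ← coeffs_C_mul, ← hc, hbd, ← rsub_rsub,
        ((hwm x).rsub y).rsub_smul s, coeffs_C_mul, eval_smul_of_isHomogeneous hΨh,
        hΨinv _ (hwm x) y hy]
    have hcτ : τ ^ δ = c ^ δ := by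
      have := key e
      rw [hρe] at this
      exact mul_right_cancel₀ (by rwa [hPx]) this
    intro x
    exact (mul_left_cancel₀ (pow_ne_zero δ hτ) ((key x).trans (by rw [hcτ]))).symm
  obtain ⟨d, hd⟩ : ∃ d, eval e (homogeneousComponent d P) ≠ 0 := by
    by_contra! hcon
    apply hδ
    rw [← hPx, ← one_smul F e, sum_eval_homogeneousComponent _ (Nat.lt_succ_self _)]
    simp [hcon]
  refine ⟨d, homogeneousComponent d P, Nat.pos_of_ne_zero ?_, homogeneousComponent_isHomogeneous _ _,
    hd, fun h x => eval_homogeneousComponent_eq P _ _ (fun s => ?_) d⟩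
  · rintro rfl
    apply hd
    rw [homogeneousComponent_zero, eval_C]
    rwa [← constantCoeff_eq, ← eval_zero]
  · rw [← hρ, hPinv]

end semiinvariant

theorem exists_linearIndependent_of_span_range {F E Z N : Type*} [Field F] [AddCommGroup E]
    [Module F E] [Fintype N] (b : Module.Basis N F E) (v : Z → E)
    (hv : Submodule.span F (Set.range v) = ⊤) : ∃ z : N → Z, LinearIndependent F fun c => v (z c) := by
  obtain ⟨B, hB, hspan, hli⟩ := exists_linearIndependent F (Set.range v)
  rw [hv] at hspan
  let b' : Module.Basis B F E := Module.Basis.mk hli (by rw [Subtype.range_coe, hspan])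
  let eqv := b.indexEquiv b'
  choose z hz using fun c => hB (eqv c).2
  refine ⟨z, ?_⟩
  simp only [hz]
  exact hli.comp eqv eqv.injective

section stackDet

variable {N R J A : Type*} [Fintype N] [DecidableEq N] [CommRing A]

/-- The determinant of a family of polynomials in independent copies of their variables. -/
noncomputable def stackDet (u : N → MvPolynomial (R × J) A) : MvPolynomial ((N × R) × J) A :=
  (Matrix.of fun c c' => rename (Prod.map (Prod.mk c') id) (u c)).det

theorem map_stackDet {B : Type*} [CommRing B] (φ : A →+* B) (u : N → MvPolynomial (R × J) A) :
    map φ (stackDet u) = stackDet fun c => map φ (u c) := by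
  rw [stackDet, RingHom.map_det]
  congr 1
  ext c c'
  simp [map_rename]

theorem rsub_stackDet [Fintype J] (g : Matrix J J A) (u : N → MvPolynomial (R × J) A) :
    rsub g (stackDet u) = stackDet fun c => rsub g (u c) := by
  rw [stackDet, AlgHom.map_det]
  congr 1
  ext c c'
  simp [rsub_rename]

theorem stackDet_mul (M : Matrix N N A) (u : N → MvPolynomial (R × J) A) :
    stackDet (fun c => ∑ c', C (M c c') * u c') = C M.det * stackDet u := by
  rw [stackDet, stackDet, RingHom.map_det, ← Matrix.det_mul]
  congr 1
  ext c c'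
  simp [Matrix.mul_apply]

theorem stackDet_ne_zero {F : Type*} [Field F] [Infinite F] (u : N → MvPolynomial (R × J) F)
    (hu : LinearIndependent F u) : stackDet u ≠ 0 := by
  classical
  let v : (R × J → F) → N → F := fun z c => eval z (u c)
  have hv : Submodule.span F (Set.range v) = ⊤ := by
    by_contra hne
    obtain ⟨f, hf0, hf⟩ := Submodule.exists_le_ker_of_lt_top _ (lt_top_iff_ne_top.2 hne)
    have h0 : ∑ c, f (Pi.single c 1) • u c = 0 := by
      refine MvPolynomial.funext fun z => ?_
      have h1 := LinearMap.mem_ker.1 (hf (Submodule.subset_span ⟨z, rfl⟩))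
      rw [LinearMap.pi_apply_eq_sum_univ] at h1
      rw [map_zero, ← h1, map_sum]
      refine Finset.sum_congr rfl fun c _ => ?_
      rw [smul_eval, smul_eq_mul, mul_comm]
      congr 2
      ext c'
      simp [Pi.single_apply, eq_comm]
    have h2 := Fintype.linearIndependent_iff.1 hu _ h0
    exact hf0 (LinearMap.pi_ext' fun c => LinearMap.ext_ring (by simpa using h2 c))
  obtain ⟨z, hz⟩ := exists_linearIndependent_of_span_range (Pi.basisFun F N) v hv
  intro h
  have h1 := congrArg (eval fun w : (N × R) × J => z w.1.1 (w.1.2, w.2)) h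
  rw [stackDet, RingHom.map_det, map_zero] at h1
  have h2 : (eval fun w : (N × R) × J => z w.1.1 (w.1.2, w.2)).mapMatrix
      (Matrix.of fun c c' => rename (Prod.map (Prod.mk c') id) (u c)) =
      (Matrix.of fun c => v (z c)).transpose := by
    ext c c'
    simp [v, eval_rename]
    rfl
  rw [h2, Matrix.det_transpose] at h1
  have h3 : LinearIndependent F (Matrix.of fun c => v (z c)).row := hz
  rw [Matrix.linearIndependent_rows_iff_isUnit, Matrix.isUnit_iff_isUnit_det, h1] at h3
  exact not_isUnit_zero h3

end stackDet

section descent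

variable {ι F X L Γ : Type*} [Fintype ι] [DecidableEq ι] {n : ι → ℕ} [Field F] [IsAlgClosed F]
  [Field L] [Algebra F L]

theorem totalDegree_rsub_le {R J A : Type*} [CommSemiring A] [Fintype J] (g : Matrix J J A)
    (p : MvPolynomial (R × J) A) : (rsub g p).totalDegree ≤ p.totalDegree := by
  classical
  conv_lhs => rw [← sum_homogeneousComponent p, map_sum]
  refine totalDegree_finsetSum_le fun l hl => ?_
  refine (isHomogeneous_rsub (homogeneousComponent_isHomogeneous l p) g).totalDegree_le.trans ?_
  exact Nat.lt_succ_iff.1 (Finset.mem_range.1 hl)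

/-- A polynomial with coefficients in a field of rational functions on a group of block matrices,
compatible with translations, gives rise to an invariant polynomial. -/
theorem exists_invariant_of_equivariant (hn : ∀ i, 0 < n i)
    (θ : MvPolynomial ((Σ i, Fin (n i)) × (Σ i, Fin (n i))) F →ₐ[F] L)
    (t : Γ → ∀ i, Matrix (Fin (n i)) (Fin (n i)) F) (ht : ∀ h i, (t h i).det ≠ 0)
    (hspan : Submodule.span F (Set.range t) = ⊤) (ρ : Γ → (X → F) → (X → F))
    (hρ : ∀ h (s : F) x, ρ h (s • x) = s • ρ h x) (hρs : ∀ h, Function.Surjective (ρ h))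
    (e : X → F) (hρe : ∀ h, ρ h e = e) (σ : Γ → L →ₐ[F] L)
    (hσ : ∀ h p, θ (rsub (Matrix.blockDiagonal' (t h)) p) = σ h (θ p)) (Q : MvPolynomial X L)
    (hQ : ∀ h x, σ h (eval (fun a => algebraMap F L (x a)) Q) =
      eval (fun a => algebraMap F L (ρ h x a)) Q)
    (hQe : eval (fun a => algebraMap F L (e a)) Q = 1) (hQ0 : constantCoeff Q = 0)
    (v : MvPolynomial ((Σ i, Fin (n i)) × (Σ i, Fin (n i))) F) (hv : θ v ≠ 0)
    (hvQ : ∀ α, ∃ s, θ v * coeff α Q = θ s) :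
    ∃ (d : ℕ) (P : MvPolynomial X F), 0 < d ∧ P.IsHomogeneous d ∧ eval e P ≠ 0 ∧
      ∀ h x, eval (ρ h x) P = eval x P := by
  classical
  have : Infinite F := IsAlgClosed.instInfinite
  let S := MvPolynomial ((Σ i, Fin (n i)) × (Σ i, Fin (n i))) F
  let r : Γ → S →ₐ[F] S := fun h => rsub (Matrix.blockDiagonal' (t h))
  let q : (X → F) → L := fun x => eval (fun a => algebraMap F L (x a)) Q
  choose s hs using hvQ
  let d : ℕ := Q.support.sup fun α => (s α).totalDegree
  let Sd : Submodule F S := restrictTotalDegree _ F d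
  let S₀ : Submodule F S := restrictTotalDegree _ F v.totalDegree
  let W : Submodule F L := Sd.map θ.toLinearMap
  have hSd : ∀ h, ∀ p ∈ Sd, r h p ∈ Sd := fun h p hp =>
    (mem_restrictTotalDegree _ _ _).2
      ((totalDegree_rsub_le _ _).trans ((mem_restrictTotalDegree _ _ _).1 hp))
  have hS₀ : ∀ h, ∀ p ∈ S₀, r h p ∈ S₀ := fun h p hp =>
    (mem_restrictTotalDegree _ _ _).2
      ((totalDegree_rsub_le _ _).trans ((mem_restrictTotalDegree _ _ _).1 hp))
  -- denominators
  let E : Submodule F S := S₀ ⊓ ⨅ x : X → F, W.comap (LinearMap.mulRight F (q x) ∘ₗ θ.toLinearMap)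
  have hE : ∀ p, p ∈ E ↔ p ∈ S₀ ∧ ∀ x, θ p * q x ∈ W := by
    intro p
    simp [E, Submodule.mem_inf, Submodule.mem_iInf]
  have hEr : ∀ h, ∀ p ∈ E, r h p ∈ E := by
    intro h p hp
    rw [hE] at hp ⊢
    refine ⟨hS₀ h p hp.1, fun x => ?_⟩
    obtain ⟨y, rfl⟩ := hρs h x
    obtain ⟨u, hu, hu'⟩ := hp.2 y
    refine ⟨r h u, hSd h u hu, ?_⟩
    show θ (r h u) = θ (r h p) * eval _ Q
    rw [hσ, hσ, ← hQ, ← map_mul]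
    exact congrArg _ hu'
  have hvE : v ∈ E := by
    rw [hE]
    refine ⟨(mem_restrictTotalDegree _ _ _).2 le_rfl, fun x => ?_⟩
    simp only [q, eval_eq, Finset.mul_sum]
    refine W.sum_mem fun α hα => ?_
    simp only [← map_pow]
    rw [← map_prod, ← mul_assoc, hs, mul_comm, ← Algebra.smul_def]
    exact W.smul_mem _ ⟨s α, (mem_restrictTotalDegree _ _ _).2
      (Finset.le_sup (f := fun α => (s α).totalDegree) hα), rfl⟩
  obtain ⟨sec, hsec⟩ : ∃ sec : L →ₗ[F] S, ∀ w ∈ W, sec w ∈ Sd ∧ θ (sec w) = w := by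
    let f : Sd →ₗ[F] W := (θ.toLinearMap.domRestrict Sd).codRestrict W fun p => ⟨p, p.2, rfl⟩
    obtain ⟨g, hg⟩ := f.exists_rightInverse_of_surjective (LinearMap.range_eq_top.2 (by
      rintro ⟨_, p, hp, rfl⟩
      exact ⟨⟨p, hp⟩, rfl⟩))
    obtain ⟨g', hg'⟩ := LinearMap.exists_extend (Sd.subtype ∘ₗ g)
    refine ⟨g', fun w hw => ?_⟩
    have h1 : g' w = g ⟨w, hw⟩ := LinearMap.congr_fun hg' ⟨w, hw⟩
    rw [h1]
    exact ⟨(g ⟨w, hw⟩).2, congrArg Subtype.val (LinearMap.congr_fun hg ⟨w, hw⟩)⟩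
  let E' : Submodule F L := E.map θ.toLinearMap
  have : Module.Finite F Sd := inferInstanceAs (Module.Finite F (restrictTotalDegree _ F d))
  have : Module.Finite F S₀ := inferInstanceAs (Module.Finite F (restrictTotalDegree _ F _))
  have hEfin : Module.Finite F E := Submodule.finiteDimensional_of_le (inf_le_left : E ≤ S₀)
  have hE'fin : Module.Finite F E' := inferInstanceAs (Module.Finite F (E.map θ.toLinearMap))
  let Y : Submodule F S := Sd ⊓ LinearMap.ker θ.toLinearMap
  have hYfin : Module.Finite F Y := Submodule.finiteDimensional_of_le (inf_le_left : Y ≤ Sd)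
  let bE := Module.finBasis F E'
  let bY := Module.finBasis F Y
  choose b hbE hb using fun i => (bE i).2
  let N := Fin (Module.finrank F E') ⊕ Fin (Module.finrank F Y)
  let u : (X → F) → N → S := fun x => Sum.elim (fun i => sec (θ (b i) * q x)) (fun l => (bY l : S))
  have hbW : ∀ i x, θ (b i) * q x ∈ W := fun i x => ((hE _).1 (hbE i)).2 x
  let U : N → MvPolynomial ((Σ i, Fin (n i)) × (Σ i, Fin (n i))) (MvPolynomial X F) :=
    Sum.elim (fun i => ∑ α ∈ Q.support, C (monomial α (1 : F)) * map C (sec (θ (b i) * coeff α Q)))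
      (fun l => map C (bY l : S))
  have hCC : ∀ x : X → F, (eval x).comp (C : F →+* MvPolynomial X F) = RingHom.id F := by
    intro x
    ext a
    exact eval_C _
  have hU : ∀ x c, map (eval x) (U c) = u x c := by
    rintro x (i | l)
    · simp only [U, u, Sum.elim_inl, map_sum, map_mul, map_C, map_map, hCC, map_id, q]
      rw [eval_eq, Finset.mul_sum, map_sum]
      refine Finset.sum_congr rfl fun α _ => ?_
      simp only [← map_pow]
      rw [← map_prod, ← mul_assoc, mul_comm _ (algebraMap F L _), ← Algebra.smul_def, map_smul,
        eval_monomial, one_mul, smul_eq_C_mul]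
      rfl
    · simp only [U, u, Sum.elim_inr, map_map, hCC, map_id]
  have hdecomp : ∀ x, ∀ p ∈ Sd, ∀ a : Fin (Module.finrank F E') → F,
      θ p = (∑ j, a j • θ (b j)) * q x →
        ∃ c : Fin (Module.finrank F Y) → F,
          p = ∑ j, a j • u x (Sum.inl j) + ∑ l, c l • u x (Sum.inr l) := by
    intro x p hp a hpa
    let p₁ : S := ∑ i, a i • u x (Sum.inl i)
    have hp₁ : p - p₁ ∈ Y := by
      refine ⟨Sd.sub_mem hp (Sd.sum_mem fun i _ => Sd.smul_mem _ (hsec _ (hbW i x)).1), ?_⟩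
      show θ (p - p₁) = 0
      rw [map_sub, hpa, map_sum, Finset.sum_mul, sub_eq_zero]
      refine Finset.sum_congr rfl fun i _ => ?_
      rw [map_smul]
      show _ = a i • θ (sec (θ (b i) * q x))
      rw [(hsec _ (hbW i x)).2, smul_mul_assoc]
    refine ⟨fun l => bY.repr ⟨_, hp₁⟩ l, ?_⟩
    have h2 := congrArg Subtype.val (bY.sum_repr ⟨_, hp₁⟩)
    rw [Submodule.coe_sum] at h2
    exact (add_sub_cancel p₁ p).symm.trans (congrArg (p₁ + ·) h2.symm)
  have hbrepr : ∀ p ∈ E, ∃ a : Fin (Module.finrank F E') → F, ∑ j, a j • θ (b j) = θ p := by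
    intro p hp
    refine ⟨fun j => bE.repr ⟨θ p, p, hp, rfl⟩ j, ?_⟩
    have h1 := congrArg Subtype.val (bE.sum_repr ⟨θ p, p, hp, rfl⟩)
    rw [Submodule.coe_sum] at h1
    refine Eq.trans ?_ (show _ = θ p from h1)
    refine Finset.sum_congr rfl fun i _ => ?_
    rw [Submodule.coe_smul]
    exact congrArg _ (hb i)
  have hbli : ∀ a : Fin (Module.finrank F E') → F, ∑ j, a j • θ (b j) = 0 → ∀ j, a j = 0 := by
    intro a ha
    refine Fintype.linearIndependent_iff.1 bE.linearIndependent a (Subtype.ext ?_)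
    rw [Submodule.coe_sum, ← show _ = ((0 : E') : L) from ha]
    refine Finset.sum_congr rfl fun i _ => ?_
    rw [Submodule.coe_smul]
    exact congrArg _ (hb i).symm
  refine exists_invariant_of_semiinvariant hn (stackDet U) ?_ e ?_ t ht hspan ρ hρ hρe ?_
  · rw [map_stackDet]
    simp only [hU]
    obtain ⟨a, ha⟩ := hbrepr v hvE
    obtain ⟨i, -⟩ : ∃ i, a i ≠ 0 := by
      by_contra! hcon
      apply hv
      rw [← ha]
      simp [hcon]
    rw [stackDet]
    refine Matrix.det_eq_zero_of_row_eq_zero (Sum.inl i) fun c' => ?_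
    have h0 : u 0 (Sum.inl i) = 0 := by
      have : q 0 = 0 := by
        have h1 : (fun a : X => algebraMap F L ((0 : X → F) a)) = 0 := by
          ext
          simp
        simp only [q]
        rw [h1, eval_zero, hQ0]
      show sec (θ (b i) * q 0) = 0
      rw [this, mul_zero, map_zero]
    rw [Matrix.of_apply, h0, map_zero]
  · rw [map_stackDet]
    simp only [hU]
    refine stackDet_ne_zero _ (Fintype.linearIndependent_iff.2 fun a ha => ?_)
    rw [Fintype.sum_sum_type] at ha
    have h1 := congrArg θ ha
    rw [map_zero, map_add, map_sum, map_sum] at h1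
    have h2 : ∑ l, θ (a (Sum.inr l) • u e (Sum.inr l)) = 0 := by
      refine Finset.sum_eq_zero fun l _ => ?_
      rw [map_smul, show θ (u e (Sum.inr l)) = 0 from (bY l).2.2, smul_zero]
    rw [h2, add_zero] at h1
    have h3 := hbli (fun i => a (Sum.inl i)) (by
      rw [← h1]
      refine Finset.sum_congr rfl fun i _ => ?_
      rw [map_smul]
      show _ = _ • θ (sec (θ (b i) * q e))
      rw [(hsec _ (hbW i e)).2, show q e = 1 from hQe, mul_one])
    simp only [h3, zero_smul, Finset.sum_const_zero, zero_add] at ha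
    have h4 := Fintype.linearIndependent_iff.1 bY.linearIndependent (fun l => a (Sum.inr l))
      (Subtype.ext (by rw [Submodule.coe_sum]; exact ha))
    rintro (i | l)
    · exact h3 i
    · exact h4 l
  · intro h
    choose A hA using fun i => hbrepr _ (hEr h _ (hbE i))
    have hY : ∀ l, ∃ c : Fin (Module.finrank F Y) → F, r h (bY l) = ∑ l', c l' • (bY l' : S) := by
      intro l
      obtain ⟨c, hc⟩ := hdecomp 0 (r h (bY l)) (hSd h _ (bY l).2.1) 0 (by
        show θ (rsub _ _) = _
        rw [hσ, show θ (bY l : S) = 0 from (bY l).2.2]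
        simp)
      refine ⟨c, hc.trans ?_⟩
      simp [u]
    choose B hB using hY
    refine ⟨(Matrix.of A).det * (Matrix.of B).det, fun x => ?_⟩
    have hu : ∀ i, ∃ c : Fin (Module.finrank F Y) → F, r h (u x (Sum.inl i)) =
        ∑ j, A i j • u (ρ h x) (Sum.inl j) + ∑ l, c l • u (ρ h x) (Sum.inr l) := by
      intro i
      refine hdecomp _ _ (hSd h _ (hsec _ (hbW i x)).1) _ ?_
      rw [hA]
      show θ (rsub _ (sec _)) = θ (rsub _ _) * eval _ Q
      rw [hσ, (hsec _ (hbW i x)).2, map_mul, hσ, ← hQ]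
    choose D hD using hu
    rw [map_stackDet, map_stackDet, rsub_stackDet]
    simp only [hU]
    rw [← Matrix.det_fromBlocks_zero₂₁ (Matrix.of A) (Matrix.of D) (Matrix.of B), ← stackDet_mul]
    congr 1
    ext1 c
    rw [Fintype.sum_sum_type]
    rcases c with i | l
    · refine (hD i).trans (congrArg₂ (· + ·) ?_ ?_) <;>
      exact Finset.sum_congr rfl fun j _ => smul_eq_C_mul _ _
    · refine (hB l).trans ?_
      simp only [Matrix.fromBlocks_apply₂₁, Matrix.fromBlocks_apply₂₂,
        Matrix.zero_apply, map_zero, zero_mul, Finset.sum_const_zero, zero_add]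
      exact Finset.sum_congr rfl fun j _ => smul_eq_C_mul _ _

end descent

section norm

variable {F X L : Type*} [Field F] [Field L] [Algebra F L]

/-- The norm form of a finite field extension, with respect to a family of elements. -/
theorem exists_normForm [Fintype X] (K : IntermediateField F L) [FiniteDimensional K L]
    (φ : X → L) : ∃ Q : MvPolynomial X K, constantCoeff Q = 0 ∧ ∀ x : X → F,
      eval (fun a => algebraMap F K (x a)) Q = Algebra.norm K (∑ a, algebraMap F L (x a) * φ a) := by
  classical
  let b := Module.finBasis K L
  let N : X → Matrix (Fin (Module.finrank K L)) (Fin (Module.finrank K L)) K :=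
    fun a => Algebra.leftMulMatrix b (φ a)
  let Q : MvPolynomial X K := (Matrix.of fun i j => ∑ a, MvPolynomial.X a * C (N a i j)).det
  have hQ : ∀ y : X → K, eval y Q = (∑ a, y a • N a).det := by
    intro y
    rw [RingHom.map_det]
    congr 1
    ext i j
    simp [Matrix.sum_apply]
  refine ⟨Q, ?_, fun x => ?_⟩
  · have : Nonempty (Fin (Module.finrank K L)) := ⟨⟨0, Module.finrank_pos⟩⟩
    rw [← eval_zero, hQ]
    simp
  · rw [hQ, Algebra.norm_eq_matrix_det b, map_sum]
    congr 1
    refine Finset.sum_congr rfl fun a _ => ?_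
    rw [show algebraMap F L (x a) = algebraMap K L (algebraMap F K (x a)) from rfl,
      ← Algebra.smul_def, map_smul]

theorem norm_algEquiv (K : IntermediateField F L) (σ : L ≃ₐ[F] L)
    (hσ : ∀ x, x ∈ K ↔ σ x ∈ K) (z : L) :
    σ (Algebra.norm K z : K) = (Algebra.norm K (σ z) : K) := by
  let e : K ≃+* K := RingEquiv.restrict σ.toRingEquiv K K hσ
  have h := Algebra.norm_eq_of_equiv_equiv (A₁ := K) (B₁ := L) (A₂ := K) (B₂ := L) e σ.toRingEquiv
    (by ext; rfl) z
  rw [h]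
  exact congrArg Subtype.val (e.apply_symm_apply _)

/-- Invariants of a group of block matrices, and more generally of a group mapping to such a group
with finite kernel. -/
theorem exists_invariant_of_finite {ι Γ : Type*} [Fintype ι] [DecidableEq ι] {n : ι → ℕ}
    [IsAlgClosed F] [Fintype X] (hn : ∀ i, 0 < n i)
    (θ : MvPolynomial ((Σ i, Fin (n i)) × (Σ i, Fin (n i))) F →ₐ[F] L)
    (t : Γ → ∀ i, Matrix (Fin (n i)) (Fin (n i)) F) (ht : ∀ h i, (t h i).det ≠ 0)
    (hspan : Submodule.span F (Set.range t) = ⊤) (ρ : Γ → (X → F) → (X → F))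
    (hρ : ∀ h (s : F) x, ρ h (s • x) = s • ρ h x) (hρs : ∀ h, Function.Surjective (ρ h))
    (e : X → F) (hρe : ∀ h, ρ h e = e) (σ : Γ → L ≃ₐ[F] L)
    (hσ : ∀ h p, θ (rsub (Matrix.blockDiagonal' (t h)) p) = σ h (θ p))
    (K : IntermediateField F L) [FiniteDimensional K L] (hθK : ∀ p, θ p ∈ K)
    (hK : ∀ x ∈ K, ∃ p q, θ q ≠ 0 ∧ θ q * x = θ p)
    (φ : X → L) (hφ : ∀ h (x : X → F), σ h (∑ a, algebraMap F L (x a) * φ a) =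
      ∑ a, algebraMap F L (ρ h x a) * φ a) (hφe : ∑ a, algebraMap F L (e a) * φ a = 1) :
    ∃ (d : ℕ) (P : MvPolynomial X F), 0 < d ∧ P.IsHomogeneous d ∧ eval e P ≠ 0 ∧
      ∀ h x, eval (ρ h x) P = eval x P := by
  classical
  obtain ⟨Q, hQ0, hQ⟩ := exists_normForm K φ
  have hQL : ∀ x : X → F, eval (fun a => algebraMap F L (x a)) (map (algebraMap K L) Q) =
      (Algebra.norm K (∑ a, algebraMap F L (x a) * φ a) : K) := by
    intro x
    rw [← hQ]
    refine Eq.trans ?_ (ringHom_eval (algebraMap K L) _ Q).symm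
    simp only [← IsScalarTower.algebraMap_apply F K L]
  have hσ' : ∀ h p, σ h (θ p) ∈ K := fun h p => by rw [← hσ]; exact hθK _
  have hσs : ∀ h p, (σ h).symm (θ p) ∈ K := by
    intro h p
    have : θ p = σ h (θ (rsub (Matrix.blockDiagonal' fun i => (t h i)⁻¹) p)) := by
      rw [← hσ, rsub_rsub, ← Matrix.blockDiagonal'_mul]
      simp only [Matrix.mul_nonsing_inv _ (isUnit_iff_ne_zero.2 (ht h _))]
      rw [show (fun i => (1 : Matrix (Fin (n i)) (Fin (n i)) F)) = 1 from rfl,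
        Matrix.blockDiagonal'_one, rsub_one]
    rw [this, AlgEquiv.symm_apply_apply]
    exact hθK _
  have hstab : ∀ τ : L ≃ₐ[F] L, (∀ p, τ (θ p) ∈ K) → ∀ x ∈ K, τ x ∈ K := by
    intro τ hτ x hx
    obtain ⟨p, q, hq, h⟩ := hK x hx
    rw [mul_comm, ← eq_div_iff hq] at h
    rw [h, map_div₀]
    exact K.div_mem (hτ _) (hτ _)
  have hσK : ∀ h x, x ∈ K ↔ σ h x ∈ K := fun h x =>
    ⟨hstab _ (hσ' h) x, fun hx => by simpa using hstab _ (hσs h) _ hx⟩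
  choose p q hq hpq using fun α => hK (coeff α Q : K) (coeff α Q).2
  refine exists_invariant_of_equivariant hn θ t ht hspan ρ hρ hρs e hρe (fun h => (σ h : L →ₐ[F] L))
    hσ (map (algebraMap K L) Q) (fun h x => ?_) ?_ ?_ (∏ α ∈ Q.support, q α) ?_ fun α => ?_
  · rw [hQL, hQL, ← hφ]
    exact norm_algEquiv K (σ h) (hσK h) _
  · rw [hQL, hφe, map_one]
    rfl
  · rw [constantCoeff_map, hQ0, map_zero]
  · rw [map_prod]
    exact Finset.prod_ne_zero_iff.2 fun α _ => hq α
  · by_cases hα : α ∈ Q.support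
    · refine ⟨(∏ β ∈ Q.support.erase α, q β) * p α, ?_⟩
      rw [coeff_map, ← Finset.prod_erase_mul _ _ hα, map_mul, map_mul, mul_assoc, ← hpq]
      rfl
    · refine ⟨0, ?_⟩
      rw [coeff_map, notMem_support_iff.1 hα]
      simp

end norm

section identityComponent

open TopologicalSpace

variable {G : Type*} [Group G] [TopologicalSpace G]

theorem image_mem_irreducibleComponents {X : Type*} [TopologicalSpace X] (e : X ≃ₜ X) {Z : Set X}
    (hZ : Z ∈ irreducibleComponents X) : e '' Z ∈ irreducibleComponents X := by
  refine ⟨hZ.1.image _ e.continuous.continuousOn, fun Y hY hZY => ?_⟩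
  have h1 : Z ≤ e.symm '' Y := by
    intro z hz
    exact ⟨e z, hZY ⟨z, hz, rfl⟩, by simp⟩
  have h2 := hZ.2 (hY.image _ e.symm.continuous.continuousOn) h1
  intro y hy
  exact ⟨e.symm y, h2 ⟨y, hy, rfl⟩, by simp⟩

/-- In a group with a noetherian topology for which the left translations are continuous, every
element lies on exactly one irreducible component. -/
theorem irreducibleComponents_eq_of_mem [NoetherianSpace G] (hl : ∀ g : G, Continuous (g * ·))
    {Z Z' : Set G} (hZ : Z ∈ irreducibleComponents G) (hZ' : Z' ∈ irreducibleComponents G) {x : G}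
    (hx : x ∈ Z) (hx' : x ∈ Z') : Z = Z' := by
  let τ : G → G ≃ₜ G := fun g =>
    { toEquiv := Equiv.mulLeft g
      continuous_toFun := hl g
      continuous_invFun := hl g⁻¹ }
  have hτ : ∀ g x, τ g x = g * x := fun _ _ => rfl
  let W := irreducibleComponent (1 : G)
  obtain ⟨U, hU, ⟨y, hy⟩, hUW⟩ := NoetherianSpace.exists_isOpen_nonempty_subset_irreducibleComponent _
    (irreducibleComponent_mem_irreducibleComponents (1 : G))
  have key : ∀ Y ∈ irreducibleComponents G, y ∈ Y → Y = W := by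
    intro Y hY hyY
    have h1 : Y ⊆ closure (Y ∩ U) := subset_closure_inter_of_isPreirreducible_of_isOpen hY.1.2 hU
      ⟨y, hyY, hy⟩
    have h2 : Y ⊆ W := h1.trans
      (closure_minimal (Set.inter_subset_right.trans hUW) isClosed_irreducibleComponent)
    exact h2.antisymm (hY.2 isIrreducible_irreducibleComponent h2)
  have h : ∀ Y ∈ irreducibleComponents G, x ∈ Y → τ (y * x⁻¹) '' Y = W := fun Y hY hxY =>
    key _ (image_mem_irreducibleComponents _ hY) ⟨x, hxY, by simp [hτ]⟩
  exact (τ (y * x⁻¹)).injective.image_injective ((h Z hZ hx).trans (h Z' hZ' hx').symm)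

/-- The identity component of an algebraic group. -/
theorem exists_identityComponent [NoetherianSpace G] (hl : ∀ g : G, Continuous (g * ·)) :
    ∃ G₀ : Subgroup G, IsClosed (G₀ : Set G) ∧ IsIrreducible (G₀ : Set G) ∧ G₀.FiniteIndex ∧
      ∀ φ : G ≃* G, Continuous φ → Continuous φ.symm → ∀ x ∈ G₀, φ x ∈ G₀ := by
  let τ : G → G ≃ₜ G := fun g =>
    { toEquiv := Equiv.mulLeft g
      continuous_toFun := hl g
      continuous_invFun := hl g⁻¹ }
  have hτ : ∀ g x, τ g x = g * x := fun _ _ => rfl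
  let W := irreducibleComponent (1 : G)
  have hW : W ∈ irreducibleComponents G := irreducibleComponent_mem_irreducibleComponents _
  have h1 : (1 : G) ∈ W := mem_irreducibleComponent
  have hτW : ∀ g, g ∈ W → τ g '' W = W := fun g hg =>
    irreducibleComponents_eq_of_mem hl (image_mem_irreducibleComponents _ hW) hW
      ⟨1, h1, by simp [hτ]⟩ hg
  let G₀ : Subgroup G :=
    { carrier := W
      one_mem' := h1
      mul_mem' := fun {a b} ha hb => by
        rw [← hτW a ha]
        exact ⟨b, hb, rfl⟩
      inv_mem' := fun {a} ha => by
        have h2 : (1 : G) ∈ τ a '' W := by rwa [hτW a ha]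
        obtain ⟨b, hb, hab⟩ := h2
        rwa [show a⁻¹ = b from (eq_inv_of_mul_eq_one_right hab).symm] }
  refine ⟨G₀, isClosed_irreducibleComponent, isIrreducible_irreducibleComponent, ?_,
    fun φ hφ hφ' x hx => ?_⟩
  · have hfin : Finite (irreducibleComponents G) := NoetherianSpace.finite_irreducibleComponents
    let c : G ⧸ G₀ → irreducibleComponents G := fun q =>
      ⟨τ q.out '' W, image_mem_irreducibleComponents _ hW⟩
    have hc : Function.Injective c := by
      intro q q' hqq
      have h2 : q.out ∈ τ q'.out '' W := by
        rw [← show τ q.out '' W = τ q'.out '' W from congrArg Subtype.val hqq]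
        exact ⟨1, h1, by simp [hτ]⟩
      obtain ⟨w, hw, hwq⟩ := h2
      rw [← q.out_eq, ← q'.out_eq, eq_comm, QuotientGroup.eq]
      rw [← hwq, hτ, inv_mul_cancel_left]
      exact hw
    have : Finite (G ⧸ G₀) := Finite.of_injective c hc
    exact Subgroup.finiteIndex_of_finite_quotient
  · let e : G ≃ₜ G :=
      { toEquiv := φ.toEquiv
        continuous_toFun := hφ
        continuous_invFun := hφ' }
    have h2 : e '' W = W := irreducibleComponents_eq_of_mem hl
      (image_mem_irreducibleComponents e hW) hW ⟨1, h1, map_one φ⟩ h1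
    show φ x ∈ W
    rw [← h2]
    exact ⟨x, hx, rfl⟩

end identityComponent

section zariski

variable {k : Type} [Field k] {n : ℕ}

/-- Substitution `p ↦ p(a Z b)` on polynomials in the entries of a matrix `Z`. -/
noncomputable def tsub (a b : Mat k n) : MPoly k n →ₐ[k] MPoly k n :=
  aeval fun z => ((a.map C * (Matrix.of fun i j => (X (i, j) : MPoly k n)) * b.map C :
    Matrix (Fin n) (Fin n) (MPoly k n)) z.1 z.2)

theorem mEval_eq (x : Mat k n) (p : MPoly k n) :
    mEval x p = aeval (fun ij : Fin n × Fin n => x ij.1 ij.2) p := by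
  rw [mEval, aeval_eq_eval]

theorem mEval_X (x : Mat k n) (z : Fin n × Fin n) : mEval x (X z) = x z.1 z.2 := eval_X _

theorem mEval_tsub (a b x : Mat k n) (p : MPoly k n) :
    mEval x (tsub a b p) = mEval (a * x * b) p := by
  induction p using MvPolynomial.induction_on with
  | C c => simp [mEval, tsub]
  | add p q hp hq => simp only [mEval, map_add] at hp hq ⊢; rw [hp, hq]
  | mul_X p i hp =>
    simp only [mEval, map_mul] at hp ⊢
    rw [hp]
    congr 1
    simp [tsub, Matrix.mul_apply]

/-- The topology induced by the Zariski topology along a map to matrix space. -/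
noncomputable abbrev zariski {Y : Type*} (c : Y → Mat k n) : TopologicalSpace Y :=
  TopologicalSpace.induced
    (fun y => (pointToPoint (fun ij : Fin n × Fin n => c y ij.1 ij.2) : PrimeSpectrum (MPoly k n)))
    inferInstance

theorem isClosed_zariski_iff {Y : Type*} (c : Y → Mat k n) (S : Set Y) :
    @IsClosed _ (zariski c) S ↔ ∃ C, ZClosed C ∧ S = c ⁻¹' C := by
  have h : ∀ (s : Set (MPoly k n)) (x : Mat k n),
      (pointToPoint (fun ij : Fin n × Fin n => x ij.1 ij.2) : PrimeSpectrum (MPoly k n)) ∈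
        PrimeSpectrum.zeroLocus s ↔ ∀ p ∈ s, mEval x p = 0 := by
    intro s x
    rw [PrimeSpectrum.mem_zeroLocus]
    refine forall₂_congr fun p _ => ?_
    rw [mEval_eq]
    exact mem_vanishingIdeal_singleton_iff _ _
  rw [isClosed_induced_iff]
  constructor
  · rintro ⟨T, hT, rfl⟩
    obtain ⟨s, rfl⟩ := (PrimeSpectrum.isClosed_iff_zeroLocus _).1 hT
    exact ⟨_, ⟨s, rfl⟩, Set.ext fun y => h s (c y)⟩
  · rintro ⟨_, ⟨s, rfl⟩, rfl⟩
    exact ⟨_, PrimeSpectrum.isClosed_zeroLocus s, Set.ext fun y => h s (c y)⟩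

theorem noetherianSpace_zariski {Y : Type*} (c : Y → Mat k n) :
    @TopologicalSpace.NoetherianSpace Y (zariski c) :=
  by
  let _ := zariski c
  exact Topology.IsInducing.noetherianSpace (i := fun y => (pointToPoint
    (fun ij : Fin n × Fin n => c y ij.1 ij.2) : PrimeSpectrum (MPoly k n))) ⟨rfl⟩

theorem continuous_zariski {Y : Type*} (c : Y → Mat k n) (f : Y → Y) (φ : MPoly k n → MPoly k n)
    (hf : ∀ y p, mEval (c (f y)) p = mEval (c y) (φ p)) :
    @Continuous _ _ (zariski c) (zariski c) f := by
  let _ := zariski c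
  refine continuous_iff_isClosed.2 fun S hS => ?_
  obtain ⟨_, ⟨s, rfl⟩, rfl⟩ := (isClosed_zariski_iff c S).1 hS
  refine (isClosed_zariski_iff c _).2 ⟨_, ⟨φ '' s, rfl⟩, Set.ext fun y => ?_⟩
  simp [hf]

theorem irreducibleSet_of_isIrreducible {Y : Type*} (c : Y → Mat k n) {S : Set Y}
    (hS : @IsIrreducible _ (zariski c) S) : IrreducibleSet (c '' S) := by
  let _ := zariski c
  refine ⟨hS.1.image c, fun p q h => ?_⟩
  have hcl : ∀ p : MPoly k n, IsClosed {y | mEval (c y) p = 0} := fun p =>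
    (isClosed_zariski_iff c _).2 ⟨_, ⟨{p}, rfl⟩, by ext; simp⟩
  rcases isPreirreducible_iff_isClosed_union_isClosed.1 hS.2 _ _ (hcl p) (hcl q) (fun y hy => by
    have h1 := h (c y) ⟨y, hy, rfl⟩
    rw [mEval, map_mul, mul_eq_zero] at h1
    exact h1) with h1 | h1
  · left
    rintro _ ⟨y, hy, rfl⟩
    exact h1 hy
  · right
    rintro _ ⟨y, hy, rfl⟩
    exact h1 hy

theorem ZClosed.inter {A B : Set (Mat k n)} (hA : ZClosed A) (hB : ZClosed B) :
    ZClosed (A ∩ B) := by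
  obtain ⟨S, rfl⟩ := hA
  obtain ⟨T, rfl⟩ := hB
  refine ⟨S ∪ T, Set.ext fun x => ?_⟩
  simp only [Set.mem_inter_iff, Set.mem_ofPred_eq, Set.mem_union, or_imp, forall_and]

/-- The set of matrices underlying a group of invertible matrices. -/
def matSet (Γ : Subgroup (Mat k n)ˣ) : Set (Mat k n) := Units.val '' (Γ : Set (Mat k n)ˣ)

/-- The identity component of a closed group of matrices. -/
theorem exists_irreducible_subgroup (Γ : Subgroup (Mat k n)ˣ) (hΓ : ZClosed (matSet Γ)) :
    ∃ Γ₀ ≤ Γ, ZClosed (matSet Γ₀) ∧ IrreducibleSet (matSet Γ₀) ∧ Γ₀.relIndex Γ ≠ 0 ∧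
      ∀ a : (Mat k n)ˣ, (∀ x ∈ Γ, a * x * a⁻¹ ∈ Γ) → (∀ x ∈ Γ, a⁻¹ * x * a ∈ Γ) →
        ∀ x ∈ Γ₀, a * x * a⁻¹ ∈ Γ₀ := by
  let c : Γ → Mat k n := fun g => ((g : (Mat k n)ˣ) : Mat k n)
  let _ : TopologicalSpace Γ := zariski c
  have : TopologicalSpace.NoetherianSpace Γ := noetherianSpace_zariski c
  obtain ⟨G₀, hcl, hirr, hfin, hstab⟩ := exists_identityComponent (G := Γ) fun g =>
    continuous_zariski c _ (tsub (c g) 1) fun y p => by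
      rw [mEval_tsub, mul_one]
      rfl
  have himg : matSet (G₀.map Γ.subtype) = c '' G₀ := by
    ext x
    simp [matSet, c]
  refine ⟨G₀.map Γ.subtype, Subgroup.map_subtype_le _, ?_, ?_, ?_, fun a ha ha' x hx => ?_⟩
  · obtain ⟨C, hC, h⟩ := (isClosed_zariski_iff c _).1 hcl
    rw [himg, h, Set.image_preimage_eq_inter_range]
    convert hC.inter hΓ
    ext x
    simp [matSet, c]
  · rw [himg]
    exact irreducibleSet_of_isIrreducible c hirr
  · rw [Subgroup.relIndex, Subgroup.subgroupOf, Subgroup.comap_map_eq_self_of_injective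
      Γ.subtype_injective]
    exact hfin.index_ne_zero
  · obtain ⟨y, hy, rfl⟩ := hx
    let φ : Γ ≃* Γ :=
      { toFun := fun x => ⟨a * x * a⁻¹, ha x x.2⟩
        invFun := fun x => ⟨a⁻¹ * x * a, ha' x x.2⟩
        left_inv := fun x => Subtype.ext (by simp [mul_assoc])
        right_inv := fun x => Subtype.ext (by simp [mul_assoc])
        map_mul' := fun x y => Subtype.ext (by simp [mul_assoc]) }
    refine ⟨φ y, hstab φ ?_ ?_ y hy, rfl⟩
    · exact continuous_zariski c _ (tsub (a : Mat k n) (a⁻¹ : (Mat k n)ˣ)) fun y p => by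
        rw [mEval_tsub]
        congr 1
    · exact continuous_zariski c _ (tsub ((a⁻¹ : (Mat k n)ˣ) : Mat k n) (a : Mat k n)) fun y p => by
        rw [mEval_tsub]
        congr 1

end zariski

section semisimple

variable {k : Type} [Field k] {n : ℕ}

theorem pow_eq_zero_of_isNilpotent {x : Mat k n} (hx : IsNilpotent x) : x ^ n = 0 := by
  have h := Matrix.isNilpotent_charpoly_sub_pow_of_isNilpotent hx
  have h2 := sub_eq_zero.1 h.eq_zero
  have h3 := Matrix.aeval_self_charpoly x
  rw [h2] at h3
  simpa using h3

/-- The linear polynomial defined by a linear form. -/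
noncomputable def linPoly (f : Mat k n →ₗ[k] k) : MPoly k n :=
  ∑ z : Fin n × Fin n, C (f (Matrix.single z.1 z.2 1)) * X z

theorem mEval_linPoly (f : Mat k n →ₗ[k] k) (x : Mat k n) : mEval x (linPoly f) = f x := by
  have h : x = ∑ z : Fin n × Fin n, x z.1 z.2 • Matrix.single z.1 z.2 (1 : k) := by
    rw [Fintype.sum_prod_type]
    simpa using Matrix.matrix_eq_sum_single x
  conv_rhs => rw [h, map_sum]
  simp only [map_smul, smul_eq_mul]
  simp [mEval, linPoly, mul_comm]

theorem ZClosed.of_linear {ι : Type*} (f : ι → Mat k n →ₗ[k] k) (c : ι → k) :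
    ZClosed {x | ∀ i, f i x = c i} := by
  refine ⟨Set.range fun i => linPoly (f i) - C (c i), Set.ext fun x => ?_⟩
  simp only [Set.mem_ofPred_eq, Set.forall_mem_range]
  refine forall_congr' fun i => ?_
  rw [mEval, map_sub, eval_C, ← mEval, mEval_linPoly, sub_eq_zero]

/-- Conjugation of matrices. -/
def conjAlgHom (u : (Mat k n)ˣ) : Mat k n →ₐ[k] Mat k n where
  toFun x := u * x * (u⁻¹ : (Mat k n)ˣ)
  map_one' := by simp
  map_mul' x y := by simp [mul_assoc]
  map_zero' := by simp
  map_add' x y := by rw [mul_add, add_mul]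
  commutes' c := by
    rw [← Algebra.commutes, mul_assoc, Units.mul_inv, mul_one]

theorem adjoin_matSet (Γ : Subgroup (Mat k n)ˣ) :
    Subalgebra.toSubmodule (Algebra.adjoin k (matSet Γ)) = Submodule.span k (matSet Γ) := by
  have h : (Submonoid.closure (matSet Γ) : Set (Mat k n)) = matSet Γ := by
    have : matSet Γ = (Γ.toSubmonoid.map (Units.coeHom (Mat k n)) : Submonoid (Mat k n)) := rfl
    rw [this, Submonoid.closure_eq]
  rw [Algebra.adjoin_eq_span, h]

/-- A closed normal subgroup of a reductive group maps, with finite kernel, to a spanning group of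
block diagonal matrices. -/
theorem exists_blockRep [IsAlgClosed k] {G : Set (Mat k n)} (hred : IsReductiveGroup G)
    (Γ : Subgroup (Mat k n)ˣ) (hΓG : matSet Γ ⊆ G) (hΓ : ZClosed (matSet Γ))
    (hnorm : ∀ a : (Mat k n)ˣ, (a : Mat k n) ∈ G → ((a⁻¹ : (Mat k n)ˣ) : Mat k n) ∈ G →
      ∀ x ∈ Γ, a * x * a⁻¹ ∈ Γ) :
    ∃ (m : ℕ) (d : Fin m → ℕ) (ℓ : Mat k n →ₗ[k] ∀ i, Matrix (Fin (d i)) (Fin (d i)) k)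
      (t : Γ →* ∀ i, Matrix (Fin (d i)) (Fin (d i)) k), (∀ i, 0 < d i) ∧
      (∀ g : Γ, t g = ℓ ((g : (Mat k n)ˣ) : Mat k n)) ∧
      Submodule.span k (Set.range t) = ⊤ ∧ Finite t.ker := by
  let A : Subalgebra k (Mat k n) := Algebra.adjoin k (matSet Γ)
  let J := Ring.jacobson A
  have : IsArtinianRing A := IsArtinianRing.of_finite k A
  obtain ⟨m, d, hd, ⟨e⟩⟩ :=
    IsSemisimpleRing.exists_algEquiv_pi_matrix_of_isAlgClosed k (A ⧸ J)
  let π : A →ₐ[k] ∀ i, Matrix (Fin (d i)) (Fin (d i)) k :=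
    (e : (A ⧸ J) →ₐ[k] _).comp (Ideal.Quotient.mkₐ k J)
  have hπs : Function.Surjective π := e.surjective.comp (Ideal.Quotient.mkₐ_surjective k J)
  have hπ0 : ∀ x, π x = 0 ↔ x ∈ J := by
    intro x
    show e (Ideal.Quotient.mk J x) = 0 ↔ _
    rw [EmbeddingLike.map_eq_zero_iff, Ideal.Quotient.eq_zero_iff_mem]
  obtain ⟨ℓ, hℓ⟩ := LinearMap.exists_extend (p := Subalgebra.toSubmodule A) π.toLinearMap
  have hℓ' : ∀ x : A, ℓ x = π x := fun x => LinearMap.congr_fun hℓ x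
  have hmem : ∀ g : Γ, ((g : (Mat k n)ˣ) : Mat k n) ∈ A := fun g =>
    Algebra.subset_adjoin ⟨g, g.2, rfl⟩
  let ψ : Γ →* A :=
    { toFun := fun g => ⟨_, hmem g⟩
      map_one' := rfl
      map_mul' := fun _ _ => rfl }
  let t : Γ →* ∀ i, Matrix (Fin (d i)) (Fin (d i)) k := (π : A →* _).comp ψ
  have htℓ : ∀ g : Γ, t g = ℓ ((g : (Mat k n)ˣ) : Mat k n) := fun g => (hℓ' (ψ g)).symm
  have htJ : ∀ g : Γ, g ∈ t.ker ↔ ψ g - 1 ∈ J := by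
    intro g
    rw [← hπ0, map_sub, map_one, sub_eq_zero]
    exact MonoidHom.mem_ker
  refine ⟨m, d, ℓ, t, fun i => (hd i).pos, htℓ, ?_, ?_⟩
  · have h1 : Submodule.span k (Set.range ψ) = ⊤ := by
      rw [eq_top_iff]
      rintro ⟨x, hx⟩ -
      have h2 : x ∈ Submodule.span k (matSet Γ) := by rw [← adjoin_matSet]; exact hx
      have h3 : (Submodule.span k (Set.range ψ)).map (Subalgebra.toSubmodule A).subtype =
          Submodule.span k (matSet Γ) := by
        rw [Submodule.map_span]
        congr 1
        ext y
        constructor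
        · rintro ⟨_, ⟨g, rfl⟩, rfl⟩
          exact ⟨g, g.2, rfl⟩
        · rintro ⟨g, hg, rfl⟩
          exact ⟨_, ⟨⟨g, hg⟩, rfl⟩, rfl⟩
      rw [← h3] at h2
      obtain ⟨y, hy, rfl⟩ := h2
      exact hy
    have h2 : Set.range t = π.toLinearMap '' Set.range ψ := by
      rw [← Set.range_comp]
      rfl
    rw [h2, ← Submodule.map_span, h1, Submodule.map_top, LinearMap.range_eq_top]
    exact hπs
  · let N : Subgroup (Mat k n)ˣ := t.ker.map Γ.subtype
    have hNΓ : N ≤ Γ := Subgroup.map_subtype_le _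
    have hNcl : ZClosed (matSet N) := by
      have h1 := hΓ.inter (ZClosed.of_linear
        (fun z : Σ i, Fin (d i) × Fin (d i) =>
          ((LinearMap.proj z.2.2 ∘ₗ LinearMap.proj z.2.1 ∘ₗ LinearMap.proj z.1 :
            (∀ i, Fin (d i) → Fin (d i) → k) →ₗ[k] k)) ∘ₗ ℓ)
        (fun z => (1 : Matrix (Fin (d z.1)) (Fin (d z.1)) k) z.2.1 z.2.2))
      convert h1
      ext x
      constructor
      · rintro ⟨_, ⟨g, hg, rfl⟩, rfl⟩
        refine ⟨⟨g, g.2, rfl⟩, fun z => ?_⟩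
        have h2 : ℓ ((g : (Mat k n)ˣ) : Mat k n) = 1 := (htℓ g).symm.trans hg
        show ℓ ((g : (Mat k n)ˣ) : Mat k n) z.1 z.2.1 z.2.2 = _
        rw [h2]
        rfl
      · rintro ⟨⟨g, hg, rfl⟩, hx⟩
        refine ⟨g, ⟨⟨g, hg⟩, ?_, rfl⟩, rfl⟩
        show t _ = 1
        rw [htℓ]
        ext i r s
        exact hx ⟨i, r, s⟩
    have hNG : ∀ a : (Mat k n)ˣ, (a : Mat k n) ∈ G → ((a⁻¹ : (Mat k n)ˣ) : Mat k n) ∈ G →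
        ∀ x ∈ N, a * x * a⁻¹ ∈ N := by
      rintro a ha ha' _ ⟨g, hg, rfl⟩
      have hA : ∀ b : (Mat k n)ˣ, (b : Mat k n) ∈ G → ((b⁻¹ : (Mat k n)ˣ) : Mat k n) ∈ G →
          A ≤ A.comap (conjAlgHom b) := by
        intro b hb hb'
        refine Algebra.adjoin_le ?_
        rintro _ ⟨g, hg, rfl⟩
        exact Algebra.subset_adjoin ⟨b * g * b⁻¹, hnorm b hb hb' g hg, by simp [conjAlgHom]⟩
      let c : A →+* A := ((conjAlgHom a).toRingHom.comp A.subtype).codRestrict A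
        fun x => hA a ha ha' x.2
      have hcs : Function.Surjective c := by
        intro x
        refine ⟨⟨conjAlgHom a⁻¹ x, hA a⁻¹ ha' (by simpa using ha) x.2⟩, Subtype.ext ?_⟩
        show (a : Mat k n) * ((a⁻¹ : (Mat k n)ˣ) * x * ((a⁻¹)⁻¹ : (Mat k n)ˣ)) *
          (a⁻¹ : (Mat k n)ˣ) = x
        simp [mul_assoc]
      have : RingHomSurjective c := ⟨hcs⟩
      have h1 := Ring.le_comap_jacobson c ((htJ g).1 hg)
      refine ⟨⟨a * g * a⁻¹, hnorm a ha ha' g g.2⟩, (htJ _).2 ?_, rfl⟩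
      have h2 : c (ψ g - 1) ∈ Ring.jacobson A := h1
      rw [map_sub, map_one] at h2
      exact h2
    obtain ⟨N₀, hN₀, hcl, hirr, hidx, hstab⟩ := exists_irreducible_subgroup N hNcl
    have h1 : matSet N₀ ⊆ {1} := by
      have hsub : matSet N₀ ⊆ G := (Set.image_mono (hN₀.trans hNΓ)).trans hΓG
      refine hred _ ⟨hsub, ⟨1, N₀.one_mem, rfl⟩, ?_, ?_⟩ ⟨hsub, _, hcl,
        (Set.inter_eq_left.2 hsub).symm⟩ hirr ?_ ?_
      · rintro _ ⟨a, ha, rfl⟩ _ ⟨b, hb, rfl⟩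
        exact ⟨a * b, N₀.mul_mem ha hb, rfl⟩
      · rintro _ ⟨a, ha, rfl⟩
        exact ⟨(a⁻¹ : (Mat k n)ˣ), ⟨a⁻¹, N₀.inv_mem ha, rfl⟩, by simp, by simp⟩
      · rintro a ha b hb hab hba _ ⟨x, hx, rfl⟩
        let u : (Mat k n)ˣ := ⟨a, b, hab, hba⟩
        refine ⟨u * x * u⁻¹, hstab u (hNG u ha hb) (fun y hy => ?_) x hx, rfl⟩
        have := hNG u⁻¹ hb (by simpa using ha) y hy
        rwa [inv_inv] at this
      · rintro _ ⟨x, hx, rfl⟩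
        obtain ⟨g, hg, rfl⟩ := hN₀ hx
        obtain ⟨r, hr⟩ := IsSemiprimaryRing.isNilpotent (R := A)
        have h2 := Ideal.pow_mem_pow ((htJ g).1 hg) r
        rw [show J ^ r = 0 from hr] at h2
        exact pow_eq_zero_of_isNilpotent ⟨r, congrArg Subtype.val (show _ = (0 : A) from h2)⟩
    have h2 : N₀ = ⊥ := by
      rw [eq_bot_iff]
      intro x hx
      exact Units.ext (h1 ⟨x, hx, rfl⟩)
    rw [h2, Subgroup.relIndex_bot_left] at hidx
    have : Finite N := Nat.finite_of_card_ne_zero hidx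
    refine Finite.of_injective (fun g : t.ker => (⟨g, ⟨g, g.2, rfl⟩⟩ : N)) fun a b hab => ?_
    have h3 : (a : Γ).1 = (b : Γ).1 := congrArg (fun z : N => (z : (Mat k n)ˣ)) hab
    exact Subtype.ext (Subtype.ext h3)

end semisimple

section points

variable {k C : Type*} [Field k] [IsAlgClosed k] [CommRing C] [Algebra k C]
  [Algebra.FiniteType k C]

theorem exists_algHom_ker_ge {I : Ideal C} (hI : I ≠ ⊤) :
    ∃ x : C →ₐ[k] k, ∀ a ∈ I, x a = 0 := by
  obtain ⟨m, hm, hIm⟩ := Ideal.exists_le_maximal I hI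
  let _ := Ideal.Quotient.field m
  have := finite_of_finite_type_of_isJacobsonRing k (C ⧸ m)
  have hb : Function.Bijective (algebraMap k (C ⧸ m)) :=
    IsAlgClosed.algebraMap_bijective_of_isIntegral
  let e : k ≃ₐ[k] (C ⧸ m) := AlgEquiv.ofBijective (Algebra.ofId k _) hb
  refine ⟨(e.symm : (C ⧸ m) →ₐ[k] k).comp (Ideal.Quotient.mkₐ k m), fun a ha => ?_⟩
  show e.symm (Ideal.Quotient.mk m a) = 0
  rw [Ideal.Quotient.eq_zero_iff_mem.2 (hIm ha), map_zero]

theorem exists_algHom_ne_zero {β : C} (hβ : ¬ IsNilpotent β) :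
    ∃ x : C →ₐ[k] k, x β ≠ 0 := by
  have h1 : Nontrivial (Localization.Away β) := by
    rw [← not_subsingleton_iff_nontrivial]
    intro h
    obtain ⟨n, hn⟩ := (IsLocalization.subsingleton_iff (M := Submonoid.powers β)).1 h
    exact hβ ⟨n, hn⟩
  have : Algebra.FiniteType k (Localization.Away β) := .trans (S := C) inferInstance inferInstance
  obtain ⟨x, -⟩ := exists_algHom_ker_ge (k := k) (bot_ne_top (α := Ideal (Localization.Away β)))
  refine ⟨x.comp (IsScalarTower.toAlgHom k C _), fun h => ?_⟩
  have h2 : IsUnit (algebraMap C (Localization.Away β) β) :=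
    IsLocalization.map_units _ (⟨β, Submonoid.mem_powers β⟩ : Submonoid.powers β)
  exact (h2.map x).ne_zero h

end points

theorem exists_forall_comap_eq {A C : Type*} [CommRing A] [IsDomain A] [IsNoetherianRing A]
    [CommRing C] (φ : A →+* C) (hφ : φ.FiniteType) (hinj : Function.Injective φ) :
    ∃ a ≠ 0, ∀ P : Ideal A, P.IsPrime → a ∉ P → ∃ Q : Ideal C, Q.IsPrime ∧ Q.comap φ = P := by
  have hfp : φ.FinitePresentation := RingHom.FinitePresentation.of_finiteType.1 hφ
  obtain ⟨S, hS⟩ := PrimeSpectrum.exists_constructibleSetData_iff.2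
    (PrimeSpectrum.isConstructible_range_comap hfp)
  have h0 : (⟨⊥, Ideal.isPrime_bot⟩ : PrimeSpectrum A) ∈ Set.range (PrimeSpectrum.comap φ) := by
    have h1 : Ideal.comap φ ⊥ = ⊥ := (RingHom.injective_iff_ker_eq_bot _).1 hinj
    obtain ⟨Q, hQ, h2⟩ := Ideal.exists_comap_eq_of_mem_minimalPrimes_of_injective hinj ⊥
      (by rw [IsDomain.minimalPrimes_eq_singleton_bot]; rfl)
    exact ⟨⟨Q, hQ⟩, PrimeSpectrum.ext h2⟩
  rw [← hS] at h0
  obtain ⟨c, hc, h0⟩ := Set.mem_iUnion₂.1 h0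
  refine ⟨c.f, fun h => h0.2 ?_, fun P hP hcP => ?_⟩
  · rw [h]; simp
  · have h1 : (⟨P, hP⟩ : PrimeSpectrum A) ∈ Set.range (PrimeSpectrum.comap φ) := by
      rw [← hS]
      refine Set.mem_iUnion₂.2 ⟨c, hc, ?_, ?_⟩
      · rintro _ ⟨i, rfl⟩
        have h2 : c.g i = 0 := h0.1 ⟨i, rfl⟩
        rw [h2]
        exact P.zero_mem
      · exact fun h => hcP (h rfl)
    obtain ⟨Q, hQ⟩ := h1
    exact ⟨Q.asIdeal, Q.isPrime, congrArg PrimeSpectrum.asIdeal hQ⟩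

theorem isAlgebraic_of_finite_fibres {k C : Type*} [Field k] [IsAlgClosed k] [CommRing C]
    [IsDomain C] [Algebra k C] [Algebra.FiniteType k C] (B : Subalgebra k C)
    [Algebra.FiniteType k B] (f : C)
    (hf : ∀ x : C →ₐ[k] k, {s | ∃ x' : C →ₐ[k] k, (∀ b ∈ B, x' b = x b) ∧ x' f = s}.Finite) :
    IsAlgebraic B f := by
  classical
  by_contra htr
  have hinj : Function.Injective (Polynomial.aeval (R := B) f) :=
    transcendental_iff_injective.1 htr
  have : IsNoetherianRing B := Algebra.FiniteType.isNoetherianRing k B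
  let φ : Polynomial B →ₐ[B] C := Polynomial.aeval f
  have hφ : (φ : Polynomial B →+* C).FiniteType := by
    have h1 : (algebraMap k C).FiniteType := RingHom.finiteType_algebraMap.2 inferInstance
    have h2 : algebraMap k C = (φ : Polynomial B →+* C).comp (algebraMap k (Polynomial B)) := by
      ext c
      simp [φ,
        ← IsScalarTower.algebraMap_apply k B C]
    rw [h2] at h1
    exact h1.of_comp_finiteType
  obtain ⟨b, hb, hlift⟩ := exists_forall_comap_eq (φ : Polynomial B →+* C) hφ hinj
  obtain ⟨i, hi⟩ : ∃ i, b.coeff i ≠ 0 := by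
    by_contra! h
    exact hb (Polynomial.ext h)
  obtain ⟨x, hx⟩ := exists_algHom_ne_zero (k := k) (β := (b.coeff i : C))
    (fun h => hi (Subtype.ext h.eq_zero))
  let xB : B →+* k := (x : C →+* k).comp B.subtype
  have hbx : b.map xB ≠ 0 := fun h => hx (by
    have := congrArg (Polynomial.coeff · i) h
    rw [Polynomial.coeff_map] at this
    exact this)
  refine (Set.Infinite.mono ?_ ((b.map xB).roots.toFinset.finite_toSet.infinite_compl))
    (hf x)
  intro s hs
  have hs' : Polynomial.eval₂ xB s b ≠ 0 := by
    rw [← Polynomial.eval_map]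
    intro h
    exact hs (by simpa [hbx] using h)
  let ψ : Polynomial B →+* k := Polynomial.eval₂RingHom xB s
  obtain ⟨Q, hQ, hQP⟩ := hlift (RingHom.ker ψ) (RingHom.ker_isPrime ψ) hs'
  obtain ⟨x', hx'⟩ := exists_algHom_ker_ge (k := k) hQ.ne_top
  have key : ∀ p : Polynomial B, x' (φ p) = ψ p := by
    intro p
    have h1 : p - Polynomial.C (algebraMap k B (ψ p)) ∈ RingHom.ker ψ := by
      rw [RingHom.mem_ker, map_sub]
      simp [ψ, xB]
    rw [← hQP] at h1
    have h2 := hx' _ h1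
    rw [map_sub, map_sub] at h2
    have h3 : (φ : Polynomial B →+* C) (Polynomial.C (algebraMap k B (ψ p))) =
        algebraMap k C (ψ p) := by
      simp [φ, ← IsScalarTower.algebraMap_apply k B C]
    rw [h3, AlgHom.commutes, sub_eq_zero] at h2
    exact h2
  refine ⟨x', fun c hc => ?_, ?_⟩
  · simpa [φ, ψ, xB] using key (Polynomial.C ⟨c, hc⟩)
  · simpa [φ, ψ] using key Polynomial.X

section regular

variable {k : Type} [Field k] {n : ℕ}

/-- The algebra of regular functions on the set of values of a map to matrix space. -/
noncomputable def regFun {Y : Type*} (c : Y → Mat k n) : Subalgebra k (Y → k) :=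
  (AlgHom.pi fun y =>
    (aeval fun z : Fin n × Fin n => c y z.1 z.2 : MPoly k n →ₐ[k] k)).range

variable {Y : Type*} (c : Y → Mat k n)

theorem mem_regFun {f : Y → k} : f ∈ regFun c ↔ ∃ p : MPoly k n, ∀ y, f y = mEval (c y) p := by
  constructor
  · rintro ⟨p, rfl⟩
    exact ⟨p, fun y => (mEval_eq _ _).symm⟩
  · rintro ⟨p, hp⟩
    exact ⟨p, _root_.funext fun y => (mEval_eq (c y) p).symm.trans (hp y).symm⟩

/-- The regular function defined by a polynomial. -/
noncomputable def regEv : MPoly k n →ₐ[k] regFun c := AlgHom.rangeRestrict _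

theorem regEv_apply (p : MPoly k n) (y : Y) : (regEv c p).1 y = mEval (c y) p := (mEval_eq _ _).symm

theorem regEv_surjective : Function.Surjective (regEv c) := AlgHom.rangeRestrict_surjective _

instance : Algebra.FiniteType k (regFun c) :=
  Algebra.FiniteType.of_surjective (regEv c) (regEv_surjective c)

theorem linear_mem_regFun (f : Mat k n →ₗ[k] k) : (fun y => f (c y)) ∈ regFun c :=
  (mem_regFun c).2 ⟨linPoly f, fun y => (mEval_linPoly f _).symm⟩

theorem isDomain_regFun (h : IrreducibleSet (Set.range c)) : IsDomain (regFun c) := by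
  have : Nonempty Y := Set.range_nonempty_iff_nonempty.1 h.1
  have : NoZeroDivisors (regFun c) := by
    refine ⟨fun {a b} hab => ?_⟩
    obtain ⟨p, hp⟩ := (mem_regFun c).1 a.2
    obtain ⟨q, hq⟩ := (mem_regFun c).1 b.2
    have h1 : ∀ (s : regFun c) (r : MPoly k n), (∀ y, s.1 y = mEval (c y) r) →
        (VanishesOn (Set.range c) r ↔ s = 0) := by
      intro s r hr
      rw [VanishesOn, Set.forall_mem_range]
      simp only [← hr]
      exact ⟨fun h => Subtype.ext (_root_.funext h), fun h => by rw [h]; exact fun _ => rfl⟩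
    rw [← h1 a p hp, ← h1 b q hq]
    refine h.2 p q ((h1 (a * b) _ fun y => ?_).2 hab)
    show a.1 y * b.1 y = _
    rw [hp, hq, mEval, mEval, mEval, map_mul]
  exact NoZeroDivisors.to_isDomain _

/-- The inclusion of a group of matrices in matrix space. -/
def incl (Γ : Subgroup (Mat k n)ˣ) (g : Γ) : Mat k n := ((g : (Mat k n)ˣ) : Mat k n)

theorem range_incl (Γ : Subgroup (Mat k n)ˣ) : Set.range (incl Γ) = matSet Γ := by
  rw [matSet, show incl Γ = Units.val ∘ Subtype.val from rfl, Set.range_comp, Subtype.range_coe]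

theorem incl_mul (Γ : Subgroup (Mat k n)ˣ) (g h : Γ) : incl Γ (g * h) = incl Γ g * incl Γ h := rfl

theorem exists_eq_eval {Γ : Subgroup (Mat k n)ˣ} (hΓ : ZClosed (matSet Γ))
    (x : regFun (incl Γ) →ₐ[k] k) : ∃ g : Γ, ∀ f : regFun (incl Γ), x f = f.1 g := by
  obtain ⟨S, hS⟩ := hΓ
  let ev := regEv (incl Γ)
  have hev : ∀ p g, (ev p).1 g = mEval (incl Γ g) p := regEv_apply _
  let a : Mat k n := Matrix.of fun i j => x (ev (X (i, j)))
  have ha : ∀ p, x (ev p) = mEval a p := by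
    intro p
    rw [mEval_eq]
    refine DFunLike.congr_fun (?_ : x.comp ev = aeval _) p
    ext z
    simp [a]
  have h1 : a ∈ matSet Γ := by
    rw [hS]
    intro p hp
    rw [← ha, show ev p = 0 from ?_, map_zero]
    ext g
    rw [hev]
    have h2 : incl Γ g ∈ matSet Γ := ⟨g, g.2, rfl⟩
    rw [hS] at h2
    exact h2 p hp
  obtain ⟨g, hg, hga⟩ := h1
  refine ⟨⟨g, hg⟩, fun f => ?_⟩
  obtain ⟨p, rfl⟩ := regEv_surjective _ f
  show x (ev p) = (ev p).1 _
  rw [ha, hev, ← hga]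
  rfl

/-- Right translation of regular functions. -/
noncomputable def rtrans (Γ : Subgroup (Mat k n)ˣ) (h : Γ) :
    regFun (incl Γ) →ₐ[k] regFun (incl Γ) :=
  ((AlgHom.pi fun g => Pi.evalAlgHom k (fun _ : Γ => k) (g * h)).comp
    (regFun (incl Γ)).val).codRestrict _ fun f => by
      obtain ⟨p, hp⟩ := (mem_regFun _).1 f.2
      refine (mem_regFun _).2 ⟨tsub 1 (incl Γ h) p, fun g => ?_⟩
      rw [mEval_tsub, one_mul, ← incl_mul, ← hp]
      rfl

theorem rtrans_apply (Γ : Subgroup (Mat k n)ˣ) (h g : Γ) (f : regFun (incl Γ)) :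
    (rtrans Γ h f).1 g = f.1 (g * h) := rfl

/-- Right translation of regular functions as an automorphism. -/
noncomputable def rtransEquiv (Γ : Subgroup (Mat k n)ˣ) (h : Γ) :
    regFun (incl Γ) ≃ₐ[k] regFun (incl Γ) :=
  AlgEquiv.ofAlgHom (rtrans Γ h) (rtrans Γ h⁻¹)
    (by ext f; simp [rtrans_apply]) (by ext f; simp [rtrans_apply])

/-- Geometric reductivity of a group of matrices: nonzero invariant vectors in rational
representations are detected by invariant homogeneous polynomials of positive degree. -/
def GeomReductive (Γ : Subgroup (Mat k n)ˣ) : Prop :=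
  ∀ (m : ℕ) (ρ : Γ →* Matrix (Fin m) (Fin m) k), (∀ i j, (fun g => ρ g i j) ∈ regFun (incl Γ)) →
    ∀ e : Fin m → k, e ≠ 0 → (∀ g, (ρ g).mulVec e = e) →
      ∃ (d : ℕ) (P : MvPolynomial (Fin m) k), 0 < d ∧ P.IsHomogeneous d ∧ eval e P ≠ 0 ∧
        ∀ g x, eval ((ρ g).mulVec x) P = eval x P

set_option maxHeartbeats 2000000 in
theorem geomReductive_of_irreducible [IsAlgClosed k] (Γ : Subgroup (Mat k n)ˣ)
    (hΓ : ZClosed (matSet Γ)) (hirr : IrreducibleSet (matSet Γ)) {m : ℕ} (d : Fin m → ℕ)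
    (ℓ : Mat k n →ₗ[k] ∀ i, Matrix (Fin (d i)) (Fin (d i)) k)
    (t : Γ →* ∀ i, Matrix (Fin (d i)) (Fin (d i)) k) (hd : ∀ i, 0 < d i)
    (ht : ∀ g : Γ, t g = ℓ (incl Γ g)) (hspan : Submodule.span k (Set.range t) = ⊤)
    (hker : Finite t.ker) : GeomReductive Γ := by
  intro r ρ hρ e he hfix
  have hdom : IsDomain (regFun (incl Γ)) := isDomain_regFun _ (by rwa [range_incl])
  let C := regFun (incl Γ)
  let L := FractionRing C
  let J := Σ i, Fin (d i)
  have htent : ∀ z : J × J, (fun g => Matrix.blockDiagonal' (t g) z.1 z.2) ∈ C := by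
    intro z
    let f : Mat k n →ₗ[k] k :=
      { toFun := fun a => Matrix.blockDiagonal' (ℓ a) z.1 z.2
        map_add' := fun a b => by rw [map_add, Matrix.blockDiagonal'_add]; rfl
        map_smul' := fun s a => by rw [map_smul, Matrix.blockDiagonal'_smul]; rfl }
    have h1 := linear_mem_regFun (incl Γ) f
    simp only [f, LinearMap.coe_mk, AddHom.coe_mk, ← ht] at h1
    exact h1
  let θC : MvPolynomial (J × J) k →ₐ[k] C := aeval fun z => ⟨_, htent z⟩
  have hθC : ∀ p g, (θC p).1 g = eval (fun z => Matrix.blockDiagonal' (t g) z.1 z.2) p := by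
    intro p g
    rw [← aeval_eq_eval]
    refine DFunLike.congr_fun
      (?_ : ((Pi.evalAlgHom k (fun _ : Γ => k) g).comp C.val).comp θC = aeval _) p
    ext z
    simp [θC]
  let ι : C →ₐ[k] L := IsScalarTower.toAlgHom k C L
  have hι : Function.Injective ι := IsFractionRing.injective C L
  let θ : MvPolynomial (J × J) k →ₐ[k] L := ι.comp θC
  have hθX : ∀ p, aeval (fun z => θ (X z)) p = θ p := by
    intro p
    rw [← comp_aeval_apply, aeval_X_left_apply]
  let K : IntermediateField k L := IntermediateField.adjoin k (Set.range fun z => θ (X z))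
  have hθK : ∀ p, θ p ∈ K := fun p => (IntermediateField.mem_adjoin_range_iff k _ _).2
    ⟨p, 1, by rw [hθX, map_one, div_one]⟩
  let coord : Fin n × Fin n → C := fun z =>
    ⟨fun g => incl Γ g z.1 z.2, (mem_regFun _).2 ⟨X z, fun g => (mEval_X _ _).symm⟩⟩
  have halg : ∀ z, IsAlgebraic K (ι (coord z)) := by
    intro z
    have hft : Algebra.FiniteType k θC.range :=
      Algebra.FiniteType.of_surjective θC.rangeRestrict θC.rangeRestrict_surjective
    obtain ⟨p, hp0, hp⟩ := isAlgebraic_of_finite_fibres θC.range (coord z) (by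
      intro x
      obtain ⟨g, hg⟩ := exists_eq_eval hΓ x
      refine (Set.finite_range fun κ : t.ker => (coord z).1 (κ * g)).subset ?_
      rintro _ ⟨x', hx', rfl⟩
      obtain ⟨g', hg'⟩ := exists_eq_eval hΓ x'
      have h1 : t g' = t g := by
        ext i a b
        have h2 := hx' (θC (X (⟨i, a⟩, ⟨i, b⟩))) ⟨_, rfl⟩
        rw [hg, hg', hθC, hθC, eval_X, eval_X] at h2
        simpa using h2
      refine ⟨⟨g' * g⁻¹, ?_⟩, ?_⟩
      · rw [MonoidHom.mem_ker, map_mul, h1, ← map_mul, mul_inv_cancel, map_one]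
      · rw [hg']
        simp)
    let κ : θC.range →+* K := ((ι : C →+* L).comp θC.range.val.toRingHom).codRestrict K (by
      rintro ⟨_, q, rfl⟩
      exact hθK q)
    have hκ : Function.Injective κ := fun a b hab => Subtype.ext (hι (congrArg Subtype.val hab))
    refine ⟨p.map κ, (Polynomial.map_ne_zero_iff hκ).2 hp0, ?_⟩
    have h3 := congrArg ι hp
    rw [map_zero, Polynomial.aeval_def] at h3
    rw [Polynomial.aeval_def, Polynomial.eval₂_map, ← h3]
    exact (Polynomial.hom_eval₂ p _ (ι : C →+* L) (coord z)).symm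
  have hfin : FiniteDimensional K L := by
    have h1 := IntermediateField.finiteDimensional_adjoin (K := K) (L := L)
      (S := Set.range fun z => ι (coord z)) (by
        rintro _ ⟨z, rfl⟩
        exact (halg z).isIntegral)
    have h2 : IntermediateField.adjoin K (Set.range fun z => ι (coord z)) = ⊤ := by
      rw [eq_top_iff]
      have h3 : ∀ f : C, ι f ∈ IntermediateField.adjoin K (Set.range fun z => ι (coord z)) := by
        intro f
        obtain ⟨p, rfl⟩ := regEv_surjective _ f
        show (ι.comp (regEv (incl Γ))) p ∈ _
        induction p using MvPolynomial.induction_on with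
        | C c =>
          rw [← algebraMap_eq, AlgHom.commutes, IsScalarTower.algebraMap_apply k K L]
          exact IntermediateField.algebraMap_mem _ _
        | add p q hp hq => rw [map_add]; exact add_mem hp hq
        | mul_X p z hp =>
          rw [map_mul]
          refine mul_mem hp (IntermediateField.subset_adjoin _ _ ⟨z, ?_⟩)
          refine congrArg ι (Subtype.ext (_root_.funext fun g => ?_))
          exact ((regEv_apply (incl Γ) (X z) g).trans (mEval_X _ _)).symm
      intro x _
      obtain ⟨a, b, -, rfl⟩ := IsFractionRing.div_surjective (A := C) x
      exact div_mem (h3 a) (h3 b)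
    rw [h2] at h1
    exact Module.Finite.equiv (IntermediateField.topEquiv (F := K) (E := L)).toLinearEquiv
  let σ : Γ → L ≃ₐ[k] L := fun h => IsFractionRing.algEquivOfAlgEquiv (rtransEquiv Γ h)
  have hσ : ∀ h f, σ h (ι f) = ι (rtrans Γ h f) := fun h f =>
    IsFractionRing.fieldEquivOfAlgEquiv_algebraMap _ _ _ _ _
  obtain ⟨i₀, hi₀⟩ := Function.ne_iff.1 he
  let φC : Fin r → C := fun a => (e i₀)⁻¹ • ⟨fun g => ρ g i₀ a, hρ i₀ a⟩
  have hφ : ∀ x : Fin r → k, ∑ a, algebraMap k L (x a) * ι (φC a) =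
      ι (∑ a, x a • φC a) := by
    intro x
    rw [map_sum]
    refine Finset.sum_congr rfl fun a _ => ?_
    rw [← Algebra.smul_def]
    exact (map_smul ι (x a) (φC a)).symm
  have hφ' : ∀ (x : Fin r → k) g, (∑ a, x a • φC a).1 g = (e i₀)⁻¹ * (ρ g).mulVec x i₀ := by
    intro x g
    rw [Matrix.mulVec, dotProduct, Finset.mul_sum]
    have h1 : (∑ a, x a • φC a).1 g = ∑ a, x a * ((e i₀)⁻¹ * ρ g i₀ a) := by
      rw [show (∑ a, x a • φC a).1 = ∑ a, (x a • φC a).1 from map_sum C.val _ _, Finset.sum_apply]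
      rfl
    rw [h1]
    exact Finset.sum_congr rfl fun a _ => by ring
  refine exists_invariant_of_finite hd θ (fun g => t g) (fun h i => ?_)
    hspan (fun h x => (ρ h).mulVec x) (fun h s x => Matrix.mulVec_smul _ _ _) (fun h x => ?_) e
    hfix σ (fun h p => ?_) K hθK (fun x hx => ?_) (fun a => ι (φC a)) (fun h x => ?_) ?_
  · have h1 : t h i * t h⁻¹ i = 1 := by
      rw [← Pi.mul_apply, ← map_mul, mul_inv_cancel, map_one]; rfl
    exact fun h2 => one_ne_zero (α := k) (by
      rw [← Matrix.det_one (n := Fin (d i)), ← h1, Matrix.det_mul, h2, zero_mul])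
  · exact ⟨(ρ h⁻¹).mulVec x, by
      show (ρ h).mulVec ((ρ h⁻¹).mulVec x) = x
      rw [Matrix.mulVec_mulVec, ← map_mul, mul_inv_cancel, map_one, Matrix.one_mulVec]⟩
  · show ι (θC (rsub (Matrix.blockDiagonal' (t h)) p)) = σ h (ι (θC p))
    rw [hσ]
    refine congrArg ι (Subtype.ext (_root_.funext fun g => ?_))
    rw [rtrans_apply, hθC, hθC, map_mul]
    have h1 := eval_rsub (Matrix.blockDiagonal' (t g)) (Matrix.blockDiagonal' (t h)) p
    rw [h1]
    congr 2
    ext z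
    rw [← Matrix.blockDiagonal'_mul]
    rfl
  · obtain ⟨p, q, rfl⟩ := (IntermediateField.mem_adjoin_range_iff k _ _).1 hx
    simp only [hθX]
    by_cases hq : θ q = 0
    · exact ⟨0, 1, by simp, by simp [hq]⟩
    · exact ⟨p, q, hq, mul_div_cancel₀ _ hq⟩
  · rw [hφ, hφ, hσ]
    congr 1
    ext g
    rw [rtrans_apply, hφ', hφ', Matrix.mulVec_mulVec, ← map_mul]
  · rw [hφ, show ∑ a, e a • φC a = 1 from ?_, map_one]
    ext g
    rw [hφ', hfix, inv_mul_cancel₀ hi₀]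
    rfl

end regular

section linSub

variable {k : Type*} [CommSemiring k] {ι : Type*} [Fintype ι]

/-- The substitution `p(x) ↦ p(A x)`. -/
noncomputable def linSub (A : Matrix ι ι k) : MvPolynomial ι k →ₐ[k] MvPolynomial ι k :=
  aeval fun i => ∑ j, C (A i j) * X j

theorem linSub_X (A : Matrix ι ι k) (i : ι) : linSub A (X i) = ∑ j, C (A i j) * X j :=
  aeval_X _ _

theorem eval_linSub (A : Matrix ι ι k) (x : ι → k) (p : MvPolynomial ι k) :
    eval x (linSub A p) = eval (A.mulVec x) p := by
  rw [← aeval_eq_eval, ← aeval_eq_eval]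
  refine DFunLike.congr_fun (?_ : (aeval x).comp (linSub A) = aeval _) p
  ext i
  simp [linSub, Matrix.mulVec, dotProduct]

theorem isHomogeneous_linSub (A : Matrix ι ι k) {p : MvPolynomial ι k} {d : ℕ}
    (hp : p.IsHomogeneous d) : (linSub A p).IsHomogeneous d := by
  have h := hp.aeval (fun i => ∑ j, C (A i j) * (X j : MvPolynomial ι k)) (n := 1) (fun i =>
    IsHomogeneous.sum _ _ _ fun j _ => by
      simpa using (isHomogeneous_C ι (A i j)).mul (isHomogeneous_X k j))
  rwa [one_mul] at h

end linSub

section normalSubgroup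

variable {k : Type} [Field k] {n : ℕ}

theorem GeomReductive.of_finite_index {Γ₀ Γ : Subgroup (Mat k n)ˣ} (h₀ : GeomReductive Γ₀)
    (hle : Γ₀ ≤ Γ) (hidx : Γ₀.relIndex Γ ≠ 0) : GeomReductive Γ := by
  intro m ρ hρ e he hfix
  obtain ⟨d, P, hd, hP, hPe, hPi⟩ := h₀ m (ρ.comp (Subgroup.inclusion hle)) (fun i j => by
    obtain ⟨p, hp⟩ := (mem_regFun _).1 (hρ i j)
    exact (mem_regFun _).2 ⟨p, fun g => hp _⟩) e he (fun g => hfix _)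
  let N := Γ₀.subgroupOf Γ
  have : Finite (Γ ⧸ N) := Nat.finite_of_card_ne_zero hidx
  have := Fintype.ofFinite (Γ ⧸ N)
  have hout : ∀ (g : Γ) x, eval ((ρ (Quotient.out (g : Γ ⧸ N))⁻¹).mulVec x) P =
      eval ((ρ g⁻¹).mulVec x) P := by
    intro g x
    obtain ⟨γ, hγ⟩ := QuotientGroup.mk_out_eq_mul N g
    have h1 : Quotient.out (g : Γ ⧸ N) = g * γ := hγ
    rw [h1, mul_inv_rev, map_mul, ← Matrix.mulVec_mulVec]
    exact hPi ⟨(γ⁻¹ : N).1.1, (γ⁻¹ : N).2⟩ _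
  refine ⟨∑ _q : Γ ⧸ N, d, ∏ q : Γ ⧸ N, linSub (ρ (Quotient.out q)⁻¹) P, ?_,
    IsHomogeneous.prod _ _ _ fun q _ => isHomogeneous_linSub _ hP, ?_, fun a x => ?_⟩
  · exact Finset.sum_pos (fun _ _ => hd) ⟨((1 : Γ) : Γ ⧸ N), Finset.mem_univ _⟩
  · rw [map_prod]
    refine Finset.prod_ne_zero_iff.2 fun q _ => ?_
    rwa [eval_linSub, hfix]
  · rw [map_prod, map_prod]
    refine Fintype.prod_equiv (MulAction.toPerm a⁻¹) _ _ fun q => ?_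
    rw [eval_linSub, eval_linSub, Matrix.mulVec_mulVec, ← map_mul]
    show _ = eval ((ρ (Quotient.out (a⁻¹ • q))⁻¹).mulVec x) P
    have h1 : a⁻¹ • q = ((a⁻¹ * Quotient.out q : Γ) : Γ ⧸ N) := by
      conv_lhs => rw [← QuotientGroup.out_eq' q]
      rfl
    rw [h1, hout]
    simp

theorem geomReductive_of_normal [IsAlgClosed k] {G : Set (Mat k n)} (hred : IsReductiveGroup G)
    (Γ : Subgroup (Mat k n)ˣ) (hΓG : matSet Γ ⊆ G) (hΓ : ZClosed (matSet Γ))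
    (hnorm : ∀ a : (Mat k n)ˣ, (a : Mat k n) ∈ G → ((a⁻¹ : (Mat k n)ˣ) : Mat k n) ∈ G →
      ∀ x ∈ Γ, a * x * a⁻¹ ∈ Γ) : GeomReductive Γ := by
  obtain ⟨Γ₀, hle, hcl, hirr, hidx, hconj⟩ := exists_irreducible_subgroup Γ hΓ
  obtain ⟨m, d, ℓ, t, hd, ht, hspan, hker⟩ := exists_blockRep hred Γ₀
    ((Set.image_mono hle).trans hΓG) hcl fun a ha ha' => hconj a (hnorm a ha ha') fun x hx => by
      have := hnorm a⁻¹ ha' (by rwa [inv_inv]) x hx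
      rwa [inv_inv] at this
  exact (geomReductive_of_irreducible Γ₀ hcl hirr d ℓ t hd ht hspan hker).of_finite_index hle hidx

end normalSubgroup

section reynolds

variable {k : Type} [Field k] {Γ : Type} [Group Γ]

/-- `α` is an action of `Γ` on `A` by algebra endomorphisms, on the right. -/
structure IsRightAction {A : Type} [CommRing A] [Algebra k A] (α : Γ → A →ₐ[k] A) : Prop where
  map_one : α 1 = AlgHom.id k A
  map_mul : ∀ g h, α (g * h) = (α h).comp (α g)

/-- The orbit of `f` depends on the group element through functions in `R`. -/
def IsRationalElt (R : Subalgebra k (Γ → k)) {A : Type} [CommRing A] [Algebra k A]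
    (α : Γ → A →ₐ[k] A) (f : A) : Prop :=
  ∃ (ι : Type) (_ : Fintype ι) (c : ι → Γ → k) (a : ι → A),
    (∀ i, c i ∈ R) ∧ ∀ h, α h f = ∑ i, c i h • a i

/-- Geometric reductivity of a group with algebra of regular functions `R`. -/
def IsGeomReductive (R : Subalgebra k (Γ → k)) : Prop :=
  ∀ (m : ℕ) (ρ : Γ →* Matrix (Fin m) (Fin m) k), (∀ i j, (fun g => ρ g i j) ∈ R) →
    ∀ e : Fin m → k, e ≠ 0 → (∀ g, (ρ g).mulVec e = e) →
      ∃ (d : ℕ) (P : MvPolynomial (Fin m) k), 0 < d ∧ P.IsHomogeneous d ∧ eval e P ≠ 0 ∧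
        ∀ g x, eval ((ρ g).mulVec x) P = eval x P

variable {R : Subalgebra k (Γ → k)} {A : Type} [CommRing A] [Algebra k A] {α : Γ → A →ₐ[k] A}

theorem isRationalElt_algebraMap (x : k) : IsRationalElt R α (algebraMap k A x) :=
  ⟨Unit, inferInstance, fun _ => 1, fun _ => algebraMap k A x, fun _ => one_mem R,
    fun h => by simp⟩

theorem IsRationalElt.add {f g : A} (hf : IsRationalElt R α f) (hg : IsRationalElt R α g) :
    IsRationalElt R α (f + g) := by
  obtain ⟨ι, _, c, a, hc, hf⟩ := hf
  obtain ⟨ι', _, c', a', hc', hg⟩ := hg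
  refine ⟨ι ⊕ ι', inferInstance, Sum.elim c c', Sum.elim a a', ?_, fun h => ?_⟩
  · rintro (i | i)
    exacts [hc i, hc' i]
  · simp [hf, hg]

theorem IsRationalElt.mul {f g : A} (hf : IsRationalElt R α f) (hg : IsRationalElt R α g) :
    IsRationalElt R α (f * g) := by
  obtain ⟨ι, _, c, a, hc, hf⟩ := hf
  obtain ⟨ι', _, c', a', hc', hg⟩ := hg
  refine ⟨ι × ι', inferInstance, fun i => c i.1 * c' i.2, fun i => a i.1 * a' i.2,
    fun i => mul_mem (hc _) (hc' _), fun h => ?_⟩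
  simp only [map_mul, hf, hg, Finset.sum_mul_sum, Fintype.sum_prod_type, Pi.mul_apply,
    smul_mul_smul_comm]

theorem isRationalElt_of_adjoin {s : Set A} (hs : ∀ x ∈ s, IsRationalElt R α x) {f : A}
    (hf : f ∈ Algebra.adjoin k s) : IsRationalElt R α f := by
  induction hf using Algebra.adjoin_induction with
  | mem x hx => exact hs x hx
  | algebraMap r => exact isRationalElt_algebraMap r
  | add x y _ _ hx hy => exact hx.add hy
  | mul x y _ _ hx hy => exact hx.mul hy

theorem aeval_linSub {ι : Type*} [Fintype ι] (B : Matrix ι ι k) (w w' : ι → A)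
    (hw : ∀ j, w' j = ∑ i, B j i • w i) (P : MvPolynomial ι k) :
    aeval w' P = aeval w (linSub B P) := by
  refine DFunLike.congr_fun (?_ : aeval w' = (aeval w).comp (linSub B)) P
  ext j
  simp [linSub, hw, Algebra.smul_def]

theorem aeval_smul_of_isHomogeneous {ι : Type*} {P : MvPolynomial ι k} {d : ℕ}
    (hP : P.IsHomogeneous d) (x : ι → k) (f : A) :
    aeval (fun i => x i • f) P = eval x P • f ^ d := by
  rw [aeval_def, eval₂_eq, eval_eq, Finset.sum_smul]
  refine Finset.sum_congr rfl fun e he => ?_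
  have h1 := hP (mem_support_iff.1 he)
  rw [Finsupp.weight_apply, Finsupp.sum] at h1
  simp only [smul_pow, Finset.prod_smul, Finset.prod_pow_eq_pow_sum]
  rw [show ∑ i ∈ e.support, e i = d by simpa using h1, ← Algebra.smul_def, smul_smul]

theorem exists_invariant_sub_pow_mem [Infinite k] (hgr : IsGeomReductive R)
    (hR : ∀ c ∈ R, ∀ g, (fun h => c (g * h)) ∈ R) (hα : IsRightAction α) (J : Ideal A)
    (hJ : ∀ h, ∀ x ∈ J, α h x ∈ J) {f : A} (hf : IsRationalElt R α f)
    (hinv : ∀ h, α h f - f ∈ J) :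
    ∃ (d : ℕ) (F : A), 0 < d ∧ (∀ h, α h F = F) ∧ F - f ^ d ∈ J := by
  by_cases hfJ : f ∈ J
  · exact ⟨1, 0, one_pos, fun h => map_zero _, by simpa using hfJ⟩
  obtain ⟨ι, _, c, a, hc, hca⟩ := hf
  let W : Submodule k A := Submodule.span k (Set.range fun h => α h f)
  have hWfin : FiniteDimensional k W := by
    have hle : W ≤ Submodule.span k (Set.range a) := by
      refine Submodule.span_le.2 ?_
      rintro _ ⟨h, rfl⟩
      simp only [hca]
      exact Submodule.sum_mem _ fun i _ =>
        Submodule.smul_mem _ _ (Submodule.subset_span ⟨i, rfl⟩)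
    have : FiniteDimensional k (Submodule.span k (Set.range a)) :=
      FiniteDimensional.span_of_finite k (Set.finite_range a)
    exact Submodule.finiteDimensional_of_le hle
  have hfW : f ∈ W := Submodule.subset_span ⟨1, by simp [hα.map_one]⟩
  have hWα : ∀ h, ∀ x ∈ W, α h x ∈ W := by
    intro h x hx
    induction hx using Submodule.span_induction with
    | mem x hx =>
      obtain ⟨g, rfl⟩ := hx
      exact Submodule.subset_span ⟨g * h, by simp [hα.map_mul]⟩
    | zero => simp
    | add x y _ _ hx hy => simpa using add_mem hx hy
    | smul t x _ hx => simpa using Submodule.smul_mem _ t hx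
  let W₀ : Submodule k A := W ⊓ J.restrictScalars k
  have hW₀fin : FiniteDimensional k W₀ := Submodule.finiteDimensional_of_le inf_le_left
  let b := Module.finBasis k W₀
  let w : Fin (Module.finrank k W₀ + 1) → A := Fin.cons f fun i => (b i : A)
  have hspanb : Submodule.span k (Set.range fun i => (b i : A)) = W₀ := by
    have := congrArg (Submodule.map W₀.subtype) b.span_eq
    rw [Submodule.map_span, Submodule.map_top, Submodule.range_subtype, ← Set.range_comp] at this
    exact this
  have hli : LinearIndependent k w := by
    refine linearIndependent_finCons.2 ⟨b.linearIndependent.map' _ (Submodule.ker_subtype _), ?_⟩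
    intro hmem
    exact hfJ (((hspanb.le hmem : f ∈ W₀)).2)
  obtain ⟨l, hl⟩ := LinearMap.exists_leftInverse_of_injective (Fintype.linearCombination k w)
    (LinearMap.ker_eq_bot.2 hli.fintypeLinearCombination_injective)
  have hlw : ∀ x ∈ Submodule.span k (Set.range w), x = ∑ i, l x i • w i := by
    intro x hx
    obtain ⟨t, rfl⟩ := (Submodule.mem_span_range_iff_exists_fun k).1 hx
    have := LinearMap.congr_fun hl t
    simp only [LinearMap.comp_apply, Fintype.linearCombination_apply, LinearMap.id_apply] at this
    rw [this]
  have hl' : ∀ i, l (w i) = Pi.single i 1 := by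
    intro i
    have := LinearMap.congr_fun hl (Pi.single i 1)
    simpa [Fintype.linearCombination_apply_single] using this
  have hW₀w : W₀ ≤ Submodule.span k (Set.range w) := by
    refine hspanb.ge.trans (Submodule.span_mono ?_)
    rintro _ ⟨i, rfl⟩
    exact ⟨i.succ, by simp [w]⟩
  have hfw : f ∈ Submodule.span k (Set.range w) := Submodule.subset_span ⟨0, by simp [w]⟩
  have hl0 : ∀ x ∈ W₀, l x 0 = 0 := by
    intro x hx
    rw [← hspanb] at hx
    obtain ⟨t, rfl⟩ := (Submodule.mem_span_range_iff_exists_fun k).1 hx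
    have : ∀ i, l (b i : A) 0 = 0 := fun i => by
      have := congrFun (hl' i.succ) 0
      simpa [w] using this
    simp [this]
  have hWw : W ≤ Submodule.span k (Set.range w) := by
    refine Submodule.span_le.2 ?_
    rintro _ ⟨h, rfl⟩
    have : α h f - f ∈ W₀ := ⟨sub_mem (hWα h f hfW) hfW, hinv h⟩
    simpa using add_mem (hW₀w this) hfw
  have hwW : ∀ j, w j ∈ W := by
    refine Fin.cases (by simpa [w] using hfW) fun i => ?_
    simpa [w] using (b i).2.1
  let B : Γ → Matrix (Fin (Module.finrank k W₀ + 1)) (Fin (Module.finrank k W₀ + 1)) k :=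
    fun h => Matrix.of fun j i => l (α h (w j)) i
  have hB : ∀ h j, α h (w j) = ∑ i, B h j i • w i := fun h j => hlw _ (hWw (hWα h _ (hwW j)))
  let ρ : Γ →* Matrix (Fin (Module.finrank k W₀ + 1)) (Fin (Module.finrank k W₀ + 1)) k :=
    { toFun := B
      map_one' := by
        ext j i
        simp [B, hα.map_one, hl', Matrix.one_apply, Pi.single_apply, eq_comm]
      map_mul' := by
        intro g h
        ext j i
        have : B (g * h) j i = l (α h (α g (w j))) i := by
          simp [B, hα.map_mul]
        rw [this, hB g j]
        simp [Matrix.mul_apply, B] }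
  have hρR : ∀ j i, (fun g => ρ g j i) ∈ R := by
    intro j i
    suffices ∀ x ∈ W, (fun g => l (α g x) i) ∈ R from this _ (hwW j)
    intro x hx
    induction hx using Submodule.span_induction with
    | mem x hx =>
      obtain ⟨g, rfl⟩ := hx
      have : (fun h => l (α h (α g f)) i) = ∑ s, l (a s) i • fun h => c s (g * h) := by
        funext h
        rw [show α h (α g f) = α (g * h) f by simp [hα.map_mul], hca]
        simp [mul_comm]
      rw [this]
      exact sum_mem fun s _ => Subalgebra.smul_mem _ (hR _ (hc s) g) _
    | zero =>
      simp only [map_zero, Pi.zero_apply]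
      exact zero_mem R
    | add x y _ _ hx hy =>
      simp only [map_add, Pi.add_apply]
      exact add_mem hx hy
    | smul t x _ hx =>
      simp only [map_smul, Pi.smul_apply]
      exact Subalgebra.smul_mem R hx t
  obtain ⟨d, P, hd, hP, hPe, hPi⟩ := hgr _ ρ hρR (Pi.single 0 1)
    (by simp) (fun h => by
      ext j
      rw [Matrix.mulVec_single_one]
      show l (α h (w j)) 0 = _
      refine Fin.cases ?_ (fun i => ?_) j
      · have h1 : α h f - f ∈ W₀ := ⟨sub_mem (hWα h f hfW) hfW, hinv h⟩
        have h2 := hl0 _ h1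
        have h3 : l f 0 = 1 := by simpa [w] using congrFun (hl' 0) 0
        simp only [map_sub, Pi.sub_apply, h3] at h2
        simpa [w] using sub_eq_zero.1 h2
      · have h1 : α h (b i : A) ∈ W₀ := ⟨hWα h _ (b i).2.1, hJ h _ (b i).2.2⟩
        simpa [w] using hl0 _ h1)
  have hlin : ∀ h, linSub (ρ h) P = P := fun h => MvPolynomial.funext fun x => by
    rw [eval_linSub, hPi]
  refine ⟨d, (eval (Pi.single 0 1) P)⁻¹ • aeval w P, hd, fun h => ?_, ?_⟩
  · rw [map_smul]
    congr 1
    rw [← AlgHom.comp_apply, comp_aeval, aeval_linSub (ρ h) w _ (hB h), hlin]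
  · have h1 : aeval w P - aeval (fun i => (Pi.single 0 1 : _ → k) i • f) P ∈ J := by
      rw [← Ideal.Quotient.eq_zero_iff_mem, map_sub, sub_eq_zero]
      have : ∀ v : _ → A, Ideal.Quotient.mk J (aeval v P) =
          aeval (fun i => Ideal.Quotient.mk J (v i)) P := fun v => by
        rw [← Ideal.Quotient.mkₐ_eq_mk k, ← AlgHom.comp_apply, comp_aeval]
      rw [this, this]
      congr 2
      funext j
      refine Fin.cases (by simp [w]) (fun i => ?_) j
      simp only [w, Fin.cons_succ]
      rw [Ideal.Quotient.eq_zero_iff_mem.2 (b i).2.2]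
      simp
    have h2 : aeval (fun i => (Pi.single 0 1 : _ → k) i • f) P = eval (Pi.single 0 1) P • f ^ d :=
      aeval_smul_of_isHomogeneous hP _ _
    rw [h2] at h1
    have h3 := J.mul_mem_left (algebraMap k A (eval (Pi.single 0 1) P)⁻¹) h1
    rwa [← Algebra.smul_def, smul_sub, smul_smul, inv_mul_cancel₀ hPe, one_smul] at h3

end reynolds

theorem fg_of_fg_of_forall_isIntegral {k : Type*} [Field k] {Q : Type*} [CommRing Q] [Algebra k Q]
    {C B : Subalgebra k Q} (hCB : C ≤ B) (hB : B.FG) (hint : ∀ b ∈ B, IsIntegral C b) :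
    C.FG ∧ ∃ s : Finset Q, (s : Set Q) ⊆ B ∧ ∀ b ∈ B, b ∈ Submodule.span C (s : Set Q) := by
  letI : Algebra C B := (Subalgebra.inclusion hCB).toAlgebra
  have : IsScalarTower k C B := IsScalarTower.of_algebraMap_eq fun _ => rfl
  have : IsScalarTower C B Q := IsScalarTower.of_algebraMap_eq fun _ => rfl
  have hft : Algebra.FiniteType k B := (Subalgebra.fg_iff_finiteType B).1 hB
  have hft' : Algebra.FiniteType C B := Algebra.FiniteType.of_restrictScalars_finiteType k C B
  have hI : Algebra.IsIntegral C B := ⟨fun b =>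
    (isIntegral_algHom_iff (IsScalarTower.toAlgHom C B Q) Subtype.val_injective).1 (hint b b.2)⟩
  have hfin : Module.Finite C B := Algebra.IsIntegral.finite
  have hfg : (⊤ : Subalgebra k C).FG :=
    fg_of_fg_of_fg k C B hft.out hfin.fg_top (Subalgebra.inclusion_injective hCB)
  refine ⟨(Subalgebra.fg_top C).1 hfg, ?_⟩
  classical
  obtain ⟨s, hs⟩ := hfin.fg_top
  refine ⟨s.image Subtype.val, fun x hx => by
    obtain ⟨y, _, rfl⟩ := Finset.mem_image.1 hx
    exact y.2, fun b hb => ?_⟩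
  have h1 : (⟨b, hb⟩ : B) ∈ Submodule.span C (s : Set B) := hs ▸ Submodule.mem_top
  have h2 := Submodule.mem_map_of_mem (f := (IsScalarTower.toAlgHom C B Q).toLinearMap) h1
  rw [Submodule.map_span] at h2
  rw [Finset.coe_image]
  exact h2

section invMod

variable {k : Type} [Field k] {Γ : Type} [Group Γ] {A : Type} [CommRing A] [Algebra k A]

/-- The elements invariant modulo an ideal. -/
def invMod (α : Γ → A →ₐ[k] A) (J : Ideal A) (hJ : ∀ h, ∀ x ∈ J, α h x ∈ J) : Subalgebra k A where
  carrier := {x | ∀ h, α h x - x ∈ J}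
  mul_mem' := fun {x y} hx hy h => by
    have : α h (x * y) - x * y = α h x * (α h y - y) + y * (α h x - x) := by
      rw [map_mul]; ring
    rw [this]
    exact add_mem (J.mul_mem_left _ (hy h)) (J.mul_mem_left _ (hx h))
  add_mem' := fun {x y} hx hy h => by
    have : α h (x + y) - (x + y) = (α h x - x) + (α h y - y) := by
      rw [map_add]; ring
    rw [this]
    exact add_mem (hx h) (hy h)
  algebraMap_mem' := fun r h => by simp

variable {α : Γ → A →ₐ[k] A} {J J' : Ideal A} {hJ : ∀ h, ∀ x ∈ J, α h x ∈ J}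
  {hJ' : ∀ h, ∀ x ∈ J', α h x ∈ J'}

theorem mem_invMod_of_mem {x : A} (hx : x ∈ J) : x ∈ invMod α J hJ :=
  fun h => sub_mem (hJ h x hx) hx

theorem invMod_mono (hle : J ≤ J') : invMod α J hJ ≤ invMod α J' hJ' :=
  fun _ hx h => hle (hx h)

theorem exists_invMod_sub_pow_mem [Infinite k] {R : Subalgebra k (Γ → k)} (hgr : IsGeomReductive R)
    (hR : ∀ c ∈ R, ∀ g, (fun h => c (g * h)) ∈ R) (hα : IsRightAction α)
    (hJJ' : J ≤ J') {f : A} (hf : IsRationalElt R α f) (hinv : f ∈ invMod α J' hJ') :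
    ∃ (d : ℕ) (F : A), 0 < d ∧ F ∈ invMod α J hJ ∧ F - f ^ d ∈ J' := by
  let q := Ideal.Quotient.mkₐ k J
  have hq : ∀ x, q x = 0 ↔ x ∈ J := fun x => Ideal.Quotient.eq_zero_iff_mem
  let β : Γ → (A ⧸ J) →ₐ[k] (A ⧸ J) := fun h => Ideal.quotientMapₐ J (α h) fun x hx => hJ h x hx
  have hβ : ∀ h x, β h (q x) = q (α h x) := fun h x => rfl
  have hsurj : Function.Surjective q := Ideal.Quotient.mk_surjective
  have hβact : IsRightAction β := by
    refine ⟨AlgHom.ext fun x => ?_, fun g h => AlgHom.ext fun x => ?_⟩ <;>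
      obtain ⟨x, rfl⟩ := hsurj x
    · simp [hβ, hα.map_one]
    · simp [hβ, hα.map_mul]
  have hmem : ∀ x, q x ∈ J'.map (Ideal.Quotient.mk J) ↔ x ∈ J' := fun x => by
    rw [show q x = Ideal.Quotient.mk J x from rfl, Ideal.mem_quotient_iff_mem hJJ']
  obtain ⟨d, F, hd, hF, hFf⟩ := exists_invariant_sub_pow_mem hgr hR hβact
    (J'.map (Ideal.Quotient.mk J)) (fun h x hx => by
      obtain ⟨x, rfl⟩ := hsurj x
      rw [hβ, hmem]
      exact hJ' h x ((hmem x).1 hx)) (f := q f) (by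
      obtain ⟨ι, i, c, a, hc, ha⟩ := hf
      refine ⟨ι, i, c, fun i => q (a i), hc, fun h => ?_⟩
      rw [hβ, ha, map_sum]
      simp) (fun h => by
      rw [hβ, ← map_sub, hmem]
      exact hinv h)
  obtain ⟨F, rfl⟩ := hsurj F
  refine ⟨d, F, hd, fun h => ?_, ?_⟩
  · rw [← hq, map_sub, ← hβ, hF, sub_self]
  · rwa [← map_pow, ← map_sub, hmem] at hFf

/-- The invariants modulo `J` are finitely generated modulo `J`. -/
def InvFG (α : Γ → A →ₐ[k] A) (J : Ideal A) (hJ : ∀ h, ∀ x ∈ J, α h x ∈ J) : Prop :=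
  ∃ T : Finset A, (T : Set A) ⊆ invMod α J hJ ∧
    ∀ x ∈ invMod α J hJ, ∃ y ∈ Algebra.adjoin k (T : Set A), x - y ∈ J

theorem exists_lift_of_invFG [Infinite k] {R : Subalgebra k (Γ → k)} (hgr : IsGeomReductive R)
    (hR : ∀ c ∈ R, ∀ g, (fun h => c (g * h)) ∈ R) (hα : IsRightAction α)
    (hrat : ∀ f, IsRationalElt R α f) (hJJ' : J ≤ J') (hfg : InvFG α J' hJ') :
    ∃ T S : Finset A, (T : Set A) ⊆ invMod α J hJ ∧ (S : Set A) ⊆ invMod α J' hJ' ∧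
      (∀ x ∈ invMod α J hJ, ∃ y ∈ Algebra.adjoin k (T : Set A), x - y ∈ J') ∧
      ∀ x ∈ invMod α J' hJ', ∃ y : A → A, (∀ s, y s ∈ Algebra.adjoin k (T : Set A)) ∧
        x - ∑ s ∈ S, y s * s ∈ J' := by
  classical
  let q := Ideal.Quotient.mkₐ k J'
  have hq : ∀ x y, q x = q y ↔ x - y ∈ J' := fun x y => Ideal.Quotient.eq
  let B := (invMod α J' hJ').map q
  let C := (invMod α J hJ).map q
  have hCB : C ≤ B := Subalgebra.map_mono (invMod_mono hJJ')
  have hB : B.FG := by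
    obtain ⟨T, hT, hTx⟩ := hfg
    refine ⟨T.image q, le_antisymm ?_ ?_⟩
    · rw [Finset.coe_image, Algebra.adjoin_le_iff]
      rintro _ ⟨x, hx, rfl⟩
      exact ⟨x, hT hx, rfl⟩
    · rintro _ ⟨x, hx, rfl⟩
      obtain ⟨y, hy, hxy⟩ := hTx x hx
      rw [Finset.coe_image, ← AlgHom.map_adjoin]
      exact ⟨y, hy, ((hq x y).2 hxy).symm⟩
  have hint : ∀ b ∈ B, IsIntegral C b := by
    rintro _ ⟨x, hx, rfl⟩
    obtain ⟨d, F, hd, hF, hFx⟩ := exists_invMod_sub_pow_mem (hJ := hJ) hgr hR hα hJJ' (hrat x) hx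
    refine IsIntegral.of_pow hd ?_
    have : q x ^ d = algebraMap C (A ⧸ J') ⟨q F, F, hF, rfl⟩ := by
      rw [← map_pow]
      exact ((hq _ _).2 hFx).symm
    exact this ▸ isIntegral_algebraMap
  obtain ⟨⟨t, ht⟩, s, hsB, hs⟩ := fg_of_fg_of_forall_isIntegral hCB hB hint
  have hl : ∀ D : Subalgebra k A, ∀ t : Finset (A ⧸ J'), (t : Set (A ⧸ J')) ⊆ D.map q →
      ∃ T : Finset A, (T : Set A) ⊆ D ∧ T.image q = t := by
    intro D t ht
    obtain ⟨T, hT, hTt⟩ := Finset.subset_set_image_iff.1 (show (t : Set (A ⧸ J')) ⊆ q '' (D : Set A) from ht)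
    exact ⟨T, hT, hTt⟩
  obtain ⟨T, hT, rfl⟩ := hl _ t (by
    have := Algebra.subset_adjoin (R := k) (s := (t : Set (A ⧸ J')))
    rwa [ht] at this)
  obtain ⟨S, hS, rfl⟩ := hl _ s hsB
  have hTC : (Algebra.adjoin k (T : Set A)).map q = C := by
    rw [AlgHom.map_adjoin, ← Finset.coe_image, ht]
  refine ⟨T, S, hT, hS, fun x hx => ?_, fun x hx => ?_⟩
  · have : q x ∈ (Algebra.adjoin k (T : Set A)).map q := hTC ▸ ⟨x, hx, rfl⟩
    obtain ⟨y, hy, hxy⟩ := this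
    exact ⟨y, hy, (hq x y).1 hxy.symm⟩
  · have h1 := hs (q x) ⟨x, hx, rfl⟩
    rw [Finset.coe_image] at h1
    have : ∀ z ∈ Submodule.span C (q '' (S : Set A)), ∃ y : A → A,
        (∀ s, y s ∈ Algebra.adjoin k (T : Set A)) ∧ z = q (∑ s ∈ S, y s * s) := by
      intro z hz
      induction hz using Submodule.span_induction with
      | mem z hz =>
        obtain ⟨s, hs, rfl⟩ := hz
        refine ⟨Pi.single s 1, fun i => ?_, ?_⟩
        · rw [Pi.single_apply]
          split_ifs
          exacts [one_mem _, zero_mem _]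
        · simp [Pi.single_apply, Finset.mem_coe.1 hs]
      | zero => exact ⟨0, fun _ => zero_mem _, by simp⟩
      | add z z' _ _ h h' =>
        obtain ⟨y, hy, rfl⟩ := h
        obtain ⟨y', hy', rfl⟩ := h'
        exact ⟨y + y', fun s => add_mem (hy s) (hy' s), by
          simp [add_mul, Finset.sum_add_distrib]⟩
      | smul c z _ h =>
        obtain ⟨y, hy, rfl⟩ := h
        obtain ⟨c, hcC⟩ := c
        obtain ⟨c, hc, rfl⟩ := hTC.ge hcC
        refine ⟨fun s => c * y s, fun s => mul_mem hc (hy s), ?_⟩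
        simp only [mul_assoc, ← Finset.mul_sum, map_mul]
        rfl
    obtain ⟨y, hy, hxy⟩ := this _ h1
    exact ⟨y, hy, (hq _ _).1 hxy⟩

end invMod

section graded

variable {k : Type} [Field k] {σ : Type}

theorem homogeneousComponent_mul_of_isHomogeneous {f : MvPolynomial σ k} {d : ℕ}
    (hf : f.IsHomogeneous d) (a : MvPolynomial σ k) (e : ℕ) :
    homogeneousComponent e (f * a) =
      if d ≤ e then f * homogeneousComponent (e - d) a else 0 := by
  conv_lhs => rw [← sum_homogeneousComponent a]
  rw [Finset.mul_sum, map_sum]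
  have : ∀ i, homogeneousComponent e (f * homogeneousComponent i a) =
      if d + i = e then f * homogeneousComponent i a else 0 := fun i => by
    rw [homogeneousComponent_of_mem (hf.mul (homogeneousComponent_isHomogeneous i a))]
    simp only [eq_comm]
  simp only [this]
  split_ifs with hde
  · have h2 : ∀ i, d + i = e ↔ i = e - d := fun i => by omega
    simp only [h2, Finset.sum_ite_eq', Finset.mem_range]
    split_ifs with h3
    · rfl
    · rw [homogeneousComponent_eq_zero _ _ (by omega), mul_zero]
  · exact Finset.sum_eq_zero fun i _ => if_neg (by omega)

theorem homogeneousComponent_mem_adjoin {T : Set (MvPolynomial σ k)}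
    (hT : ∀ x ∈ T, ∀ e, homogeneousComponent e x ∈ Algebra.adjoin k T) {x : MvPolynomial σ k}
    (hx : x ∈ Algebra.adjoin k T) (e : ℕ) : homogeneousComponent e x ∈ Algebra.adjoin k T := by
  induction hx using Algebra.adjoin_induction generalizing e with
  | mem x hx => exact hT x hx e
  | algebraMap r =>
    rw [algebraMap_eq, homogeneousComponent_of_mem (isHomogeneous_C σ r)]
    split_ifs
    exacts [Subalgebra.algebraMap_mem _ r, zero_mem _]
  | add x y _ _ hx hy => simpa using add_mem (hx e) (hy e)
  | mul x y _ _ hx hy =>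
    rw [← sum_homogeneousComponent x, Finset.sum_mul, map_sum]
    refine sum_mem fun i _ => ?_
    rw [homogeneousComponent_mul_of_isHomogeneous (homogeneousComponent_isHomogeneous i x)]
    split_ifs
    exacts [mul_mem (hx i) (hy _), zero_mem _]

/-- An ideal containing the homogeneous components of its elements. -/
def IsGradedIdeal (J : Ideal (MvPolynomial σ k)) : Prop :=
  ∀ x ∈ J, ∀ e, homogeneousComponent e x ∈ J

variable {Γ : Type} [Group Γ] {α : Γ → MvPolynomial σ k →ₐ[k] MvPolynomial σ k}

theorem homogeneousComponent_mem_invMod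
    (hdeg : ∀ h e x, homogeneousComponent e (α h x) = α h (homogeneousComponent e x))
    {J : Ideal (MvPolynomial σ k)} {hJ : ∀ h, ∀ x ∈ J, α h x ∈ J} (hgr : IsGradedIdeal J)
    {x : MvPolynomial σ k} (hx : x ∈ invMod α J hJ) (e : ℕ) :
    homogeneousComponent e x ∈ invMod α J hJ := fun h => by
  rw [← hdeg, ← map_sub]
  exact hgr _ (hx h) e

theorem mul_sub_mem_of_mem_invMod {A : Type} [CommRing A] [Algebra k A] {α : Γ → A →ₐ[k] A}
    {J : Ideal A} {hJ : ∀ h, ∀ x ∈ J, α h x ∈ J} {f : A} (hf : f ∈ invMod α J hJ) (a : A) (h : Γ) :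
    (α h (f * a) - f * a) - f * (α h a - a) ∈ J := by
  have : (α h (f * a) - f * a) - f * (α h a - a) = α h a * (α h f - f) := by
    rw [map_mul]; ring
  rw [this]
  exact J.mul_mem_left _ (hf h)

variable [Finite σ] [Infinite k] {R : Subalgebra k (Γ → k)}

theorem invFG_of_isGradedIdeal (hgr : IsGeomReductive R)
    (hR : ∀ c ∈ R, ∀ g, (fun h => c (g * h)) ∈ R) (hα : IsRightAction α)
    (hrat : ∀ f, IsRationalElt R α f)
    (hdeg : ∀ h e x, homogeneousComponent e (α h x) = α h (homogeneousComponent e x))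
    (J : Ideal (MvPolynomial σ k)) :
    ∀ (hJ : ∀ h, ∀ x ∈ J, α h x ∈ J), IsGradedIdeal J → InvFG α J hJ := by
  classical
  induction J using IsNoetherian.induction with | _ J ih
  intro hJ hJgr
  by_cases htriv : ∀ d f, 0 < d → IsHomogeneous f d → f ∈ invMod α J hJ → f ∈ J
  · refine ⟨∅, by simp, fun x hx => ⟨homogeneousComponent 0 x, ?_, ?_⟩⟩
    · rw [homogeneousComponent_zero]
      exact Subalgebra.algebraMap_mem _ _
    · have hs := sum_homogeneousComponent x
      rw [Finset.sum_range_succ', ← eq_sub_iff_add_eq] at hs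
      rw [← hs]
      exact sum_mem fun i _ => htriv (i + 1) _ i.succ_pos (homogeneousComponent_isHomogeneous _ _)
        (homogeneousComponent_mem_invMod hdeg hJgr hx _)
  push Not at htriv
  obtain ⟨d, f, hd, hfd, hfinv, hfJ⟩ := htriv
  let J' : Ideal (MvPolynomial σ k) := J ⊔ Ideal.span {f}
  have hfJ' : f ∈ J' := Ideal.mem_sup_right (Ideal.mem_span_singleton_self f)
  have hmemJ' : ∀ x, x ∈ J' ↔ ∃ a, x - f * a ∈ J := by
    intro x
    constructor
    · intro hx
      obtain ⟨j, hj, y, hy, rfl⟩ := Submodule.mem_sup.1 hx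
      obtain ⟨a, rfl⟩ := Ideal.mem_span_singleton'.1 hy
      exact ⟨a, by rwa [mul_comm a f, add_sub_cancel_right]⟩
    · rintro ⟨a, ha⟩
      rw [← sub_add_cancel x (f * a)]
      exact add_mem (Ideal.mem_sup_left ha) (J'.mul_mem_right _ hfJ')
  have hJJ' : J ≤ J' := le_sup_left
  have hlt : J < J' := lt_of_le_of_ne hJJ' fun h => hfJ (h ▸ hfJ')
  have hJ' : ∀ h, ∀ x ∈ J', α h x ∈ J' := by
    intro h x hx
    obtain ⟨a, ha⟩ := (hmemJ' x).1 hx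
    refine (hmemJ' _).2 ⟨α h a, ?_⟩
    have : α h x - f * α h a = α h (x - f * a) + α h a * (α h f - f) := by
      rw [map_sub, map_mul]; ring
    rw [this]
    exact add_mem (hJ h _ ha) (Ideal.mul_mem_left J _ (hfinv h))
  have hJ'gr : IsGradedIdeal J' := by
    intro x hx e
    obtain ⟨a, ha⟩ := (hmemJ' x).1 hx
    have h1 := hJgr _ ha e
    rw [map_sub, homogeneousComponent_mul_of_isHomogeneous hfd] at h1
    refine (hmemJ' _).2 ?_
    split_ifs at h1
    exacts [⟨_, h1⟩, ⟨0, by simpa using h1⟩]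
  obtain ⟨T₁, -, hT₁, -, hT₁x, -⟩ :=
    exists_lift_of_invFG (hJ := hJ) hgr hR hα hrat hJJ' (ih J' hlt hJ' hJ'gr)
  let I : Ideal (MvPolynomial σ k) := Submodule.comap (LinearMap.mulLeft _ f) J
  have hmemI : ∀ x, x ∈ I ↔ f * x ∈ J := fun x => Iff.rfl
  have hJI : J ≤ I := fun x hx => Ideal.mul_mem_left J f hx
  have hI : ∀ h, ∀ x ∈ I, α h x ∈ I := by
    intro h x hx
    have : f * α h x = α h (f * x) - α h x * (α h f - f) := by
      rw [map_mul]; ring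
    rw [hmemI, this]
    exact sub_mem (hJ h _ hx) (Ideal.mul_mem_left J _ (hfinv h))
  have hIgr : IsGradedIdeal I := by
    intro x hx e
    have h1 := hJgr _ hx (d + e)
    rw [LinearMap.mulLeft_apply, homogeneousComponent_mul_of_isHomogeneous hfd,
      if_pos (by omega), Nat.add_sub_cancel_left] at h1
    exact h1
  have hfmul : ∀ a, f * a ∈ invMod α J hJ ↔ a ∈ invMod α I hI := by
    intro a
    refine forall_congr' fun h => ?_
    rw [hmemI]
    exact ⟨fun h1 => (Submodule.sub_mem_iff_right _ h1).1 (mul_sub_mem_of_mem_invMod hfinv a h),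
      fun h1 => (Submodule.sub_mem_iff_left _ h1).1 (mul_sub_mem_of_mem_invMod hfinv a h)⟩
  by_cases hIJ : I = J
  · let T : Finset (MvPolynomial σ k) := insert f (T₁.biUnion fun x =>
      (Finset.range (x.totalDegree + 1)).image fun e => homogeneousComponent e x)
    have hTc : ∀ x ∈ T₁, ∀ e, homogeneousComponent e x ∈ Algebra.adjoin k (T : Set (MvPolynomial σ k)) := by
      intro x hx e
      by_cases he : e < x.totalDegree + 1
      · refine Algebra.subset_adjoin (Finset.mem_coe.2 (Finset.mem_insert_of_mem ?_))
        exact Finset.mem_biUnion.2 ⟨x, hx, Finset.mem_image.2 ⟨e, Finset.mem_range.2 he, rfl⟩⟩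
      · rw [homogeneousComponent_eq_zero _ _ (by omega)]
        exact zero_mem _
    have hfT : f ∈ Algebra.adjoin k (T : Set (MvPolynomial σ k)) :=
      Algebra.subset_adjoin (Finset.mem_coe.2 (Finset.mem_insert_self _ _))
    have hTgr : ∀ x ∈ (T : Set (MvPolynomial σ k)), ∀ e, homogeneousComponent e x ∈ Algebra.adjoin k (T : Set (MvPolynomial σ k)) := by
      intro x hx e
      obtain rfl | hx := Finset.mem_insert.1 (Finset.mem_coe.1 hx)
      · rw [homogeneousComponent_of_mem hfd]
        split_ifs
        exacts [hfT, zero_mem _]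
      · obtain ⟨y, hy, hx⟩ := Finset.mem_biUnion.1 hx
        obtain ⟨i, -, rfl⟩ := Finset.mem_image.1 hx
        rw [homogeneousComponent_of_mem (homogeneousComponent_isHomogeneous i y)]
        split_ifs
        exacts [hTc y hy i, zero_mem _]
    have hT₁T : Algebra.adjoin k (T₁ : Set (MvPolynomial σ k)) ≤ Algebra.adjoin k (T : Set (MvPolynomial σ k)) := by
      refine Algebra.adjoin_le fun x hx => ?_
      rw [← sum_homogeneousComponent x]
      exact sum_mem fun i _ => hTc x hx i
    have key : ∀ e, ∀ x, IsHomogeneous x e → x ∈ invMod α J hJ →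
        ∃ y ∈ Algebra.adjoin k (T : Set (MvPolynomial σ k)), x - y ∈ J := by
      intro e
      induction e using Nat.strong_induction_on with | _ e ihe
      intro x hxe hx
      obtain ⟨y, hy, hxy⟩ := hT₁x x hx
      obtain ⟨a, ha⟩ := (hmemJ' _).1 hxy
      have h1 := hJgr _ ha e
      have h2 : homogeneousComponent e y ∈ Algebra.adjoin k (T : Set (MvPolynomial σ k)) :=
        homogeneousComponent_mem_adjoin hTgr (hT₁T hy) e
      rw [map_sub, map_sub, homogeneousComponent_of_mem hxe, if_pos rfl,
        homogeneousComponent_mul_of_isHomogeneous hfd] at h1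
      split_ifs at h1 with hde
      · have hyinv : homogeneousComponent e y ∈ invMod α J hJ := homogeneousComponent_mem_invMod
          hdeg hJgr (Algebra.adjoin_le (S := invMod α J hJ) hT₁ hy) e
        have h3 : f * homogeneousComponent (e - d) a ∈ invMod α J hJ := by
          have := sub_mem (sub_mem hx hyinv) (mem_invMod_of_mem (hJ := hJ) h1)
          rwa [sub_sub_cancel] at this
        have h4 : homogeneousComponent (e - d) a ∈ invMod α J hJ := by
          intro h
          have := (hfmul _).1 h3 h
          rwa [hIJ] at this
        obtain ⟨z, hz, hza⟩ := ihe (e - d) (by omega) _ (homogeneousComponent_isHomogeneous _ _) h4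
        refine ⟨homogeneousComponent e y + f * z, add_mem h2 (mul_mem hfT hz), ?_⟩
        convert add_mem h1 (Ideal.mul_mem_left J f hza) using 1
        ring
      · exact ⟨_, h2, by simpa using h1⟩
    refine ⟨T, fun x hx => ?_, fun x hx => ?_⟩
    · obtain rfl | hx := Finset.mem_insert.1 (Finset.mem_coe.1 hx)
      · exact hfinv
      · obtain ⟨y, hy, hx⟩ := Finset.mem_biUnion.1 hx
        obtain ⟨i, -, rfl⟩ := Finset.mem_image.1 hx
        exact homogeneousComponent_mem_invMod hdeg hJgr (hT₁ hy) i
    · choose y hy hyx using fun e => key e _ (homogeneousComponent_isHomogeneous e x)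
        (homogeneousComponent_mem_invMod hdeg hJgr hx e)
      refine ⟨∑ i ∈ Finset.range (x.totalDegree + 1), y i, sum_mem fun i _ => hy i, ?_⟩
      have hs := Finset.sum_sub_distrib (s := Finset.range (x.totalDegree + 1))
        (fun i => homogeneousComponent i x) y
      rw [sum_homogeneousComponent] at hs
      rw [← hs]
      exact sum_mem fun i _ => hyx i
  · obtain ⟨T₂, S, hT₂, hS, -, hSx⟩ := exists_lift_of_invFG (hJ := hJ) hgr hR hα hrat hJI
      (ih I (lt_of_le_of_ne hJI (Ne.symm hIJ)) hI hIgr)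
    let T : Finset (MvPolynomial σ k) := T₁ ∪ T₂ ∪ S.image fun s => f * s
    have hT : (T : Set (MvPolynomial σ k)) ⊆ invMod α J hJ := by
      intro x hx
      simp only [T, Finset.coe_union, Finset.coe_image] at hx
      obtain (hx | hx) | ⟨s, hs, rfl⟩ := hx
      exacts [hT₁ hx, hT₂ hx, (hfmul s).2 (hS hs)]
    have hT₁T : Algebra.adjoin k (T₁ : Set (MvPolynomial σ k)) ≤ Algebra.adjoin k (T : Set (MvPolynomial σ k)) :=
      Algebra.adjoin_mono fun x hx => by simp [T, Finset.mem_coe.1 hx]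
    have hT₂T : Algebra.adjoin k (T₂ : Set (MvPolynomial σ k)) ≤ Algebra.adjoin k (T : Set (MvPolynomial σ k)) :=
      Algebra.adjoin_mono fun x hx => by simp [T, Finset.mem_coe.1 hx]
    refine ⟨T, hT, fun x hx => ?_⟩
    obtain ⟨y, hy, hxy⟩ := hT₁x x hx
    obtain ⟨a, ha⟩ := (hmemJ' _).1 hxy
    have h3 : f * a ∈ invMod α J hJ := by
      have := sub_mem (sub_mem hx (Algebra.adjoin_le (S := invMod α J hJ) hT₁ hy))
        (mem_invMod_of_mem (hJ := hJ) ha)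
      rwa [sub_sub_cancel] at this
    obtain ⟨c, hc, hca⟩ := hSx a ((hfmul a).1 h3)
    refine ⟨y + ∑ s ∈ S, c s * (f * s), add_mem (hT₁T hy) (sum_mem fun s hs =>
      mul_mem (hT₂T (hc s)) (Algebra.subset_adjoin ?_)), ?_⟩
    · simp only [T, Finset.coe_union, Finset.coe_image]
      exact Or.inr ⟨s, hs, rfl⟩
    · have h4 : f * (a - ∑ s ∈ S, c s * s) ∈ J := hca
      convert add_mem ha h4 using 1
      rw [mul_sub, Finset.mul_sum]
      simp only [mul_left_comm f]
      ring

end graded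

section linAction

variable {k : Type} [Field k] [Infinite k] {Γ : Type} [Group Γ] {σ : Type} [Fintype σ]

theorem homogeneousComponent_linSub (B : Matrix σ σ k) (e : ℕ) (p : MvPolynomial σ k) :
    homogeneousComponent e (linSub B p) = linSub B (homogeneousComponent e p) := by
  conv_lhs => rw [← sum_homogeneousComponent p]
  rw [map_sum, map_sum]
  have : ∀ i, homogeneousComponent e (linSub B (homogeneousComponent i p)) =
      if e = i then linSub B (homogeneousComponent i p) else 0 := fun i =>
    homogeneousComponent_of_mem (isHomogeneous_linSub B (homogeneousComponent_isHomogeneous i p))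
  simp only [this, Finset.sum_ite_eq, Finset.mem_range]
  split_ifs with h
  · rfl
  · rw [homogeneousComponent_eq_zero _ _ (by omega), map_zero]

variable [DecidableEq σ]

theorem isRightAction_linSub (ρ : Γ →* Matrix σ σ k) :
    IsRightAction fun h => linSub (ρ h) where
  map_one := AlgHom.ext fun p => MvPolynomial.funext fun x => by simp [eval_linSub]
  map_mul g h := AlgHom.ext fun p => MvPolynomial.funext fun x => by
    simp [eval_linSub, Matrix.mulVec_mulVec]

theorem isRationalElt_linSub {R : Subalgebra k (Γ → k)} (ρ : Γ →* Matrix σ σ k)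
    (hρ : ∀ i j, (fun h => ρ h i j) ∈ R) (p : MvPolynomial σ k) :
    IsRationalElt R (fun h => linSub (ρ h)) p := by
  refine isRationalElt_of_adjoin (s := Set.range X) ?_ (by rw [adjoin_range_X]; trivial)
  rintro _ ⟨i, rfl⟩
  exact ⟨σ, inferInstance, fun j h => ρ h i j, X, hρ i, fun h => by simp [linSub_X, smul_eq_C_mul]⟩

end linAction

section extRep

variable {k : Type} [Field k] {n : ℕ}

/-- The entries of a matrix, as a vector. -/
def entries (x : Mat k n) : Fin n × Fin n → k := fun ij => x ij.1 ij.2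

theorem mEval_eq_eval_entries (x : Mat k n) (p : MPoly k n) : mEval x p = eval (entries x) p := rfl

open scoped Kronecker in
/-- The action of `Γ` on `k^τ × Mat k n` by left multiplication on the second factor. -/
def extRep (τ : Type) [Fintype τ] [DecidableEq τ] (Γ : Subgroup (Mat k n)ˣ) :
    Γ →* Matrix (τ ⊕ Fin n × Fin n) (τ ⊕ Fin n × Fin n) k where
  toFun h := Matrix.fromBlocks 1 0 0 (incl Γ h ⊗ₖ (1 : Mat k n))
  map_one' := by simp [incl]
  map_mul' g h := by
    rw [Matrix.fromBlocks_multiply, incl_mul, ← Matrix.mul_kronecker_mul]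
    simp

variable {τ : Type} [Fintype τ] [DecidableEq τ] {Γ : Subgroup (Mat k n)ˣ}

theorem extRep_mulVec (h : Γ) (w : τ → k) (x : Mat k n) :
    (extRep τ Γ h).mulVec (Sum.elim w (entries x)) = Sum.elim w (entries (incl Γ h * x)) := by
  simp only [extRep, MonoidHom.coe_mk, OneHom.coe_mk, Matrix.fromBlocks_mulVec]
  congr 1
  · ext i; simp
  · ext ⟨i, j⟩
    simp [Matrix.mulVec, dotProduct, entries, Fintype.sum_prod_type, Matrix.mul_apply,
      Matrix.one_apply]

theorem extRep_mem_regFun (i j) : (fun h => extRep τ Γ h i j) ∈ regFun (incl Γ) := by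
  rw [mem_regFun]
  rcases i with i | i <;> rcases j with j | j
  · exact ⟨C ((1 : Matrix τ τ k) i j), fun h => by simp [extRep, mEval]⟩
  · exact ⟨0, fun h => by simp [extRep, mEval]⟩
  · exact ⟨0, fun h => by simp [extRep, mEval]⟩
  · exact ⟨X (i.1, j.1) * C ((1 : Mat k n) i.2 j.2), fun h => by simp [extRep, mEval]⟩

theorem translate_mem_regFun {c : Γ → k} (hc : c ∈ regFun (incl Γ)) (g : Γ) :
    (fun h => c (g * h)) ∈ regFun (incl Γ) := by
  obtain ⟨p, hp⟩ := (mem_regFun _).1 hc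
  exact (mem_regFun _).2 ⟨tsub (incl Γ g) 1 p, fun h => by
    rw [hp, mEval_tsub, incl_mul, mul_one]⟩

theorem eval_linSub_extRep (h : Γ) (w : τ → k) (x : Mat k n) (F) :
    eval (Sum.elim w (entries x)) (linSub (extRep τ Γ h) F) =
      eval (Sum.elim w (entries (incl Γ h * x))) F := by
  rw [eval_linSub, extRep_mulVec]

/-- The ideal of polynomials vanishing on a set of points. -/
def pointIdeal {σ : Type} (Z : Set (σ → k)) : Ideal (MvPolynomial σ k) where
  carrier := {p | ∀ z ∈ Z, eval z p = 0}
  add_mem' hp hq z hz := by rw [map_add, hp z hz, hq z hz, add_zero]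
  zero_mem' z _ := map_zero _
  smul_mem' c p hp z hz := by rw [smul_eq_mul, map_mul, hp z hz, mul_zero]

variable [Infinite k]

/-- A family of polynomials that is invariant on a stable set `Z` has a power that extends from
`Z` to an invariant family. -/
theorem exists_invariant_eq_pow (hgr : GeomReductive Γ) {M : Set (Mat k n)}
    (hM : ∀ h, ∀ m ∈ M, incl Γ h * m ∈ M) {Z : Set ((τ → k) × Mat k n)} (hZM : ∀ z ∈ Z, z.2 ∈ M)
    (hZ : ∀ h, ∀ z ∈ Z, (z.1, incl Γ h * z.2) ∈ Z) (F₀ : MvPolynomial (τ ⊕ Fin n × Fin n) k)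
    (hF₀ : ∀ h, ∀ z ∈ Z, eval (Sum.elim z.1 (entries (incl Γ h * z.2))) F₀ =
      eval (Sum.elim z.1 (entries z.2)) F₀) :
    ∃ (d : ℕ) (F : MvPolynomial (τ ⊕ Fin n × Fin n) k), 0 < d ∧
      (∀ h w, ∀ m ∈ M, eval (Sum.elim w (entries (incl Γ h * m))) F =
        eval (Sum.elim w (entries m)) F) ∧
      ∀ z ∈ Z, eval (Sum.elim z.1 (entries z.2)) F =
        eval (Sum.elim z.1 (entries z.2)) F₀ ^ d := by
  let pt : (τ → k) × Mat k n → (τ ⊕ Fin n × Fin n → k) := fun z => Sum.elim z.1 (entries z.2)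
  have hst : ∀ Y : Set ((τ → k) × Mat k n), (∀ h, ∀ z ∈ Y, (z.1, incl Γ h * z.2) ∈ Y) →
      ∀ h, ∀ p ∈ pointIdeal (pt '' Y), linSub (extRep τ Γ h) p ∈ pointIdeal (pt '' Y) := by
    rintro Y hY h p hp _ ⟨z, hz, rfl⟩
    rw [eval_linSub_extRep]
    exact hp _ ⟨_, hY h z hz, rfl⟩
  obtain ⟨d, F, hd, hF, hFF⟩ := exists_invMod_sub_pow_mem (R := regFun (incl Γ))
    (α := fun h => linSub (extRep τ Γ h))
    (J := pointIdeal (pt '' {z | z.2 ∈ M})) (J' := pointIdeal (pt '' Z))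
    (hJ := hst _ fun h z hz => hM h _ hz) (hJ' := hst _ hZ) hgr
    (fun c hc g => translate_mem_regFun hc g) (isRightAction_linSub _)
    (fun p hp z hz => hp z (Set.image_mono hZM hz))
    (isRationalElt_linSub _ extRep_mem_regFun F₀) (by
      rintro h _ ⟨z, hz, rfl⟩
      rw [map_sub, eval_linSub_extRep, hF₀ h z hz, sub_self])
  refine ⟨d, F, hd, fun h w m hm => ?_, fun z hz => ?_⟩
  · have := hF h _ ⟨(w, m), hm, rfl⟩
    rwa [map_sub, eval_linSub_extRep, sub_eq_zero] at this
  · have := hFF _ ⟨z, hz, rfl⟩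
    rwa [map_sub, map_pow, sub_eq_zero] at this

end extRep

section generators

variable {k : Type} [Field k] {n : ℕ} {Γ : Subgroup (Mat k n)ˣ}

theorem invariantOn_matSet {M : Set (Mat k n)} {p : MPoly k n} :
    InvariantOn (matSet Γ) M p ↔ ∀ h : Γ, ∀ m ∈ M, mEval (incl Γ h * m) p = mEval m p := by
  constructor
  · exact fun hp h => hp _ ⟨h, h.2, rfl⟩
  · rintro hp _ ⟨h, hh, rfl⟩
    exact hp ⟨h, hh⟩

variable [Infinite k]

theorem isGradedIdeal_pointIdeal {σ : Type} {Z : Set (σ → k)}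
    (hZ : ∀ (t : k), ∀ z ∈ Z, t • z ∈ Z) : IsGradedIdeal (pointIdeal Z) := by
  intro p hp e z hz
  have := eq_of_sum_mul_pow_eq (p.totalDegree + e + 1)
    (fun l => eval z (homogeneousComponent l p)) (fun _ => 0) (fun t => by
      rw [← sum_eval_homogeneousComponent p (by omega)]
      simpa using hp _ (hZ t z hz)) e (by omega)
  exact this

/-- The homogenization of a polynomial on matrices by one more variable. -/
noncomputable def homogenizeMat (p : MPoly k n) : MvPolynomial (Unit ⊕ Fin n × Fin n) k :=
  ∑ l ∈ Finset.range (p.totalDegree + 1),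
    X (Sum.inl ()) ^ (p.totalDegree - l) * rename Sum.inr (homogeneousComponent l p)

theorem eval_homogenizeMat (p : MPoly k n) (t : k) (m : Mat k n) :
    eval (Sum.elim (fun _ => t) (entries (t • m))) (homogenizeMat p) =
      t ^ p.totalDegree * mEval m p := by
  have h1 : mEval m p = ∑ l ∈ Finset.range (p.totalDegree + 1),
      eval (entries m) (homogeneousComponent l p) := by
    rw [← map_sum, sum_homogeneousComponent]
    rfl
  rw [homogenizeMat, map_sum, h1, Finset.mul_sum]
  refine Finset.sum_congr rfl fun l hl => ?_
  have hl : l ≤ p.totalDegree := by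
    rw [Finset.mem_range] at hl; omega
  rw [map_mul, map_pow, eval_X, eval_rename, Sum.elim_comp_inr, Sum.elim_inl,
    show entries (t • m) = t • entries m from rfl,
    eval_smul_of_isHomogeneous (homogeneousComponent_isHomogeneous l p), ← mul_assoc, ← pow_add,
    Nat.sub_add_cancel hl]

theorem exists_invariant_generators (hgr : GeomReductive Γ) {M : Set (Mat k n)}
    (hM : ∀ h, ∀ m ∈ M, incl Γ h * m ∈ M) :
    ∃ (r : ℕ) (f : Fin r → MPoly k n), (∀ i, InvariantOn (matSet Γ) M (f i)) ∧
      ∀ p : MPoly k n, InvariantOn (matSet Γ) M p →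
        ∃ q : QPoly r k, ∀ m ∈ M, mEval m p = qEval (quotMap f m) q := by
  let pt : k × Mat k n → (Unit ⊕ Fin n × Fin n → k) := fun z => Sum.elim (fun _ => z.1) (entries z.2)
  let Z : Set (k × Mat k n) := {z | ∃ m ∈ M, z.2 = z.1 • m}
  have hZ : ∀ h : Γ, ∀ z ∈ Z, (z.1, incl Γ h * z.2) ∈ Z := by
    rintro h z ⟨m, hm, hz⟩
    exact ⟨_, hM h m hm, by simp [hz]⟩
  have hst : ∀ h, ∀ p ∈ pointIdeal (pt '' Z), linSub (extRep Unit Γ h) p ∈ pointIdeal (pt '' Z) := by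
    rintro h p hp _ ⟨z, hz, rfl⟩
    rw [eval_linSub_extRep]
    exact hp _ ⟨_, hZ h z hz, rfl⟩
  have hgrad : IsGradedIdeal (pointIdeal (pt '' Z)) := by
    refine isGradedIdeal_pointIdeal ?_
    rintro t _ ⟨z, ⟨m, hm, hz⟩, rfl⟩
    refine ⟨(t * z.1, t • z.2), ⟨m, hm, by simp [hz, mul_smul]⟩, ?_⟩
    ext (i | i) <;> simp [pt, entries]
  obtain ⟨T, hT, hTx⟩ := invFG_of_isGradedIdeal (R := regFun (incl Γ)) hgr
    (fun c hc g => translate_mem_regFun hc g) (isRightAction_linSub (extRep Unit Γ))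
    (isRationalElt_linSub _ extRep_mem_regFun) (fun h e x => homogeneousComponent_linSub _ e x)
    _ hst hgrad
  let φ : MvPolynomial (Unit ⊕ Fin n × Fin n) k →ₐ[k] MPoly k n := aeval (Sum.elim 1 X)
  have hφ : ∀ P m, mEval m (φ P) = eval (pt (1, m)) P := by
    intro P m
    rw [mEval_eq_eval_entries, ← aeval_eq_eval, ← aeval_eq_eval, ← AlgHom.comp_apply, comp_aeval]
    congr 2
    ext (i | i) <;> simp [pt]
  have hZ1 : ∀ m ∈ M, (1, m) ∈ Z := fun m hm => ⟨m, hm, (one_smul _ _).symm⟩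
  let e := T.equivFin
  refine ⟨T.card, fun i => φ (e.symm i), fun i => ?_, fun p hp => ?_⟩
  · rw [invariantOn_matSet]
    intro h m hm
    have h1 := hT (e.symm i).2 h _ ⟨(1, m), hZ1 m hm, rfl⟩
    rw [map_sub, eval_linSub_extRep, sub_eq_zero] at h1
    rw [hφ, hφ]
    exact h1
  · rw [invariantOn_matSet] at hp
    obtain ⟨y, hy, hyp⟩ := hTx (homogenizeMat p) (by
      rintro h _ ⟨⟨t, x⟩, ⟨m, hm, hx⟩, rfl⟩
      obtain rfl : x = t • m := hx
      rw [map_sub, eval_linSub_extRep]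
      simp only [mul_smul_comm]
      rw [eval_homogenizeMat, eval_homogenizeMat, hp h m hm, sub_self])
    rw [show (T : Set (MvPolynomial (Unit ⊕ Fin n × Fin n) k)) =
      Set.range fun i => ((e.symm i : T) : MvPolynomial (Unit ⊕ Fin n × Fin n) k) by
        rw [show (fun i => ((e.symm i : T) : MvPolynomial (Unit ⊕ Fin n × Fin n) k)) =
          Subtype.val ∘ e.symm from rfl, Set.range_comp, e.symm.surjective.range_eq, Set.image_univ]
        simp, Algebra.adjoin_range_eq_range_aeval] at hy
    obtain ⟨q, rfl⟩ := hy
    refine ⟨q, fun m hm => ?_⟩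
    have h1 := hyp _ ⟨(1, m), hZ1 m hm, rfl⟩
    have h2 := eval_homogenizeMat p 1 m
    rw [one_smul, one_pow, one_mul] at h2
    rw [map_sub, sub_eq_zero] at h1
    rw [← h2]
    refine h1.trans ?_
    rw [← hφ, qEval, ← aeval_eq_eval, mEval_eq_eval_entries, ← aeval_eq_eval]
    refine DFunLike.congr_fun (?_ : ((aeval (entries m)).comp φ).comp (aeval _) = aeval _) q
    rw [comp_aeval]
    rfl

end generators

section tensor

theorem exists_eval_sumElim_eq {k : Type*} [CommSemiring k] {σ σ' : Type*}
    (F : MvPolynomial (σ ⊕ σ') k) :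
    ∃ (N : ℕ) (U : Fin N → MvPolynomial σ k) (V : Fin N → MvPolynomial σ' k),
      ∀ w z, eval (Sum.elim w z) F = ∑ l, eval w (U l) * eval z (V l) := by
  induction F using MvPolynomial.induction_on with
  | C a => exact ⟨1, fun _ => C a, fun _ => 1, fun w z => by simp⟩
  | add p q hp hq =>
    obtain ⟨N, U, V, h⟩ := hp
    obtain ⟨N', U', V', h'⟩ := hq
    refine ⟨N + N', Fin.append U U', Fin.append V V', fun w z => ?_⟩
    simp [h, h', Fin.sum_univ_add]
  | mul_X p i hp =>
    obtain ⟨N, U, V, h⟩ := hp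
    rcases i with i | i
    · refine ⟨N, fun l => U l * X i, V, fun w z => ?_⟩
      simp [h, Finset.sum_mul, mul_right_comm]
    · refine ⟨N, U, fun l => V l * X i, fun w z => ?_⟩
      simp [h, Finset.sum_mul, mul_assoc]

variable {k : Type*} [Field k] {W Y : Type*}

theorem exists_linearIndependent_combination {E : Type*} [AddCommGroup E] [Module k E]
    (U : Submodule k E) {N : ℕ} (u : Fin N → E) (hu : ∀ l, u l ∈ U) :
    ∃ (m : ℕ) (b : Fin m → E) (c : Fin N → Fin m → k), LinearIndependent k b ∧ (∀ j, b j ∈ U) ∧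
      ∀ l, u l = ∑ j, c l j • b j := by
  have : FiniteDimensional k (Submodule.span k (Set.range u)) :=
    FiniteDimensional.span_of_finite k (Set.finite_range u)
  let b := Module.finBasis k (Submodule.span k (Set.range u))
  refine ⟨_, fun j => b j, fun l => b.repr ⟨u l, Submodule.subset_span ⟨l, rfl⟩⟩,
    b.linearIndependent.map' _ (Submodule.ker_subtype _), fun j => ?_, fun l => ?_⟩
  · refine (Submodule.span_le.2 ?_ : Submodule.span k (Set.range u) ≤ U) (b j).2
    rintro _ ⟨l, rfl⟩
    exact hu l
  · have := congrArg (Submodule.subtype _)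
      (b.sum_repr ⟨u l, Submodule.subset_span ⟨l, rfl⟩⟩)
    rw [map_sum] at this
    exact this.symm

/-- If `∑ u_l(w) v_l(y)` is invariant in `y`, it can be written with invariant `v_l`. -/
theorem exists_sum_mul_eq_of_invariant (SU : Submodule k (W → k)) (SV : Submodule k (Y → k))
    {N : ℕ} (u : Fin N → W → k) (v : Fin N → Y → k) (hu : ∀ l, u l ∈ SU) (hv : ∀ l, v l ∈ SV)
    (r : Y → Y → Prop)
    (hr : ∀ w y y', r y y' → ∑ l, u l w * v l y = ∑ l, u l w * v l y') :
    ∃ (N' : ℕ) (u' : Fin N' → W → k) (v' : Fin N' → Y → k), (∀ l, u' l ∈ SU) ∧ (∀ l, v' l ∈ SV) ∧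
      (∀ l y y', r y y' → v' l y = v' l y') ∧
      ∀ w y, ∑ l, u l w * v l y = ∑ l, u' l w * v' l y := by
  obtain ⟨m, b, c, hli, hbu, hc⟩ := exists_linearIndependent_combination SU u hu
  let v' : Fin m → Y → k := fun j => ∑ l, c l j • v l
  have heq : ∀ w y, ∑ l, u l w * v l y = ∑ j, b j w * v' j y := by
    intro w y
    have : ∀ l, u l w = ∑ j, c l j * b j w := fun l => by
      simpa using congrFun (hc l) w
    simp only [this, v', Finset.sum_apply, Pi.smul_apply, smul_eq_mul, Finset.sum_mul,
      Finset.mul_sum]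
    rw [Finset.sum_comm]
    exact Finset.sum_congr rfl fun _ _ => Finset.sum_congr rfl fun _ _ => by ring
  refine ⟨m, b, v', hbu, fun j => sum_mem fun l _ => SV.smul_mem _ (hv l),
    fun j y y' hy => ?_, heq⟩
  have h0 : ∑ j, (v' j y - v' j y') • b j = 0 := by
    funext w
    have := hr w y y' hy
    rw [heq, heq, ← sub_eq_zero, ← Finset.sum_sub_distrib] at this
    simpa [mul_sub, mul_comm] using this
  exact sub_eq_zero.1 (Fintype.linearIndependent_iff.1 hli _ h0 j)

end tensor

section quotient

variable {k : Type} [Field k] {n : ℕ} {Γ : Subgroup (Mat k n)ˣ} {M : Set (Mat k n)}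

theorem exists_mEval_eq_zero [IsAlgClosed k] {I : Ideal (MPoly k n)} (hI : I ≠ ⊤) :
    ∃ a : Mat k n, ∀ p ∈ I, mEval a p = 0 := by
  obtain ⟨x, hx⟩ := exists_algHom_ker_ge (k := k) hI
  refine ⟨Matrix.of fun i j => x (X (i, j)), fun p hp => ?_⟩
  rw [← hx p hp, mEval_eq]
  refine DFunLike.congr_fun (?_ : aeval _ = x) p
  ext ij
  simp

theorem mEval_eq_zero_of_mem_span {S : Set (MPoly k n)} {m : Mat k n} (hm : ∀ p ∈ S, mEval m p = 0)
    {p : MPoly k n} (hp : p ∈ Ideal.span S) : mEval m p = 0 :=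
  (Ideal.span_le (I := RingHom.ker (eval (entries m)))).2 hm hp

/-- Disjoint closed stable sets are separated by an invariant polynomial. -/
theorem exists_invariant_separating [IsAlgClosed k] (hgr : GeomReductive Γ)
    (hM : ∀ h, ∀ m ∈ M, incl Γ h * m ∈ M) {Z₁ Z₂ : Set (Mat k n)} (h₁ : ZClosed Z₁)
    (h₂ : ZClosed Z₂) (h₁M : Z₁ ⊆ M) (h₂M : Z₂ ⊆ M) (hs₁ : ∀ h, ∀ m ∈ Z₁, incl Γ h * m ∈ Z₁)
    (hs₂ : ∀ h, ∀ m ∈ Z₂, incl Γ h * m ∈ Z₂) (hdisj : Disjoint Z₁ Z₂) :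
    ∃ p : MPoly k n, InvariantOn (matSet Γ) M p ∧ (∀ m ∈ Z₁, mEval m p = 0) ∧
      ∀ m ∈ Z₂, mEval m p = 1 := by
  obtain ⟨S₁, rfl⟩ := h₁
  obtain ⟨S₂, rfl⟩ := h₂
  have htop : Ideal.span S₁ ⊔ Ideal.span S₂ = ⊤ := by
    by_contra hne
    obtain ⟨a, ha⟩ := exists_mEval_eq_zero hne
    exact Set.disjoint_left.1 hdisj
      (show a ∈ _ from fun p hp => ha p (Ideal.mem_sup_left (Ideal.subset_span hp)))
      fun p hp => ha p (Ideal.mem_sup_right (Ideal.subset_span hp))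
  have hvan : ∀ S : Set (MPoly k n), ∀ p ∈ Ideal.span S,
      ∀ m ∈ {x : Mat k n | ∀ p ∈ S, mEval x p = 0}, mEval m p = 0 :=
    fun S p hp m hm => mEval_eq_zero_of_mem_span hm hp
  obtain ⟨p, hp, q, hq, hpq⟩ := Submodule.mem_sup.1 (htop ▸ Submodule.mem_top :
    (1 : MPoly k n) ∈ Ideal.span S₁ ⊔ Ideal.span S₂)
  have hp1 := hvan S₁ p hp
  have hp2 : ∀ m ∈ {x : Mat k n | ∀ p ∈ S₂, mEval x p = 0}, mEval m p = 1 := by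
    intro m hm
    have h2 := hvan S₂ q hq m hm
    have h3 := congrArg (eval (entries m)) hpq
    rw [map_add, map_one] at h3
    rw [mEval_eq_eval_entries] at h2 ⊢
    rwa [h2, add_zero] at h3
  set Z₁ := {x : Mat k n | ∀ p ∈ S₁, mEval x p = 0}
  set Z₂ := {x : Mat k n | ∀ p ∈ S₂, mEval x p = 0}
  have hev : ∀ (w : Empty → k) (m : Mat k n), eval (Sum.elim w (entries m)) (rename Sum.inr p) =
      mEval m p := fun w m => by
    rw [eval_rename, Sum.elim_comp_inr]; rfl
  obtain ⟨d, F, hd, hF, hFZ⟩ := exists_invariant_eq_pow (τ := Empty) hgr hM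
    (Z := {z | z.2 ∈ Z₁ ∪ Z₂}) (fun z hz => hz.elim (fun h => h₁M h) fun h => h₂M h)
    (fun h z hz => hz.imp (hs₁ h _) (hs₂ h _)) (rename Sum.inr p) (by
      rintro h ⟨w, m⟩ (hm | hm)
      · rw [hev, hev, hp1 _ hm, hp1 _ (hs₁ h _ hm)]
      · rw [hev, hev, hp2 _ hm, hp2 _ (hs₂ h _ hm)])
  let P : MPoly k n := aeval (Sum.elim (fun e : Empty => e.elim) X) F
  have hP : ∀ m, mEval m P = eval (Sum.elim (fun e : Empty => e.elim) (entries m)) F := fun m => by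
    rw [mEval_eq_eval_entries, ← aeval_eq_eval, ← aeval_eq_eval, ← AlgHom.comp_apply, comp_aeval]
    congr 2
    ext (i | i)
    · exact i.elim
    · simp
  refine ⟨P, ?_, fun m hm => ?_, fun m hm => ?_⟩
  · rw [invariantOn_matSet]
    intro h m hm
    rw [hP, hP, hF h _ m hm]
  · rw [hP, hFZ (_, m) (Or.inl hm), hev, hp1 _ hm, zero_pow hd.ne']
  · rw [hP, hFZ (_, m) (Or.inr hm), hev, hp2 _ hm, one_pow]

/-- The polynomial functions on `M`. -/
noncomputable def polyFun (M : Set (Mat k n)) : Submodule k (M → k) :=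
  Subalgebra.toSubmodule (regFun fun m : M => (m : Mat k n))

theorem mem_polyFun {u : M → k} : u ∈ polyFun M ↔ ∃ p : MPoly k n, ∀ m : M, u m = mEval m p :=
  mem_regFun _

/-- A polynomial family of invariants is polynomial in the generators. -/
theorem exists_eval_eq_sum_quotMap (hM : ∀ h, ∀ m ∈ M, incl Γ h * m ∈ M) {r : ℕ}
    {f : Fin r → MPoly k n} (hgen : ∀ p : MPoly k n, InvariantOn (matSet Γ) M p →
        ∃ q : QPoly r k, ∀ m ∈ M, mEval m p = qEval (quotMap f m) q)
    {τ : Type} (F : MvPolynomial (τ ⊕ Fin n × Fin n) k)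
    (hF : ∀ h w, ∀ m ∈ M, eval (Sum.elim w (entries (incl Γ h * m))) F =
        eval (Sum.elim w (entries m)) F) :
    ∃ (N : ℕ) (U : Fin N → MvPolynomial τ k) (Q : Fin N → QPoly r k), ∀ w, ∀ m ∈ M,
      eval (Sum.elim w (entries m)) F = ∑ l, eval w (U l) * qEval (quotMap f m) (Q l) := by
  obtain ⟨N, U, V, hUV⟩ := exists_eval_sumElim_eq F
  have hU : ∀ l, (fun w => eval w (U l)) ∈
      LinearMap.range (LinearMap.pi fun w : τ → k => (aeval w).toLinearMap) :=
    fun l => ⟨U l, _root_.funext fun w => by simp [aeval_eq_eval]⟩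
  have hV : ∀ l, (fun m : M => mEval (m : Mat k n) (V l)) ∈ polyFun M :=
    fun l => mem_polyFun.2 ⟨V l, fun m => rfl⟩
  have hinv : ∀ (w : τ → k) (m m' : M), (∃ h : Γ, (m' : Mat k n) = incl Γ h * m) →
      ∑ l, eval w (U l) * mEval (m : Mat k n) (V l) =
        ∑ l, eval w (U l) * mEval (m' : Mat k n) (V l) := by
    rintro w m m' ⟨h, hm'⟩
    have := hF h w m m.2
    rw [hUV, hUV, ← hm'] at this
    exact this.symm
  obtain ⟨N', u, v, hu, hv, hvinv, huv⟩ := exists_sum_mul_eq_of_invariant _ _ _ _ hU hV _ hinv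
  have hu' : ∀ l, ∃ p : MvPolynomial τ k, ∀ w, eval w p = u l w := fun l =>
    (hu l).imp fun p hp w => by rw [← hp]; simp [aeval_eq_eval]
  choose U' hU' using hu'
  have hv' : ∀ l, ∃ p : MPoly k n, ∀ m : M, v l m = mEval m p := fun l => mem_polyFun.1 (hv l)
  choose V' hV' using hv'
  have hQ : ∀ l, ∃ q : QPoly r k, ∀ m ∈ M, mEval m (V' l) = qEval (quotMap f m) q := by
    refine fun l => hgen (V' l) (invariantOn_matSet.2 fun h m hm => ?_)
    have := hvinv l ⟨m, hm⟩ ⟨_, hM h m hm⟩ ⟨h, rfl⟩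
    rw [hV', hV'] at this
    exact this.symm
  choose Q hQ using hQ
  refine ⟨N', U', Q, fun w m hm => ?_⟩
  rw [hUV]
  refine (huv w ⟨m, hm⟩).trans (Finset.sum_congr rfl fun l _ => ?_)
  rw [hV', ← hU']
  exact congrArg (_ * ·) (hQ l m hm)

theorem eval_aeval_X_sub_C {σ : Type} (y z : σ → k) (p : MvPolynomial σ k) :
    eval z (aeval (fun i => X i - C (y i)) p) = eval (z - y) p := by
  rw [← aeval_eq_eval, ← aeval_eq_eval, ← AlgHom.comp_apply, comp_aeval]
  congr 2
  ext i
  simp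

/-- The quotient map is surjective onto the quotient variety. -/
theorem exists_quotMap_eq [IsAlgClosed k] (hgr : GeomReductive Γ)
    (hMc : ZClosed M) (hM : ∀ h, ∀ m ∈ M, incl Γ h * m ∈ M) {r : ℕ} {f : Fin r → MPoly k n}
    (hf : ∀ i, InvariantOn (matSet Γ) M (f i))
    (hgen : ∀ p : MPoly k n, InvariantOn (matSet Γ) M p →
        ∃ q : QPoly r k, ∀ m ∈ M, mEval m p = qEval (quotMap f m) q)
    {y : Fin r → k} (hy : y ∈ quotVariety f M) : ∃ m ∈ M, quotMap f m = y := by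
  by_contra! hne
  simp only [invariantOn_matSet] at hf
  obtain ⟨S, hS⟩ := hMc
  let I : Ideal (MPoly k n) := Ideal.span S ⊔ Ideal.span (Set.range fun i => f i - C (y i))
  have htop : I = ⊤ := by
    by_contra hI
    obtain ⟨a, ha⟩ := exists_mEval_eq_zero hI
    refine hne a (hS ▸ fun p hp => ha p (Ideal.mem_sup_left (Ideal.subset_span hp)))
      (_root_.funext fun i => ?_)
    have := ha _ (Ideal.mem_sup_right (Ideal.subset_span ⟨i, rfl⟩))
    rwa [mEval_eq_eval_entries, map_sub, eval_C, sub_eq_zero] at this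
  obtain ⟨p, hp, q, hq, hpq⟩ := Submodule.mem_sup.1 (htop ▸ Submodule.mem_top : (1 : MPoly k n) ∈ I)
  obtain ⟨a, rfl⟩ := (Submodule.mem_span_range_iff_exists_fun _).1 hq
  have ha : ∀ m ∈ M, ∑ i, mEval m (a i) * (mEval m (f i) - y i) = 1 := by
    intro m hm
    have h2 : eval (entries m) p = 0 := mEval_eq_zero_of_mem_span (S := S)
      (hS ▸ hm : m ∈ {x : Mat k n | ∀ p ∈ S, mEval x p = 0}) hp
    have h3 := congrArg (eval (entries m)) hpq
    rw [map_add, h2, zero_add, map_sum, map_one] at h3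
    simpa [mEval_eq_eval_entries] using h3
  let F₀ : MvPolynomial (Fin r ⊕ Fin n × Fin n) k :=
    ∑ i, rename Sum.inr (a i) * X (Sum.inl i)
  have hF₀ : ∀ w m, eval (Sum.elim w (entries m)) F₀ = ∑ i, mEval m (a i) * w i := by
    intro w m
    simp [F₀, eval_rename, mEval_eq_eval_entries]
  let Z : Set ((Fin r → k) × Mat k n) := {z | z.2 ∈ M ∧ (z.1 = 0 ∨ z.1 = quotMap f z.2 - y)}
  have hZ1 : ∀ m ∈ M, eval (Sum.elim (quotMap f m - y) (entries m)) F₀ = 1 := by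
    intro m hm
    rw [hF₀]
    exact ha m hm
  have hZ0 : ∀ m, eval (Sum.elim 0 (entries m)) F₀ = 0 := by
    intro m
    simp [hF₀]
  have hqm : ∀ h : Γ, ∀ m ∈ M, quotMap f (incl Γ h * m) = quotMap f m :=
    fun h m hm => _root_.funext fun i => hf i h m hm
  obtain ⟨d, F, hd, hF, hFZ⟩ := exists_invariant_eq_pow (τ := Fin r) hgr hM (Z := Z)
    (fun z hz => hz.1) (by
      rintro h ⟨w, m⟩ ⟨hm, hw⟩
      refine ⟨hM h m hm, hw.imp id fun hw => ?_⟩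
      rwa [hqm h m hm]) F₀ (by
      rintro h ⟨w, m⟩ ⟨hm, hw⟩
      obtain rfl | rfl : w = 0 ∨ w = quotMap f m - y := hw
      · rw [hZ0, hZ0]
      · have := hZ1 _ (hM h m hm)
        rw [hqm h m hm] at this
        rw [this, hZ1 m hm])
  obtain ⟨N, U', Q, hFQ⟩ := exists_eval_eq_sum_quotMap hM hgen F hF
  have hG0 := hy (∑ l, C (eval 0 (U' l)) * Q l) (fun m hm => by
    have := hFZ (0, m) ⟨hm, Or.inl rfl⟩
    rw [hFQ 0 m hm, hZ0, zero_pow hd.ne'] at this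
    simpa [qEval] using this)
  have hG1 := hy (∑ l, aeval (fun i => X i - C (y i)) (U' l) * Q l - 1) (fun m hm => by
    have := hFZ (quotMap f m - y, m) ⟨hm, Or.inr rfl⟩
    rw [hFQ _ m hm, hZ1 m hm, one_pow] at this
    rw [qEval, map_sub, map_one, map_sum, sub_eq_zero, ← this]
    refine Finset.sum_congr rfl fun l _ => ?_
    rw [map_mul, eval_aeval_X_sub_C]
    rfl)
  rw [qEval, map_sum] at hG0
  rw [qEval, map_sub, map_one, map_sum, sub_eq_zero] at hG1
  refine one_ne_zero (hG1.symm.trans (Eq.trans ?_ hG0))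
  refine Finset.sum_congr rfl fun l _ => ?_
  rw [map_mul, map_mul, eval_aeval_X_sub_C, sub_self, eval_C]

end quotient

section monoid

variable {k : Type} [Field k] {n : ℕ} {M : Set (Mat k n)}

noncomputable def detMPoly : MPoly k n :=
  (Matrix.of fun i j => (X (i, j) : MPoly k n)).det

theorem mEval_det {d : ℕ} (A : Matrix (Fin d) (Fin d) (MPoly k n)) (x : Mat k n) :
    mEval x A.det = (Matrix.of fun i j => mEval x (A i j)).det := by
  rw [mEval_eq_eval_entries, RingHom.map_det]
  rfl

theorem mEval_detMPoly (x : Mat k n) : mEval x detMPoly = x.det := by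
  rw [detMPoly, mEval_det]
  congr 1
  ext i j
  simp [mEval_X]

theorem zClosed_zeroLocus (p : MPoly k n) : ZClosed {x : Mat k n | mEval x p = 0} :=
  ⟨{p}, by simp⟩

theorem ZClosed.preimage_mul {A : Set (Mat k n)} (hA : ZClosed A) (a b : Mat k n) :
    ZClosed {x | a * x * b ∈ A} := by
  obtain ⟨S, rfl⟩ := hA
  refine ⟨tsub a b '' S, Set.ext fun x => ?_⟩
  simp [mEval_tsub]

/-- A closed submonoid of matrices contains the inverses of its invertible elements. -/
theorem mem_of_mul_eq_one (hM : IsAlgMonoid M) {a b : Mat k n} (ha : a ∈ M) (hab : a * b = 1) :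
    b ∈ M := by
  have hba : b * a = 1 := mul_eq_one_comm.1 hab
  have hpow : ∀ i : ℕ, a ^ i ∈ M := fun i => by
    induction i with
    | zero => simpa using hM.one_mem
    | succ i ih => rw [pow_succ]; exact hM.mul_mem _ ih _ ha
  have hcancel : ∀ i : ℕ, b ^ i * a ^ i = 1 := fun i => by
    induction i with
    | zero => simp
    | succ i ih => rw [pow_succ, pow_succ', mul_assoc, ← mul_assoc b, hba, one_mul, ih]
  let I : ℕ →o Ideal (MPoly k n) :=
    { toFun := fun i => pointIdeal (entries '' {x : Mat k n | ∃ m ∈ M, x = a ^ i * m})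
      monotone' := monotone_nat_of_le_succ fun i p hp => by
        rintro _ ⟨_, ⟨m, hm, rfl⟩, rfl⟩
        exact hp _ ⟨_, ⟨a * m, hM.mul_mem _ ha _ hm, by rw [pow_succ, mul_assoc]⟩, rfl⟩ }
  obtain ⟨N, hN⟩ := monotone_stabilizes_iff_noetherian.2 inferInstance I
  obtain ⟨S, hS⟩ := hM.zclosed
  have hiff : ∀ x, x ∈ M ↔ ∀ p ∈ S, mEval x p = 0 := fun x => by rw [hS]; rfl
  refine (hiff b).2 fun p hp => ?_
  have h1 : tsub (b ^ (N + 1)) 1 p ∈ I N := by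
    rw [hN (N + 1) (by omega)]
    rintro _ ⟨_, ⟨m, hm, rfl⟩, rfl⟩
    rw [← mEval_eq_eval_entries, mEval_tsub, mul_one, ← mul_assoc, hcancel, one_mul]
    exact (hiff m).1 hm p hp
  have h2 : mEval (a ^ N) (tsub (b ^ (N + 1)) 1 p) = 0 := h1 _ ⟨_, ⟨1, hM.one_mem, by simp⟩, rfl⟩
  rwa [mEval_tsub, mul_one, pow_succ', mul_assoc, hcancel, mul_one] at h2

theorem mem_unitGroup_iff (hM : IsAlgMonoid M) {a : Mat k n} :
    a ∈ unitGroup M ↔ a ∈ M ∧ a.det ≠ 0 := by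
  constructor
  · rintro ⟨ha, b, -, hab, -⟩
    exact ⟨ha, fun h => by simpa [h] using congrArg Matrix.det hab⟩
  · rintro ⟨ha, hd⟩
    have h1 := Matrix.mul_nonsing_inv a (isUnit_iff_ne_zero.2 hd)
    exact ⟨ha, a⁻¹, mem_of_mul_eq_one hM ha h1, h1, Matrix.nonsing_inv_mul a (isUnit_iff_ne_zero.2 hd)⟩

/-- The unit group of an irreducible monoid is dense. -/
theorem mEval_eq_zero_of_unitGroup (hM : IsAlgMonoid M) (hMirr : IrreducibleSet M) {p : MPoly k n}
    (hp : ∀ g ∈ unitGroup M, mEval g p = 0) {m : Mat k n} (hm : m ∈ M) : mEval m p = 0 := by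
  refine (hMirr.2 p detMPoly fun x hx => ?_).elim (fun h => h m hm) fun h => ?_
  · rw [mEval_eq_eval_entries, map_mul, ← mEval_eq_eval_entries, ← mEval_eq_eval_entries,
      mEval_detMPoly]
    by_cases hd : x.det = 0
    · rw [hd, mul_zero]
    · rw [hp x ((mem_unitGroup_iff hM).2 ⟨hx, hd⟩), zero_mul]
  · simpa [mEval_detMPoly] using h 1 hM.one_mem

theorem mEval_eq_of_unitGroup (hM : IsAlgMonoid M) (hMirr : IrreducibleSet M) {p q : MPoly k n}
    (hp : ∀ g ∈ unitGroup M, mEval g p = mEval g q) {m : Mat k n} (hm : m ∈ M) :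
    mEval m p = mEval m q := by
  have := mEval_eq_zero_of_unitGroup hM hMirr (p := p - q) (fun g hg => by
    have := hp g hg
    simp only [mEval, map_sub] at this ⊢
    rw [this, sub_self]) hm
  simpa [mEval, sub_eq_zero] using this

/-- A subgroup of the unit group, as a group of invertible matrices. -/
def unitsOf {H G : Set (Mat k n)} (hH : IsSubgroupOf H G) : Subgroup (Mat k n)ˣ where
  carrier := {u | (u : Mat k n) ∈ H}
  one_mem' := hH.2.1
  mul_mem' := fun ha hb => hH.2.2.1 _ ha _ hb
  inv_mem' := by
    rintro u hu
    obtain ⟨b, hb, h1, -⟩ := hH.2.2.2 _ hu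
    rwa [← Units.inv_eq_of_mul_eq_one_right h1] at hb

theorem matSet_unitsOf {H G : Set (Mat k n)} (hH : IsSubgroupOf H G) : matSet (unitsOf hH) = H := by
  ext x
  constructor
  · rintro ⟨u, hu, rfl⟩
    exact hu
  · intro hx
    obtain ⟨b, hb, h1, h2⟩ := hH.2.2.2 _ hx
    exact ⟨⟨x, b, h1, h2⟩, hx, rfl⟩

end monoid

section kernel

variable {k : Type*} [Field k] {W Y : Type*}

/-- A kernel of finite rank has a finite basis of columns, whose span is separated by finitely
many points. -/
theorem exists_columns_points (K : W → Y → k) {N : ℕ} (u : Fin N → W → k) (v : Fin N → Y → k)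
    (hK : ∀ w y, K w y = ∑ l, u l w * v l y) :
    ∃ (d : ℕ) (a : Fin d → W) (b : Fin d → Y), (LinearIndependent k fun j w => K w (b j)) ∧
      ∀ ψ ∈ Submodule.span k (Set.range fun y w => K w y), (∀ i, ψ (a i) = 0) → ψ = 0 := by
  let V := Submodule.span k (Set.range fun y w => K w y)
  have hVle : V ≤ Submodule.span k (Set.range u) := by
    rw [Submodule.span_le]
    rintro _ ⟨y, rfl⟩
    have : (fun w => K w y) = ∑ l, v l y • u l := by
      ext w
      simp [hK, mul_comm]
    simp only [this]
    exact Submodule.sum_mem _ fun l _ => Submodule.smul_mem _ _ (Submodule.subset_span ⟨l, rfl⟩)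
  have := FiniteDimensional.span_of_finite k (Set.finite_range u)
  have hfin : FiniteDimensional k V := Submodule.finiteDimensional_of_le hVle
  obtain ⟨e, he, hspan, hli⟩ := Submodule.exists_fun_fin_finrank_span_eq k
    (Set.range fun y w => K w y)
  choose b hb using he
  have heb : (fun j w => K w (b j)) = e := _root_.funext hb
  let rr : W → (Fin (Module.finrank k V) → k) := fun w j => e j w
  have htop : Submodule.span k (Set.range rr) = ⊤ := by
    by_contra hne
    obtain ⟨φ, hφ, hle⟩ := Submodule.exists_le_ker_of_lt_top _ (lt_top_iff_ne_top.2 hne)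
    refine hφ (LinearMap.pi_ext' fun j => LinearMap.ext_ring ?_)
    refine Fintype.linearIndependent_iff.1 hli (fun j => φ (Pi.single j 1)) ?_ j
    ext w
    have h1 : φ (rr w) = 0 := hle (Submodule.subset_span ⟨w, rfl⟩)
    rw [pi_eq_sum_univ' (rr w), map_sum] at h1
    simpa [rr, mul_comm] using h1
  obtain ⟨s, hs, hsspan, hsli⟩ := Submodule.exists_fun_fin_finrank_span_eq k (Set.range rr)
  have hd : Module.finrank k (Submodule.span k (Set.range rr)) = Module.finrank k V := by
    rw [htop, finrank_top, Module.finrank_fin_fun]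
  choose a ha using hs
  refine ⟨_, fun i => a (Fin.cast hd.symm i), b, heb ▸ hli, fun ψ hψ h0 => ?_⟩
  rw [← hspan] at hψ
  obtain ⟨c, rfl⟩ := (Submodule.mem_span_range_iff_exists_fun _).1 hψ
  let φ : (Fin (Module.finrank k V) → k) →ₗ[k] k := ∑ j, c j • LinearMap.proj j
  have hφ : ∀ w, φ (rr w) = (∑ j, c j • e j) w := fun w => by simp [φ, rr]
  have hle : Submodule.span k (Set.range rr) ≤ LinearMap.ker φ := by
    rw [← hsspan, Submodule.span_le]
    rintro _ ⟨i, rfl⟩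
    rw [SetLike.mem_coe, LinearMap.mem_ker, ← ha, hφ]
    simpa using h0 (Fin.cast hd i)
  ext w
  rw [← hφ]
  exact hle (Submodule.subset_span ⟨w, rfl⟩)

end kernel

section product

variable {k : Type} [Field k] {n : ℕ} {M H : Set (Mat k n)}

theorem mEval_mul_mul_of_invariantOn (hM : IsAlgMonoid M) (hMirr : IrreducibleSet M)
    (hn : ∀ g ∈ unitGroup M, ∀ h ∈ H, ∃ h' ∈ H, g * h = h' * g) {p : MPoly k n}
    (hp : InvariantOn H M p) {a b h : Mat k n} (ha : a ∈ M) (hh : h ∈ H) (hb : b ∈ M) :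
    mEval (a * (h * b)) p = mEval (a * b) p := by
  have := mEval_eq_of_unitGroup hM hMirr (p := tsub 1 (h * b) p) (q := tsub 1 b p)
    (fun g hg => by
      rw [mEval_tsub, mEval_tsub, one_mul]
      obtain ⟨h', hh', hgh⟩ := hn g hg h hh
      rw [← mul_assoc, hgh, mul_assoc, hp h' hh' _ (hM.mul_mem _ hg.1 _ hb)]) ha
  rwa [mEval_tsub, mEval_tsub, one_mul] at this

/-- The comultiplication of polynomials on matrices. -/
noncomputable def mulPoly (p : MPoly k n) : MvPolynomial (Fin n × Fin n ⊕ Fin n × Fin n) k :=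
  aeval (fun z : Fin n × Fin n => ∑ l, X (Sum.inl (z.1, l)) * X (Sum.inr (l, z.2))) p

theorem eval_mulPoly (p : MPoly k n) (a b : Mat k n) :
    eval (Sum.elim (entries a) (entries b)) (mulPoly p) = mEval (a * b) p := by
  rw [mulPoly, mEval_eq, ← aeval_eq_eval, ← AlgHom.comp_apply, comp_aeval]
  congr 2
  ext z
  simp [Matrix.mul_apply, entries]

/-- A function of a product that is invariant in both factors is polynomial in the generating
invariants of the factors. -/
theorem exists_eval_quotMap_eq {r : ℕ} {f : Fin r → MPoly k n}
    (hHM : ∀ h ∈ H, ∀ m ∈ M, h * m ∈ M)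
    (hgen : ∀ p : MPoly k n, InvariantOn H M p →
        ∃ q : QPoly r k, ∀ m ∈ M, mEval m p = qEval (quotMap f m) q)
    {p : MPoly k n} (h1 : ∀ h ∈ H, ∀ a ∈ M, ∀ b ∈ M, mEval (h * a * b) p = mEval (a * b) p)
    (h2 : ∀ h ∈ H, ∀ a ∈ M, ∀ b ∈ M, mEval (a * (h * b)) p = mEval (a * b) p) :
    ∃ (N : ℕ) (P Q : Fin N → QPoly r k), ∀ a ∈ M, ∀ b ∈ M,
      mEval (a * b) p = ∑ l, qEval (quotMap f a) (P l) * qEval (quotMap f b) (Q l) := by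
  obtain ⟨N, U, V, hUV⟩ := exists_eval_sumElim_eq (mulPoly p)
  replace hUV : ∀ a b : Mat k n, mEval (a * b) p = ∑ l, mEval a (U l) * mEval b (V l) :=
    fun a b => (eval_mulPoly p a b).symm.trans (hUV _ _)
  have hpoly : ∀ q : MPoly k n, (fun m : M => mEval (m : Mat k n) q) ∈ polyFun M :=
    fun q => mem_polyFun.2 ⟨q, fun m => rfl⟩
  have hdesc : ∀ v : M → k, v ∈ polyFun M →
      (∀ m m' : M, (∃ h ∈ H, (m' : Mat k n) = h * m) → v m = v m') →
      ∃ q : QPoly r k, ∀ m : M, v m = qEval (quotMap f m) q := by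
    intro v hv hinv
    obtain ⟨q, hq⟩ := mem_polyFun.1 hv
    obtain ⟨Q, hQ⟩ := hgen q (fun h hh m hm => by
      rw [← hq ⟨m, hm⟩, ← hq ⟨_, hHM h hh m hm⟩]
      exact (hinv _ _ ⟨h, hh, rfl⟩).symm)
    exact ⟨Q, fun m => (hq m).trans (hQ m m.2)⟩
  have hinv1 : ∀ (a b b' : M), (∃ h ∈ H, (b' : Mat k n) = h * b) →
      ∑ l, mEval (a : Mat k n) (U l) * mEval (b : Mat k n) (V l) =
        ∑ l, mEval (a : Mat k n) (U l) * mEval (b' : Mat k n) (V l) := by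
    rintro a b b' ⟨h, hh, hb⟩
    have := h2 h hh a a.2 b b.2
    rw [← hb, hUV, hUV] at this
    exact this.symm
  obtain ⟨N₁, u, v, hu, hv, hvinv, huv⟩ := exists_sum_mul_eq_of_invariant (polyFun M) (polyFun M)
    (fun l (m : M) => mEval (m : Mat k n) (U l)) (fun l (m : M) => mEval (m : Mat k n) (V l))
    (fun l => hpoly (U l)) (fun l => hpoly (V l)) _ hinv1
  let SQ : Submodule k (M → k) :=
    LinearMap.range (LinearMap.pi fun m : M => (aeval (quotMap f m)).toLinearMap)
  have hSQ : ∀ v : M → k, v ∈ SQ ↔ ∃ q : QPoly r k, ∀ m : M, v m = qEval (quotMap f m) q := by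
    intro v
    constructor
    · rintro ⟨q, rfl⟩
      exact ⟨q, fun m => by simp [aeval_eq_eval, qEval]⟩
    · rintro ⟨q, hq⟩
      exact ⟨q, _root_.funext fun m => by simp [aeval_eq_eval, hq, qEval]⟩
  have hvSQ : ∀ l, v l ∈ SQ := fun l => (hSQ _).2 (hdesc _ (hv l) (hvinv l))
  have hmul : ∀ a b : M, mEval ((a : Mat k n) * (b : Mat k n)) p = ∑ l, v l b * u l a := fun a b => by
    rw [hUV]
    refine (huv a b).trans (Finset.sum_congr rfl fun l _ => mul_comm _ _)
  have hinv2 : ∀ (b a a' : M), (∃ h ∈ H, (a' : Mat k n) = h * a) →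
      ∑ l, v l b * u l a = ∑ l, v l b * u l a' := by
    rintro b a a' ⟨h, hh, ha⟩
    rw [← hmul, ← hmul, ha, h1 h hh a a.2 b b.2]
  obtain ⟨N₂, P, Q, hP, hQ, hQinv, hPQ⟩ := exists_sum_mul_eq_of_invariant SQ (polyFun M)
    v u hvSQ hu _ hinv2
  have hQ' := fun l => hdesc _ (hQ l) (hQinv l)
  have hP' := fun l => (hSQ _).1 (hP l)
  choose Q' hQ' using hQ'
  choose P' hP' using hP'
  refine ⟨N₂, Q', P', fun a ha b hb => (hmul ⟨a, ha⟩ ⟨b, hb⟩).trans ?_⟩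
  rw [hPQ]
  exact Finset.sum_congr rfl fun l _ => by rw [hP', hQ', mul_comm]

/-- An invariant that vanishes exactly off the unit group. -/
theorem exists_invariant_ne_zero_iff (hM : IsAlgMonoid M)
    (hinv : ∀ p : MPoly k n, InvariantOn H M p → ∀ h ∈ H, ∀ a ∈ M, ∀ b ∈ M,
      mEval (a * (h * b)) p = mEval (a * b) p) {p : MPoly k n} (hp : InvariantOn H M p)
    (hp1 : mEval 1 p ≠ 0) (hp0 : ∀ m ∈ M, m.det = 0 → mEval m p = 0) :
    ∃ D : MPoly k n, InvariantOn H M D ∧ (∀ m ∈ M, m.det = 0 → mEval m D = 0) ∧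
      ∀ g ∈ unitGroup M, mEval g D ≠ 0 := by
  obtain ⟨N, U, V, hUV⟩ := exists_eval_sumElim_eq (mulPoly p)
  replace hUV : ∀ a b : Mat k n, mEval (a * b) p = ∑ l, mEval a (U l) * mEval b (V l) :=
    fun a b => (eval_mulPoly p a b).symm.trans (hUV _ _)
  obtain ⟨d, a, b, hli, hsep⟩ := exists_columns_points
    (fun (x y : M) => mEval ((x : Mat k n) * (y : Mat k n)) p) (fun l x => mEval (x : Mat k n) (U l))
    (fun l x => mEval (x : Mat k n) (V l)) (fun x y => hUV x y)
  let D : MPoly k n := (Matrix.of fun i j => tsub (a i : Mat k n) (b j : Mat k n) p).det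
  have hD : ∀ x, mEval x D = (Matrix.of fun i j => mEval ((a i : Mat k n) * x * (b j : Mat k n)) p).det := by
    intro x
    rw [mEval_det]
    congr 1
    ext i j
    simp [mEval_tsub]
  have hd : Nonempty (Fin d) := by
    by_contra hne
    rw [not_nonempty_iff] at hne
    have := congrFun (hsep _ (Submodule.subset_span ⟨⟨1, hM.one_mem⟩, rfl⟩) fun i => hne.elim i)
      ⟨1, hM.one_mem⟩
    simp only [mul_one] at this
    exact hp1 this
  refine ⟨D, fun h hh x hx => ?_, fun m hm hdet => ?_, fun g hg => ?_⟩
  · rw [hD, hD]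
    congr 1
    ext i j
    simp only [Matrix.of_apply]
    rw [← mul_assoc, mul_assoc, mul_assoc, hinv p hp h hh _ (a i).2 _ (hM.mul_mem _ hx _ (b j).2), mul_assoc]
  · rw [hD]
    convert Matrix.det_zero (n := Fin d) (R := k)
    ext i j
    refine hp0 _ (hM.mul_mem _ (hM.mul_mem _ (a i).2 _ hm) _ (b j).2) ?_
    rw [Matrix.det_mul, Matrix.det_mul, hdet, mul_zero, zero_mul]
  · intro h0
    rw [hD] at h0
    obtain ⟨c, hc, hc0⟩ := Matrix.exists_mulVec_eq_zero_iff.2 h0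
    obtain ⟨hgM, g', hg', hgg', hg'g⟩ := hg
    refine hc (_root_.funext (Fintype.linearIndependent_iff.1 hli c ?_))
    have hψ := hsep (∑ j, c j • fun x : M => mEval ((x : Mat k n) * (g * (b j : Mat k n))) p)
      (Submodule.sum_mem _ fun j _ => Submodule.smul_mem _ _
        (Submodule.subset_span ⟨⟨g * b j, hM.mul_mem _ hgM _ (b j).2⟩, rfl⟩)) fun i => by
      have := congrFun hc0 i
      simp only [Matrix.mulVec, dotProduct, Matrix.of_apply, Pi.zero_apply] at this
      simp only [Finset.sum_apply, Pi.smul_apply, smul_eq_mul, ← mul_assoc]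
      simpa only [mul_comm] using this
    ext x
    have h1 := congrFun hψ ⟨x * g', hM.mul_mem _ x.2 _ hg'⟩
    simp only [Finset.sum_apply, Pi.smul_apply, smul_eq_mul, Pi.zero_apply] at h1 ⊢
    rw [← h1]
    refine Finset.sum_congr rfl fun j _ => ?_
    rw [mul_assoc (x : Mat k n), ← mul_assoc g', hg'g, one_mul]

end product

section descent

variable {k : Type} [Field k] [IsAlgClosed k] {n : ℕ} {M H : Set (Mat k n)}

/-- A power of a function vanishing on the zeros of `q` is a multiple of `q`. -/
theorem exists_pow_eq_mul (hM : ZClosed M) {D q : MPoly k n}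
    (h : ∀ m ∈ M, mEval m q = 0 → mEval m D = 0) :
    ∃ (N : ℕ) (s : MPoly k n), ∀ m ∈ M, mEval m D ^ N = mEval m q * mEval m s := by
  obtain ⟨S, rfl⟩ := hM
  let I : Ideal (MPoly k n) := Ideal.span S ⊔ Ideal.span {q}
  have hnil : IsNilpotent (Ideal.Quotient.mk I D) := by
    by_contra hne
    obtain ⟨x, hx⟩ := exists_algHom_ne_zero (k := k) hne
    let y : MPoly k n →ₐ[k] k := x.comp (Ideal.Quotient.mkₐ k I)
    have hy : ∀ p, mEval (Matrix.of fun i j => y (X (i, j))) p = y p := fun p => by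
      rw [mEval_eq]
      exact DFunLike.congr_fun (algHom_ext (by intro z; simp)) p
    have hyI : ∀ p ∈ I, y p = 0 := fun p hp => by
      rw [AlgHom.comp_apply, Ideal.Quotient.mkₐ_eq_mk, Ideal.Quotient.eq_zero_iff_mem.2 hp, map_zero]
    refine hx ((hy D).symm.trans (h _ (fun p hp => ?_) ?_))
    · rw [hy, hyI p (Ideal.mem_sup_left (Ideal.subset_span hp))]
    · rw [hy, hyI q (Ideal.mem_sup_right (Ideal.subset_span rfl))]
  obtain ⟨N, hN⟩ := hnil
  rw [← map_pow, Ideal.Quotient.eq_zero_iff_mem] at hN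
  obtain ⟨p, hp, q', hq', hpq⟩ := Submodule.mem_sup.1 hN
  obtain ⟨s, rfl⟩ := Ideal.mem_span_singleton.1 hq'
  refine ⟨N, s, fun m hm => ?_⟩
  have h1 := congrArg (eval (entries m)) hpq
  rw [map_add, map_mul, map_pow, ← mEval_eq_eval_entries m p, mEval_eq_zero_of_mem_span hm hp,
    zero_add] at h1
  exact h1.symm

/-- Invariant fractions on the unit group are fractions of invariants. -/
theorem exists_invariant_fraction (hM : IsAlgMonoid M) (hMirr : IrreducibleSet M)
    (hHG : H ⊆ unitGroup M) {D : MPoly k n} (hD : InvariantOn H M D)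
    (hD0 : ∀ m ∈ M, m.det = 0 → mEval m D = 0) (hDG : ∀ g ∈ unitGroup M, mEval g D ≠ 0)
    {p q : MPoly k n} (hq : ∀ g ∈ unitGroup M, mEval g q ≠ 0)
    (hpq : RatInvariantOn H (unitGroup M) p q) :
    ∃ P Q : MPoly k n, InvariantOn H M P ∧ InvariantOn H M Q ∧
      (∀ g ∈ unitGroup M, mEval g Q ≠ 0) ∧
      ∀ g ∈ unitGroup M, mEval g p * mEval g Q = mEval g q * mEval g P := by
  obtain ⟨N, s, hs⟩ := exists_pow_eq_mul hM.zclosed (D := D) (q := q) fun m hm h0 =>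
    hD0 m hm (by_contra fun hd => hq m ((mem_unitGroup_iff hM).2 ⟨hm, hd⟩) h0)
  have hpow : ∀ x, mEval x (D ^ N) = mEval x D ^ N := fun x => by simp [mEval]
  have hmul : ∀ x, mEval x (s * p) = mEval x s * mEval x p := fun x => by simp [mEval]
  have hHg : ∀ h ∈ H, ∀ g ∈ unitGroup M, h * g ∈ unitGroup M := fun h hh g hg => by
    rw [mem_unitGroup_iff hM] at hg ⊢
    have := (mem_unitGroup_iff hM).1 (hHG hh)
    exact ⟨hM.mul_mem _ this.1 _ hg.1, by rw [Matrix.det_mul]; exact mul_ne_zero this.2 hg.2⟩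
  refine ⟨s * p, D ^ N, fun h hh x hx => ?_, fun h hh x hx => ?_, fun g hg => ?_, fun g hg => ?_⟩
  · have := mEval_eq_of_unitGroup hM hMirr (p := tsub h 1 (s * p)) (q := s * p) (fun g hg => by
      rw [mEval_tsub, mul_one, hmul, hmul]
      have hhg := hHg h hh g hg
      have e1 := hs g hg.1
      have e2 := hs _ hhg.1
      rw [hD h hh g hg.1, e1] at e2
      refine mul_left_cancel₀ (mul_ne_zero (hq _ hhg) (hq _ hg)) ?_
      linear_combination (mEval g s) * mEval g q * hpq h hh g hg
        - (mEval (h * g) p) * mEval g q * e2) hx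
    rwa [mEval_tsub, mul_one] at this
  · rw [hpow, hpow, hD h hh x hx]
  · rw [hpow]
    exact pow_ne_zero _ (hDG g hg)
  · rw [hpow, hmul, hs g hg.1]
    ring

/-- Invariants separate the cosets of a closed subgroup. -/
theorem exists_mul_of_invariants_eq {Γ : Subgroup (Mat k n)ˣ} (hgr : GeomReductive Γ)
    (hM : IsAlgMonoid M) (hΓM : matSet Γ ⊆ M) (hΓ : ZClosed (matSet Γ)) {g g' : Mat k n}
    (hg : g ∈ unitGroup M) (hg' : g' ∈ unitGroup M)
    (h : ∀ p : MPoly k n, InvariantOn (matSet Γ) M p → mEval g p = mEval g' p) :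
    ∃ x ∈ matSet Γ, g' = x * g := by
  by_contra! hne
  obtain ⟨hgM, a, ha, hga, hag⟩ := hg
  obtain ⟨hgM', a', ha', hga', hag'⟩ := hg'
  have hincl : ∀ x : Γ, incl Γ x ∈ matSet Γ := fun x => ⟨x, x.2, rfl⟩
  have hmm : ∀ x ∈ matSet Γ, ∀ y ∈ matSet Γ, x * y ∈ matSet Γ := by
    rintro _ ⟨x, hx, rfl⟩ _ ⟨y, hy, rfl⟩
    exact ⟨x * y, Γ.mul_mem hx hy, rfl⟩
  have hone : (1 : Mat k n) ∈ matSet Γ := ⟨1, Γ.one_mem, rfl⟩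
  have hsub : ∀ b c : Mat k n, c ∈ M → b * c = 1 → {x : Mat k n | 1 * x * b ∈ matSet Γ} ⊆ M := by
    intro b c hc hbc x hx
    have := hM.mul_mem _ (hΓM hx) _ hc
    rwa [one_mul, mul_assoc, hbc, mul_one] at this
  have hst : ∀ (b : Mat k n) (h : Γ), ∀ x ∈ {x : Mat k n | 1 * x * b ∈ matSet Γ},
      incl Γ h * x ∈ {x : Mat k n | 1 * x * b ∈ matSet Γ} := by
    intro b h x hx
    have := hmm _ (hincl h) _ hx
    rw [Set.mem_ofPred_eq]
    rwa [one_mul, ← mul_assoc, ← one_mul (incl Γ h * x)] at this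
  obtain ⟨p, hp, hp0, hp1⟩ := exists_invariant_separating hgr
    (fun x m hm => hM.mul_mem _ (hΓM (hincl x)) _ hm) (hΓ.preimage_mul 1 a) (hΓ.preimage_mul 1 a')
    (hsub a g hgM hag) (hsub a' g' hgM' hag') (hst a) (hst a') (by
      rw [Set.disjoint_left]
      rintro x hx hx'
      obtain ⟨u, hu, hux⟩ := hx
      obtain ⟨u', hu', hux'⟩ := hx'
      rw [one_mul] at hux hux'
      refine hne (u'⁻¹ * u : (Mat k n)ˣ) ⟨_, Γ.mul_mem (Γ.inv_mem hu') hu, rfl⟩ ?_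
      have e1 : x = u * g := by rw [hux, mul_assoc, hag, mul_one]
      have e2 : x = u' * g' := by rw [hux', mul_assoc, hag', mul_one]
      rw [Units.val_mul, mul_assoc, ← e1, e2, Units.inv_mul_cancel_left])
  have h1 := hp0 g (by rw [Set.mem_ofPred_eq, one_mul, hga]; exact hone)
  have h2 := hp1 g' (by rw [Set.mem_ofPred_eq, one_mul, hga']; exact hone)
  exact zero_ne_one (h1.symm.trans ((h p hp).trans h2))

end descent

/-- Let `M` be a reductive algebraic monoid with unit group `G`, and
let `H ⊆ G` be a normal subgroup, closed in `M`.  Then the categorical quotient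
`M ∥ H = Spec k[M]^H` (realized as the closure of the image of `π = (f₁, …, f_r)` for
generators `f i` of the invariant algebra) is an affine algebraic monoid with unit
group `G/H`, and `π : M → M ∥ H` is a morphism of algebraic monoids. -/
theorem reductive_monoid_quotient_by_normal_subgroup
    {k : Type} [Field k] [IsAlgClosed k] {n : ℕ}
    (M H : Set (Mat k n)) (hM : IsAlgMonoid M) (hMirr : IrreducibleSet M)
    (hred : IsReductiveGroup (unitGroup M))
    (hH : IsSubgroupOf H (unitGroup M)) (hnorm : IsNormalIn H (unitGroup M))
    (hHcl : IsClosedIn H M) :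
    ∃ (r : ℕ) (f : Fin r → MPoly k n),
      -- the invariant algebra `k[M]^H` is finitely generated, by the `f i` …
      (∀ i, InvariantOn H M (f i)) ∧
      (∀ p : MPoly k n, InvariantOn H M p →
        ∃ q : QPoly r k, ∀ m ∈ M, mEval m p = qEval (quotMap f m) q) ∧
      -- … and `M ∥ H` is an affine algebraic monoid:
      ∃ μ : Fin r → MvPolynomial (Fin r ⊕ Fin r) k,
        (∀ y ∈ quotVariety f M, ∀ y' ∈ quotVariety f M,
          mulMap μ y y' ∈ quotVariety f M) ∧
        (∀ y ∈ quotVariety f M,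
          mulMap μ (quotMap f 1) y = y ∧ mulMap μ y (quotMap f 1) = y) ∧
        (∀ y ∈ quotVariety f M, ∀ y' ∈ quotVariety f M, ∀ y'' ∈ quotVariety f M,
          mulMap μ (mulMap μ y y') y'' = mulMap μ y (mulMap μ y' y'')) ∧
        -- `π` is a morphism of algebraic monoids
        (∀ a ∈ M, ∀ b ∈ M, mulMap μ (quotMap f a) (quotMap f b) = quotMap f (a * b)) ∧
        -- the unit group of `M ∥ H` is the image of `G` …
        ({u ∈ quotVariety f M | ∃ v ∈ quotVariety f M,
            mulMap μ u v = quotMap f 1 ∧ mulMap μ v u = quotMap f 1}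
          = quotMap f '' unitGroup M) ∧
        -- … and it is isomorphic to `G/H`: the fibres of `π` on `G` are the `H`-cosets
        (∀ g ∈ unitGroup M, ∀ g' ∈ unitGroup M,
          (quotMap f g = quotMap f g' ↔ ∃ h ∈ H, g' = h * g)) ∧
        -- and every `H`-invariant regular function on `G` descends to `G(M ∥ H)`
        (∀ p q : MPoly k n, (∀ g ∈ unitGroup M, mEval g q ≠ 0) →
          RatInvariantOn H (unitGroup M) p q →
          ∃ P Q : QPoly r k, (∀ g ∈ unitGroup M, qEval (quotMap f g) Q ≠ 0) ∧
            ∀ g ∈ unitGroup M,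
              mEval g p * qEval (quotMap f g) Q = mEval g q * qEval (quotMap f g) P) := by
  have hHset := matSet_unitsOf hH
  have hHM : H ⊆ M := hHcl.1
  have hHz : ZClosed H := by
    obtain ⟨-, C, hC, rfl⟩ := hHcl
    exact hC.inter hM.zclosed
  have hone : (1 : Mat k n) ∈ unitGroup M := ⟨hM.one_mem, 1, hM.one_mem, mul_one 1, mul_one 1⟩
  have hgr : GeomReductive (unitsOf hH) := geomReductive_of_normal hred (unitsOf hH)
    (hHset.symm ▸ hH.1) (hHset.symm ▸ hHz) fun a ha ha' x hx =>
      hnorm a ha _ ha' (Units.mul_inv a) (Units.inv_mul a) x hx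
  have hΓM : ∀ h : unitsOf hH, ∀ m ∈ M, incl (unitsOf hH) h * m ∈ M :=
    fun h m hm => hM.mul_mem _ (hHM h.2) _ hm
  obtain ⟨r, f, hf, hgen⟩ := exists_invariant_generators hgr hΓM
  have hsurj : ∀ y ∈ quotVariety f M, ∃ m ∈ M, quotMap f m = y :=
    fun y hy => exists_quotMap_eq hgr hM.zclosed hΓM hf hgen hy
  rw [hHset] at hf hgen
  have hmem : ∀ m ∈ M, quotMap f m ∈ quotVariety f M := fun m hm p hp => hp m hm
  have hfac : ∀ p : MPoly k n, InvariantOn H M p → ∀ m ∈ M, ∀ m' ∈ M,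
      quotMap f m = quotMap f m' → mEval m p = mEval m' p := by
    intro p hp m hm m' hm' h
    obtain ⟨q, hq⟩ := hgen p hp
    rw [hq m hm, hq m' hm', h]
  have hn : ∀ g ∈ unitGroup M, ∀ h ∈ H, ∃ h' ∈ H, g * h = h' * g := by
    rintro g ⟨hg, g', hg', h1, h2⟩ h hh
    refine ⟨_, hnorm g ⟨hg, g', hg', h1, h2⟩ g' ⟨hg', g, hg, h2, h1⟩ h1 h2 h hh, ?_⟩
    rw [mul_assoc, h2, mul_one]
  have hinv : ∀ p : MPoly k n, InvariantOn H M p → ∀ h ∈ H, ∀ a ∈ M, ∀ b ∈ M,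
      mEval (a * (h * b)) p = mEval (a * b) p :=
    fun p hp h hh a ha b hb => mEval_mul_mul_of_invariantOn hM hMirr hn hp ha hh hb
  have hcomul : ∀ i, ∃ μ : MvPolynomial (Fin r ⊕ Fin r) k, ∀ a ∈ M, ∀ b ∈ M,
      eval (Sum.elim (quotMap f a) (quotMap f b)) μ = mEval (a * b) (f i) := by
    intro i
    obtain ⟨N, P, Q, hPQ⟩ := exists_eval_quotMap_eq
      (fun h hh m hm => hM.mul_mem _ (hHM hh) _ hm) hgen (p := f i)
      (fun h hh a ha b hb => by rw [mul_assoc, hf i h hh _ (hM.mul_mem _ ha _ hb)]) (hinv _ (hf i))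
    refine ⟨∑ l, rename Sum.inl (P l) * rename Sum.inr (Q l), fun a ha b hb => ?_⟩
    simp [hPQ a ha b hb, eval_rename, qEval]
  choose μ hμ using hcomul
  have hmul : ∀ a ∈ M, ∀ b ∈ M, mulMap μ (quotMap f a) (quotMap f b) = quotMap f (a * b) :=
    fun a ha b hb => _root_.funext fun i => hμ i a ha b hb
  obtain ⟨p₁, hp₁, hp₁0, hp₁1⟩ := exists_invariant_separating hgr hΓM
    (Z₁ := {x : Mat k n | mEval x detMPoly = 0} ∩ M) (Z₂ := H)
    ((zClosed_zeroLocus _).inter hM.zclosed) hHz Set.inter_subset_right hHM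
    (fun h m hm => ⟨by
      rw [Set.mem_ofPred_eq, mEval_detMPoly, Matrix.det_mul, ← mEval_detMPoly m, hm.1, mul_zero],
      hΓM h m hm.2⟩) (fun h m hm => hH.2.2.1 _ h.2 _ hm) (by
      rw [Set.disjoint_left]
      rintro x ⟨hx, hxM⟩ hxH
      rw [Set.mem_ofPred_eq, mEval_detMPoly] at hx
      exact ((mem_unitGroup_iff hM).1 (hH.1 hxH)).2 hx)
  rw [hHset] at hp₁
  replace hp₁0 : ∀ m ∈ M, m.det = 0 → mEval m p₁ = 0 := fun m hm h =>
    hp₁0 m ⟨(mEval_detMPoly m).trans h, hm⟩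
  have hp₁one : mEval 1 p₁ ≠ 0 := by
    rw [hp₁1 1 hH.2.1]
    exact one_ne_zero
  refine ⟨r, f, hf, hgen, μ, ?_, ?_, ?_, hmul, ?_, ?_, ?_⟩
  · intro y hy y' hy'
    obtain ⟨a, ha, rfl⟩ := hsurj y hy
    obtain ⟨b, hb, rfl⟩ := hsurj y' hy'
    rw [hmul a ha b hb]
    exact hmem _ (hM.mul_mem _ ha _ hb)
  · intro y hy
    obtain ⟨a, ha, rfl⟩ := hsurj y hy
    rw [hmul 1 hM.one_mem a ha, hmul a ha 1 hM.one_mem, one_mul, mul_one]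
    exact ⟨rfl, rfl⟩
  · intro y hy y' hy' y'' hy''
    obtain ⟨a, ha, rfl⟩ := hsurj y hy
    obtain ⟨b, hb, rfl⟩ := hsurj y' hy'
    obtain ⟨c, hc, rfl⟩ := hsurj y'' hy''
    rw [hmul a ha b hb, hmul b hb c hc, hmul _ (hM.mul_mem _ ha _ hb) c hc,
      hmul a ha _ (hM.mul_mem _ hb _ hc), mul_assoc]
  · ext y
    constructor
    · rintro ⟨hy, v, hv, hyv, -⟩
      obtain ⟨a, ha, rfl⟩ := hsurj y hy
      obtain ⟨b, hb, rfl⟩ := hsurj v hv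
      rw [hmul a ha b hb] at hyv
      refine ⟨a, (mem_unitGroup_iff hM).2 ⟨ha, fun h0 => hp₁one ?_⟩, rfl⟩
      rw [← hfac p₁ hp₁ _ (hM.mul_mem _ ha _ hb) 1 hM.one_mem hyv]
      exact hp₁0 _ (hM.mul_mem _ ha _ hb) (by rw [Matrix.det_mul, h0, zero_mul])
    · rintro ⟨g, ⟨hg, g', hg', h1, h2⟩, rfl⟩
      exact ⟨hmem g hg, _, hmem g' hg', by rw [hmul g hg g' hg', h1],
        by rw [hmul g' hg' g hg, h2]⟩
  · intro g hg g' hg'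
    constructor
    · intro h
      obtain ⟨x, hx, hxg⟩ := exists_mul_of_invariants_eq hgr hM (hHset.symm ▸ hHM)
        (hHset.symm ▸ hHz) hg hg' fun p hp => hfac p (hHset ▸ hp) g hg.1 g' hg'.1 h
      exact ⟨x, hHset ▸ hx, hxg⟩
    · rintro ⟨h, hh, rfl⟩
      exact _root_.funext fun i => (hf i h hh g hg.1).symm
  · intro p q hq hpq
    obtain ⟨D, hD, hD0, hDG⟩ := exists_invariant_ne_zero_iff hM hinv hp₁ hp₁one hp₁0
    obtain ⟨P, Q, hP, hQ, hQG, hPQ⟩ := exists_invariant_fraction hM hMirr hH.1 hD hD0 hDG hq hpq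
    obtain ⟨P', hP'⟩ := hgen P hP
    obtain ⟨Q', hQ'⟩ := hgen Q hQ
    refine ⟨P', Q', fun g hg => ?_, fun g hg => ?_⟩
    · rw [← hQ' g hg.1]
      exact hQG g hg
    · rw [← hQ' g hg.1, ← hP' g hg.1]
      exact hPQ g hg

end AlgebraicMonoid
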